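/- arXiv:1611.02231 — 3 statements merged into one kernel-verified Lean document; each statement's English description precedes it below -/
import Mathlib

section
/- Suppose that every 5-edge-connected graph is Z_3-connected. Then every graph that contains 3 pairwise edge-disjoint spanning trees is Z_3-connected. -/
/-- A finite loopless multigraph on vertex type `V` with edge type `E`:
each edge `e` is given by its two (distinct) endpoints `fst e` and `snd e`.
Multiple edges are allowed, loops are not. -/
structure Multigraph (V : Type) (E : Type) where
  fst : E → V
  snd : E → V
  loopless : ∀ e, fst e ≠ snd e

namespace Multigraph

variable {V E : Type} (G : Multigraph V E)

/-- `u` and `v` are joined by some edge belonging to the edge set `F`. -/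
def AdjOn (F : Set E) (u v : V) : Prop :=
  ∃ e ∈ F, (G.fst e = u ∧ G.snd e = v) ∨ (G.fst e = v ∧ G.snd e = u)

/-- The subgraph with vertex set `S` and edge set `F` is a connected spanning
subgraph of the induced subgraph of `G` on `S`: all edges of `F` have both
endpoints in `S`, and any two vertices of `S` are joined by a walk using
edges of `F`. -/
def ConnectedWithin (S : Set V) (F : Set E) : Prop :=
  (∀ e ∈ F, G.fst e ∈ S ∧ G.snd e ∈ S) ∧
    ∀ u ∈ S, ∀ v ∈ S, Relation.ReflTransGen (G.AdjOn F) u v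

/-- The spanning subgraph of `G` with edge set `F` is connected. -/
def ConnectedOn (F : Set E) : Prop := G.ConnectedWithin Set.univ F

/-- `G` is a connected graph. -/
def Connected : Prop := G.ConnectedOn Set.univ

/-- `F` is the edge set of a spanning tree of the induced subgraph of `G`
on `S`, i.e. a minimal edge set making `S` connected. -/
def IsSpanningTreeWithin (S : Set V) (F : Set E) : Prop :=
  G.ConnectedWithin S F ∧ ∀ F' ⊆ F, G.ConnectedWithin S F' → F' = F

/-- `F` is the edge set of a spanning tree of `G`:
a minimal edge set making `G` connected. -/
def IsSpanningTree (F : Set E) : Prop := G.IsSpanningTreeWithin Set.univ F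

/-- `G` contains `t` pairwise edge-disjoint spanning trees. -/
def HasEdgeDisjointSpanningTrees (t : ℕ) : Prop :=
  ∃ T : Fin t → Set E, (∀ i, G.IsSpanningTree (T i)) ∧
    ∀ i j, i ≠ j → Disjoint (T i) (T j)

/-- The edge cut determined by the vertex set `S`: all edges with exactly
one endpoint in `S`. -/
def cutEdges (S : Set V) : Set E :=
  {e | (G.fst e ∈ S ∧ G.snd e ∉ S) ∨ (G.fst e ∉ S ∧ G.snd e ∈ S)}

/-- `G` is `n`-edge-connected: it is connected and every edge cut has at
least `n` edges. -/
def EdgeConnected (n : ℕ) : Prop :=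
  G.Connected ∧
    ∀ S : Set V, S.Nonempty → S ≠ Set.univ → n ≤ (G.cutEdges S).ncard

/-- An orientation of `G` is a map `o : E → Bool`: `o e = true` means `e` is
directed from `fst e` to `snd e`, and `o e = false` means the reverse.
`tail o e` is the initial vertex of `e` under the orientation `o`. -/
def tail (o : E → Bool) (e : E) : V := if o e then G.fst e else G.snd e

/-- The terminal vertex of the edge `e` under the orientation `o`. -/
def head (o : E → Bool) (e : E) : V := if o e then G.snd e else G.fst e

/-- The number of edges belonging to `F` directed away from `v` by `o`. -/
noncomputable def outDegOn (F : Set E) (o : E → Bool) (v : V) : ℕ :=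
  {e ∈ F | G.tail o e = v}.ncard

/-- The out-degree of `v` under the orientation `o`. -/
noncomputable def outDeg (o : E → Bool) (v : V) : ℕ := G.outDegOn Set.univ o v

/-- The in-degree of `v` under the orientation `o`. -/
noncomputable def inDeg (o : E → Bool) (v : V) : ℕ := {e | G.head o e = v}.ncard

/-- The degree of `v` in the spanning subgraph with edge set `F`
(there are no loops, so each edge at `v` counts once). -/
noncomputable def degOn (F : Set E) (v : V) : ℕ := {e ∈ F | G.fst e = v ∨ G.snd e = v}.ncard

/-- `o` is an `f`-orientation of `G` (modulo `k`): the out-degree of every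
vertex `v` is congruent to `f v` modulo `k`. -/
def IsModOrientation (k : ℕ) (f : V → ZMod k) (o : E → Bool) : Prop :=
  ∀ v, (G.outDeg o v : ZMod k) = f v

/-- `G` is `Z_3`-connected: for every `f : V → ZMod 3` with
`|E(G)| ≡ ∑ v, f v (mod 3)`, `G` has an `f`-orientation. -/
def Z3Connected [Fintype V] [Fintype E] : Prop :=
  ∀ f : V → ZMod 3, (Nat.card E : ZMod 3) = ∑ v, f v →
    ∃ o : E → Bool, G.IsModOrientation 3 f o

/-- `G` is a simple graph: no two distinct edges have the same endpoints
(and there are no loops, by definition of `Multigraph`). -/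
def IsSimple : Prop :=
  ∀ e e' : E, s(G.fst e, G.snd e) = s(G.fst e', G.snd e') → e = e'

/-- `G` admits a decomposition of its edge set into stars with `k` edges:
a partition of `E` into parts, each consisting of `k` edges sharing a
common center vertex. -/
def HasStarDecomposition (k : ℕ) : Prop :=
  ∃ P : Set (Set E), (∀ e : E, ∃! p, p ∈ P ∧ e ∈ p) ∧
    ∀ p ∈ P, ∃ c : V, (∀ e ∈ p, G.fst e = c ∨ G.snd e = c) ∧ p.ncard = k

end Multigraph

namespace Multigraph

variable {V E : Type} (G : Multigraph V E)

/-- The edges of `G` with both endpoints in `S`. -/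
def inducedEdges (S : Set V) : Set E := {e | G.fst e ∈ S ∧ G.snd e ∈ S}

/-- The induced subgraph of `G` on `S` has three disjoint connected spanning edge sets. -/
def HasTriplePacking (S : Set V) : Prop :=
  ∃ T : Fin 3 → Set E, (∀ i, G.ConnectedWithin S (T i)) ∧ ∀ i j, i ≠ j → Disjoint (T i) (T j)

open Classical in
/-- The induced subgraph of `G` on `S` is `Z₃`-connected. -/
def Z3ConnectedWithin [Fintype V] (S : Set V) : Prop :=
  ∀ f : V → ZMod 3, ((G.inducedEdges S).ncard : ZMod 3) = ∑ v with v ∈ S, f v →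
    ∃ o : E → Bool, ∀ v ∈ S, (G.outDegOn (G.inducedEdges S) o v : ZMod 3) = f v

/-- The induced subgraph of `G` on `S`, as a multigraph in its own right. -/
def induce (S : Set V) : Multigraph S (G.inducedEdges S) where
  fst e := ⟨G.fst e, e.2.1⟩
  snd e := ⟨G.snd e, e.2.2⟩
  loopless e h := G.loopless e (congrArg Subtype.val h)

variable {G}

theorem adjOn_symm {F : Set E} {u v : V} (h : G.AdjOn F u v) : G.AdjOn F v u := by
  obtain ⟨e, he, h⟩ := h
  exact ⟨e, he, h.symm⟩

theorem adjOn_mono {F F' : Set E} (hF : F ⊆ F') {u v : V} (h : G.AdjOn F u v) :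
    G.AdjOn F' u v := by
  obtain ⟨e, he, h⟩ := h
  exact ⟨e, hF he, h⟩

theorem reach_symm {F : Set E} {u v : V} (h : Relation.ReflTransGen (G.AdjOn F) u v) :
    Relation.ReflTransGen (G.AdjOn F) v u := by
  induction h with
  | refl => exact .refl
  | tail _ hbc ih => exact .head (adjOn_symm hbc) ih

theorem cutEdges_compl (S : Set V) : G.cutEdges Sᶜ = G.cutEdges S := by
  ext e; simp [cutEdges]; tauto

theorem reach_induce {S : Set V} {T : Set E} (hT : ∀ e ∈ T, G.fst e ∈ S ∧ G.snd e ∈ S)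
    {u v : V} (hu : u ∈ S) (h : Relation.ReflTransGen (G.AdjOn T) u v) :
    ∃ hv : v ∈ S, Relation.ReflTransGen
      ((G.induce S).AdjOn (Subtype.val ⁻¹' T)) ⟨u, hu⟩ ⟨v, hv⟩ := by
  induction h with
  | refl => exact ⟨hu, .refl⟩
  | @tail b c _ hbc ih =>
    obtain ⟨hb, ih⟩ := ih
    obtain ⟨e, he, h⟩ := hbc
    have hc : c ∈ S := by
      rcases h with ⟨_, rfl⟩ | ⟨rfl, _⟩
      exacts [(hT e he).2, (hT e he).1]
    refine ⟨hc, ih.tail ⟨⟨e, hT e he⟩, he, ?_⟩⟩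
    simpa [induce] using h

theorem HasTriplePacking.induce {S : Set V} (h : G.HasTriplePacking S) :
    (G.induce S).HasTriplePacking Set.univ := by
  obtain ⟨T, hT, hd⟩ := h
  refine ⟨fun i => Subtype.val ⁻¹' T i, fun i => ⟨by simp, ?_⟩,
    fun i j hij => (hd i j hij).preimage _⟩
  rintro ⟨u, hu⟩ - ⟨v, hv⟩ -
  exact (reach_induce (hT i).1 hu ((hT i).2 u hu v hv)).2

open Classical in
theorem z3ConnectedWithin_of_induce [Fintype V] [Fintype E] {S : Set V}
    (h : (G.induce S).Z3Connected) : G.Z3ConnectedWithin S := by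
  intro f hf
  obtain ⟨o, ho⟩ := h (fun v => f v) (by
    rw [Nat.card_coe_set_eq, hf]
    exact Finset.sum_subtype _ (by simp) f)
  refine ⟨fun e => if he : e ∈ G.inducedEdges S then o ⟨e, he⟩ else true, fun v hv => ?_⟩
  refine Eq.trans ?_ (ho ⟨v, hv⟩)
  rw [outDeg, outDegOn, outDegOn, ← Set.ncard_image_of_injective {e | e ∈ Set.univ ∧ _}
    Subtype.val_injective]
  congr 2
  ext e
  simp only [Set.mem_ofPred_eq, Set.mem_image, Set.mem_univ, true_and, Subtype.exists,
    exists_and_right, exists_eq_right]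
  have htail (he : e ∈ G.inducedEdges S) : ((G.induce S).tail o ⟨e, he⟩ : V) =
      G.tail (fun e => if he : e ∈ G.inducedEdges S then o ⟨e, he⟩ else true) e := by
    simp only [tail, Multigraph.induce, he, dite_true]
    split_ifs <;> rfl
  constructor
  · rintro ⟨he, h⟩
    exact ⟨he, Subtype.ext ((htail he).trans h)⟩
  · rintro ⟨he, h⟩
    exact ⟨he, (htail he).symm.trans (congrArg Subtype.val h)⟩

open Classical in
theorem sum_outDegOn [Fintype V] [Fintype E] (F : Set E) (o : E → Bool) (S : Set V) :
    ∑ v with v ∈ S, G.outDegOn F o v = {e ∈ F | G.tail o e ∈ S}.ncard := by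
  have h := Finset.card_eq_sum_card_fiberwise (s := {e | e ∈ F ∧ G.tail o e ∈ S})
    (t := {v | v ∈ S}) (f := G.tail o) (by intro e; simp)
  rw [Set.ncard_eq_toFinset_card', Set.toFinset_ofPred, h]
  refine Finset.sum_congr rfl fun v hv => ?_
  rw [outDegOn, Set.ncard_eq_toFinset_card', Set.toFinset_ofPred, Finset.filter_filter]
  congr 1
  ext e
  simp only [Finset.mem_filter, Finset.mem_univ, true_and] at hv ⊢
  constructor
  · rintro ⟨h1, rfl⟩; exact ⟨⟨h1, hv⟩, rfl⟩
  · rintro ⟨⟨h1, _⟩, h2⟩; exact ⟨h1, h2⟩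

theorem outDegOn_union [Finite E] {F F' : Set E} (h : Disjoint F F') (o : E → Bool) (v : V) :
    G.outDegOn (F ∪ F') o v = G.outDegOn F o v + G.outDegOn F' o v := by
  rw [outDegOn, outDegOn, outDegOn, ← Set.ncard_union_eq _ (Set.toFinite _) (Set.toFinite _)]
  · congr 1
    ext e
    simp only [Set.mem_ofPred_eq, Set.mem_union]
    tauto
  · exact h.mono (fun e he => he.1) (fun e he => he.1)

theorem outDegOn_congr {F : Set E} {o o' : E → Bool} (h : ∀ e ∈ F, o e = o' e) (v : V) :
    G.outDegOn F o v = G.outDegOn F o' v := by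
  rw [outDegOn, outDegOn]
  congr 1
  ext e
  simp only [Set.mem_ofPred_eq]
  refine and_congr_right fun he => ?_
  simp [tail, h e he]

open Classical in
/-- Contraction principle: an orientation that is correct outside `S` can be corrected inside `S`
when the induced subgraph on `S` is `Z₃`-connected. -/
theorem Z3ConnectedWithin.extend [Fintype V] [Fintype E] {S : Set V}
    (hS : G.Z3ConnectedWithin S) {f : V → ZMod 3} (hf : (Nat.card E : ZMod 3) = ∑ v, f v)
    {o : E → Bool} (ho : ∀ v ∉ S, (G.outDeg o v : ZMod 3) = f v) :
    ∃ o' : E → Bool, G.IsModOrientation 3 f o' := by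
  set F := G.inducedEdges S with hF
  have hsplit (o : E → Bool) (v : V) : G.outDeg o v = G.outDegOn F o v + G.outDegOn Fᶜ o v := by
    rw [outDeg, ← outDegOn_union disjoint_compl_right, Set.union_compl_self]
  have hzero (o : E → Bool) (v : V) (hv : v ∉ S) : G.outDegOn F o v = 0 := by
    rw [outDegOn, Set.ncard_eq_zero]
    ext e
    simp only [Set.mem_ofPred_eq, Set.mem_empty_iff_false, iff_false]
    rintro ⟨he, rfl⟩
    apply hv
    rw [tail]
    split_ifs
    exacts [he.1, he.2]
  have htot : ∑ v, (G.outDegOn Fᶜ o v : ZMod 3) = (Fᶜ.ncard : ZMod 3) := by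
    have := G.sum_outDegOn Fᶜ o Set.univ
    simp only [Set.mem_univ, Finset.filter_true, and_true, Set.ofPred_mem_eq] at this
    rw [← this]
    push_cast
    rfl
  have hout : ∑ v with v ∉ S, (G.outDegOn Fᶜ o v : ZMod 3) = ∑ v with v ∉ S, f v := by
    refine Finset.sum_congr rfl fun v hv => ?_
    have hv : v ∉ S := by simpa using hv
    rw [← ho v hv, hsplit, hzero o v hv, zero_add]
  obtain ⟨o', ho'⟩ := hS (fun v => f v - G.outDegOn Fᶜ o v) (by
    have h1 := Finset.sum_filter_add_sum_filter_not Finset.univ (· ∈ S) f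
    have h2 := Finset.sum_filter_add_sum_filter_not Finset.univ (· ∈ S)
      (fun v => (G.outDegOn Fᶜ o v : ZMod 3))
    have h3 : ((F.ncard + Fᶜ.ncard : ℕ) : ZMod 3) = Nat.card E := by
      rw [Set.ncard_add_ncard_compl]
    push_cast at h3
    rw [Finset.sum_sub_distrib]
    linear_combination h3 + hf - h1 + h2 - hout + htot)
  refine ⟨fun e => if e ∈ F then o' e else o e, fun v => ?_⟩
  rw [hsplit, outDegOn_congr (F := F) (o' := o') (by simp +contextual),
    outDegOn_congr (F := Fᶜ) (o' := o) (by simp +contextual)]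
  by_cases hv : v ∈ S
  · push_cast
    rw [ho' v hv]
    ring
  · rw [hzero o' v hv, ← hzero o v hv, ← hsplit, ho v hv]

open Classical in
theorem exists_sum_outDegOn_eq [Fintype V] [Fintype E] {S : Set V} {D : Set E}
    (hD : D ⊆ G.cutEdges S) (hcard : 2 ≤ D.ncard) (x : ZMod 3) :
    ∃ o : E → Bool, ∑ v with v ∈ S, (G.outDegOn D o v : ZMod 3) = x := by
  have hx : x.val < 3 := x.val_lt
  obtain ⟨D', hD', hD'card⟩ := Set.exists_subset_card_eq (s := D) (n := x.val) (by omega)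
  refine ⟨fun e => decide (G.fst e ∈ S ↔ e ∈ D'), ?_⟩
  rw [← Nat.cast_sum, sum_outDegOn]
  suffices h : {e ∈ D | G.tail (fun e => decide (G.fst e ∈ S ↔ e ∈ D')) e ∈ S} = D' by
    rw [h, hD'card, ZMod.natCast_zmod_val]
  ext e
  simp only [Set.mem_ofPred_eq, tail, decide_eq_true_eq]
  constructor
  · rintro ⟨he, h⟩
    have := hD he
    simp only [cutEdges, Set.mem_ofPred_eq] at this
    split_ifs at h <;> tauto
  · intro he
    have := hD (hD' he)
    simp only [cutEdges, Set.mem_ofPred_eq] at this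
    refine ⟨hD' he, ?_⟩
    split_ifs <;> tauto

theorem disjoint_inducedEdges_cutEdges (S : Set V) :
    Disjoint (G.inducedEdges S) (G.cutEdges S) := by
  rw [Set.disjoint_left]
  rintro e ⟨h1, h2⟩ h
  simp only [cutEdges, Set.mem_ofPred_eq] at h
  tauto

open Classical in
theorem Z3ConnectedWithin.exists_outDegOn_union [Fintype V] [Fintype E] {S : Set V}
    (hS : G.Z3ConnectedWithin S) {D : Set E} (hD : D ⊆ G.cutEdges S) (hcard : 2 ≤ D.ncard)
    (f : V → ZMod 3) :
    ∃ o : E → Bool, ∀ v ∈ S, (G.outDegOn (G.inducedEdges S ∪ D) o v : ZMod 3) = f v := by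
  have hdisj : Disjoint (G.inducedEdges S) D :=
    (G.disjoint_inducedEdges_cutEdges S).mono_right hD
  obtain ⟨o, ho⟩ := exists_sum_outDegOn_eq hD hcard
    ((∑ v with v ∈ S, f v) - (G.inducedEdges S).ncard)
  obtain ⟨o', ho'⟩ := hS (fun v => f v - G.outDegOn D o v) (by
    rw [Finset.sum_sub_distrib, ho]
    ring)
  refine ⟨fun e => if e ∈ D then o e else o' e, fun v hv => ?_⟩
  rw [outDegOn_union hdisj, outDegOn_congr (F := D) (o' := o) (by simp +contextual),
    outDegOn_congr (F := G.inducedEdges S) (o' := o')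
      (fun e he => if_neg (Set.disjoint_left.1 hdisj he))]
  push_cast
  rw [ho' v hv]
  ring

/-- A walk starting in `S` either stays in `S` or reaches, inside `S`, an end of a cut edge. -/
theorem reach_within_or_cut {S : Set V} {T : Set E} {u v : V} (hu : u ∈ S)
    (h : Relation.ReflTransGen (G.AdjOn T) u v) :
    (v ∈ S ∧ Relation.ReflTransGen (G.AdjOn (T ∩ G.inducedEdges S)) u v) ∨
      ∃ e ∈ T ∩ G.cutEdges S, ∃ a ∈ S, (G.fst e = a ∨ G.snd e = a) ∧
        Relation.ReflTransGen (G.AdjOn (T ∩ G.inducedEdges S)) u a := by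
  induction h with
  | refl => exact .inl ⟨hu, .refl⟩
  | @tail b c _ hbc ih =>
    refine ih.elim ?_ .inr
    rintro ⟨hb, hr⟩
    obtain ⟨e, he, h⟩ := hbc
    by_cases hc : c ∈ S
    · refine .inl ⟨hc, hr.tail ⟨e, ⟨he, ?_⟩, h⟩⟩
      rcases h with ⟨rfl, rfl⟩ | ⟨rfl, rfl⟩
      exacts [⟨hb, hc⟩, ⟨hc, hb⟩]
    · refine .inr ⟨e, ⟨he, ?_⟩, b, hb, ?_, hr⟩
      · rcases h with ⟨rfl, rfl⟩ | ⟨rfl, rfl⟩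
        exacts [.inl ⟨hb, hc⟩, .inr ⟨hc, hb⟩]
      · tauto

/-- If all `S`-ends of cut edges in `T` can be joined to each other by `R`-walks and `R` contains
adjacency by edges of `T` inside `S`, then `S` is `R`-connected. -/
theorem reach_of_cut_ends {S : Set V} {T : Set E} (hT : G.ConnectedOn T) {R : V → V → Prop}
    (hR : ∀ u v, G.AdjOn (T ∩ G.inducedEdges S) u v → R u v)
    (hends : ∀ e ∈ T ∩ G.cutEdges S, ∀ e' ∈ T ∩ G.cutEdges S, ∀ a ∈ S, ∀ a' ∈ S,
      (G.fst e = a ∨ G.snd e = a) → (G.fst e' = a' ∨ G.snd e' = a') →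
      Relation.ReflTransGen R a a') :
    ∀ u ∈ S, ∀ v ∈ S, Relation.ReflTransGen R u v := by
  intro u hu v hv
  rcases reach_within_or_cut hu (hT.2 u trivial v trivial) with ⟨_, h⟩ | ⟨e, he, a, ha, hea, h⟩
  · exact .mono hR _ _ h
  rcases reach_within_or_cut hv (hT.2 v trivial u trivial) with
    ⟨_, h'⟩ | ⟨e', he', a', ha', hea', h'⟩
  · exact Relation.ReflTransGen.mono hR _ _ (reach_symm h')
  · exact (Relation.ReflTransGen.mono hR _ _ h).trans
      ((hends e he e' he' a ha a' ha' hea hea').trans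
        (Relation.ReflTransGen.mono hR _ _ (reach_symm h')))

theorem eq_of_mem_cutEdges {S : Set V} {e : E} (he : e ∈ G.cutEdges S) {a b : V} (ha : a ∈ S)
    (hb : b ∈ S) (hea : G.fst e = a ∨ G.snd e = a) (heb : G.fst e = b ∨ G.snd e = b) :
    a = b := by
  rcases he with ⟨_, h⟩ | ⟨h, _⟩ <;> rcases hea with rfl | rfl <;> rcases heb with rfl | rfl <;>
    first | rfl | exact absurd ‹_› h

theorem exists_cutEdge_ends {S : Set V} {e : E} (he : e ∈ G.cutEdges S) :
    ∃ a ∈ S, ∃ b ∉ S, (G.fst e = a ∧ G.snd e = b) ∨ (G.fst e = b ∧ G.snd e = a) := by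
  rcases he with ⟨h1, h2⟩ | ⟨h1, h2⟩
  · exact ⟨_, h1, _, h2, .inl ⟨rfl, rfl⟩⟩
  · exact ⟨_, h2, _, h1, .inr ⟨rfl, rfl⟩⟩

theorem ConnectedOn.within_of_subsingleton {S : Set V} {T : Set E} (hT : G.ConnectedOn T)
    (h : (T ∩ G.cutEdges S).Subsingleton) : G.ConnectedWithin S (T ∩ G.inducedEdges S) := by
  refine ⟨fun e he => he.2, reach_of_cut_ends hT (fun _ _ => id) ?_⟩
  intro e he e' he' a ha a' ha' hea hea'
  obtain rfl := h he he'
  rw [eq_of_mem_cutEdges he.2 ha ha' hea hea']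

/-- A connected edge set crossing a cut at most twice is connected on at least one side. -/
theorem ConnectedOn.within_or_within_compl {S : Set V} {T : Set E} (hT : G.ConnectedOn T)
    {e₁ e₂ : E} (h : T ∩ G.cutEdges S = {e₁, e₂}) :
    G.ConnectedWithin S (T ∩ G.inducedEdges S) ∨
      G.ConnectedWithin Sᶜ (T ∩ G.inducedEdges Sᶜ) := by
  have h₁ : e₁ ∈ T ∩ G.cutEdges S := by simp [h]
  have h₂ : e₂ ∈ T ∩ G.cutEdges S := by simp [h]
  obtain ⟨a₁, ha₁, b₁, hb₁, he₁⟩ := exists_cutEdge_ends h₁.2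
  obtain ⟨a₂, ha₂, b₂, hb₂, he₂⟩ := exists_cutEdge_ends h₂.2
  have hside (S' : Set V) (hS' : G.cutEdges S' = G.cutEdges S) (c₁ c₂ : V) (hc₁ : c₁ ∈ S')
      (hc₂ : c₂ ∈ S') (hec₁ : G.fst e₁ = c₁ ∨ G.snd e₁ = c₁)
      (hec₂ : G.fst e₂ = c₂ ∨ G.snd e₂ = c₂)
      (hc : Relation.ReflTransGen (G.AdjOn (T ∩ G.inducedEdges S')) c₁ c₂) :
      G.ConnectedWithin S' (T ∩ G.inducedEdges S') := by
    refine ⟨fun e he => he.2, reach_of_cut_ends hT (fun _ _ => id) ?_⟩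
    rw [hS', h]
    rw [← hS'] at h₁ h₂
    rintro e (rfl | rfl) e' (rfl | rfl) a ha a' ha' hea hea'
    · rw [eq_of_mem_cutEdges h₁.2 ha ha' hea hea']
    · rwa [eq_of_mem_cutEdges h₁.2 ha hc₁ hea hec₁, eq_of_mem_cutEdges h₂.2 ha' hc₂ hea' hec₂]
    · rw [eq_of_mem_cutEdges h₁.2 ha' hc₁ hea' hec₁, eq_of_mem_cutEdges h₂.2 ha hc₂ hea hec₂]
      exact reach_symm hc
    · rw [eq_of_mem_cutEdges h₂.2 ha ha' hea hea']
  by_contra! hcon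
  have hA : ¬ Relation.ReflTransGen (G.AdjOn (T ∩ G.inducedEdges S)) a₁ a₂ := fun hc =>
    hcon.1 (hside S rfl a₁ a₂ ha₁ ha₂ (by tauto) (by tauto) hc)
  have hB : ¬ Relation.ReflTransGen (G.AdjOn (T ∩ G.inducedEdges Sᶜ)) b₁ b₂ := fun hc =>
    hcon.2 (hside Sᶜ (cutEdges_compl S) b₁ b₂ hb₁ hb₂ (by tauto) (by tauto) hc)
  have key (w : V) (hw : Relation.ReflTransGen (G.AdjOn T) a₁ w) :
      (w ∈ S ∧ Relation.ReflTransGen (G.AdjOn (T ∩ G.inducedEdges S)) a₁ w) ∨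
      (w ∉ S ∧ Relation.ReflTransGen (G.AdjOn (T ∩ G.inducedEdges Sᶜ)) b₁ w) := by
    induction hw with
    | refl => exact .inl ⟨ha₁, .refl⟩
    | @tail x y _ hxy ih =>
      obtain ⟨e, he, hexy⟩ := hxy
      by_cases hcut : e ∈ G.cutEdges S
      · have hmem : e ∈ T ∩ G.cutEdges S := ⟨he, hcut⟩
        rw [h] at hmem
        rcases hmem with rfl | rfl
        · have : (x = a₁ ∧ y = b₁) ∨ (x = b₁ ∧ y = a₁) := by grind
          rcases this with ⟨rfl, rfl⟩ | ⟨rfl, rfl⟩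
          · exact .inr ⟨hb₁, .refl⟩
          · exact .inl ⟨ha₁, .refl⟩
        · have : (x = a₂ ∧ y = b₂) ∨ (x = b₂ ∧ y = a₂) := by grind
          rcases this with ⟨rfl, rfl⟩ | ⟨rfl, rfl⟩ <;> tauto
      · have hx : x ∈ S ↔ y ∈ S := by
          simp only [cutEdges, Set.mem_ofPred_eq] at hcut
          rcases hexy with ⟨rfl, rfl⟩ | ⟨rfl, rfl⟩ <;> tauto
        rcases ih with ⟨hxS, ih⟩ | ⟨hxS, ih⟩
        · refine .inl ⟨hx.1 hxS, ih.tail ⟨e, ⟨he, ?_⟩, hexy⟩⟩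
          rcases hexy with ⟨rfl, rfl⟩ | ⟨rfl, rfl⟩
          exacts [⟨hxS, hx.1 hxS⟩, ⟨hx.1 hxS, hxS⟩]
        · have hyS : y ∉ S := fun hy => hxS (hx.2 hy)
          refine .inr ⟨hyS, ih.tail ⟨e, ⟨he, ?_⟩, hexy⟩⟩
          rcases hexy with ⟨rfl, rfl⟩ | ⟨rfl, rfl⟩
          exacts [⟨hxS, hyS⟩, ⟨hyS, hxS⟩]
  rcases key a₂ (hT.2 a₁ trivial a₂ trivial) with h' | h'
  exacts [hA h'.2, h'.1 ha₂]

theorem ConnectedOn.inter_cutEdges_nonempty {S : Set V} {T : Set E} (hT : G.ConnectedOn T)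
    (hS : S.Nonempty) (hS' : S ≠ Set.univ) : (T ∩ G.cutEdges S).Nonempty := by
  obtain ⟨u, hu⟩ := hS
  obtain ⟨v, hv⟩ := (Set.ne_univ_iff_exists_notMem S).1 hS'
  rcases reach_within_or_cut hu (hT.2 u trivial v trivial) with ⟨h, _⟩ | ⟨e, he, _⟩
  exacts [absurd h hv, ⟨e, he⟩]

theorem outDegOn_eq_outDeg {S : Set V} {F : Set E} {o : E → Bool}
    (hF : ∀ e, G.tail o e ∈ S → e ∈ F) {v : V} (hv : v ∈ S) :
    G.outDegOn F o v = G.outDeg o v := by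
  rw [outDeg, outDegOn, outDegOn]
  congr 1
  ext e
  simp only [Set.mem_ofPred_eq, Set.mem_univ, true_and, and_iff_right_iff_imp]
  rintro rfl
  exact hF e hv

theorem mem_inducedEdges_union_cutEdges {S : Set V} {o : E → Bool} {e : E}
    (h : G.tail o e ∈ S) : e ∈ G.inducedEdges S ∪ G.cutEdges S := by
  rw [tail] at h
  simp only [inducedEdges, cutEdges, Set.mem_union, Set.mem_ofPred_eq]
  split_ifs at h <;> tauto

theorem Z3ConnectedWithin.z3Connected [Fintype V] [Fintype E] {S : Set V}
    (h : G.Z3ConnectedWithin S) (h' : G.Z3ConnectedWithin Sᶜ)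
    (hcard : 2 ≤ (G.cutEdges S).ncard) : G.Z3Connected := by
  intro f hf
  obtain ⟨o, ho⟩ := h.exists_outDegOn_union subset_rfl hcard f
  refine h'.extend hf (o := o) fun v hv => ?_
  have hv : v ∈ S := by simpa using hv
  rw [← ho v hv, outDegOn_eq_outDeg (fun _ => mem_inducedEdges_union_cutEdges) hv]

open Classical in
variable (G) in
/-- Replace the edge `e` by an edge from `x` to `y`. -/
noncomputable def replaceEdge (e : E) {x y : V} (hxy : x ≠ y) : Multigraph V E where
  fst := Function.update G.fst e x
  snd := Function.update G.snd e y
  loopless e' := by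
    by_cases h : e' = e
    · subst h; simpa
    · simpa [h] using G.loopless e'

section ReplaceEdge

variable {e : E} {x y : V} (hxy : x ≠ y)

@[simp] theorem replaceEdge_fst_self : (G.replaceEdge e hxy).fst e = x := by simp [replaceEdge]

@[simp] theorem replaceEdge_snd_self : (G.replaceEdge e hxy).snd e = y := by simp [replaceEdge]

theorem replaceEdge_fst_of_ne {e' : E} (h : e' ≠ e) :
    (G.replaceEdge e hxy).fst e' = G.fst e' := by simp [replaceEdge, h]

theorem replaceEdge_snd_of_ne {e' : E} (h : e' ≠ e) :
    (G.replaceEdge e hxy).snd e' = G.snd e' := by simp [replaceEdge, h]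

theorem replaceEdge_adjOn {F : Set E} (he : e ∉ F) {u v : V} (h : G.AdjOn F u v) :
    (G.replaceEdge e hxy).AdjOn F u v := by
  obtain ⟨e', he', h⟩ := h
  have hne : e' ≠ e := fun h => he (h ▸ he')
  exact ⟨e', he', by rwa [replaceEdge_fst_of_ne hxy hne, replaceEdge_snd_of_ne hxy hne]⟩

theorem ConnectedWithin.replaceEdge {S : Set V} {F : Set E} (he : e ∉ F)
    (h : G.ConnectedWithin S F) : (G.replaceEdge e hxy).ConnectedWithin S F := by
  refine ⟨fun e' he' => ?_, fun u hu v hv =>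
    Relation.ReflTransGen.mono (fun _ _ => replaceEdge_adjOn hxy he) _ _ (h.2 u hu v hv)⟩
  have hne : e' ≠ e := fun h => he (h ▸ he')
  rw [replaceEdge_fst_of_ne hxy hne, replaceEdge_snd_of_ne hxy hne]
  exact h.1 e' he'

end ReplaceEdge

theorem exists_tail_eq {e : E} {a b : V}
    (he : (G.fst e = a ∧ G.snd e = b) ∨ (G.fst e = b ∧ G.snd e = a)) (c : Bool) :
    ∃ d : Bool, (if d then G.fst e else G.snd e) = if c then a else b := by
  rcases he with ⟨rfl, rfl⟩ | ⟨rfl, rfl⟩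
  · exact ⟨c, rfl⟩
  · exact ⟨!c, by cases c <;> rfl⟩

open Classical in
/-- An orientation of the graph obtained by lifting the two cut edges `e₁`, `e₂` to an edge
`a₁a₂` inside `S` yields an orientation of `G` with the same out-degrees on `S`. -/
theorem exists_outDeg_eq_of_lift {S : Set V} {e₁ e₂ : E} (hne : e₁ ≠ e₂) {a₁ b₁ a₂ b₂ : V}
    (ha₁ : a₁ ∈ S) (hb₁ : b₁ ∉ S) (ha₂ : a₂ ∈ S) (hb₂ : b₂ ∉ S)
    (he₁ : (G.fst e₁ = a₁ ∧ G.snd e₁ = b₁) ∨ (G.fst e₁ = b₁ ∧ G.snd e₁ = a₁))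
    (he₂ : (G.fst e₂ = a₂ ∧ G.snd e₂ = b₂) ∨ (G.fst e₂ = b₂ ∧ G.snd e₂ = a₂))
    (ha : a₁ ≠ a₂) (o : E → Bool) :
    ∃ o' : E → Bool, ∀ v ∈ S, G.outDeg o' v = (G.replaceEdge e₁ ha).outDegOn
      ((G.replaceEdge e₁ ha).inducedEdges S ∪ G.cutEdges S \ {e₁, e₂}) o v := by
  obtain ⟨d₁, hd₁⟩ := exists_tail_eq he₁ (o e₁)
  obtain ⟨d₂, hd₂⟩ := exists_tail_eq he₂ (!o e₁)
  set G' := G.replaceEdge e₁ ha with hG'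
  set o' : E → Bool := fun e => if e = e₁ then d₁ else if e = e₂ then d₂ else o e with ho'
  have h₁ : G.tail o' e₁ = if o e₁ then a₁ else b₁ := by simpa [tail, ho'] using hd₁
  have h₂ : G.tail o' e₂ = if o e₁ then b₂ else a₂ := by
    have h : G.tail o' e₂ = if !o e₁ then a₂ else b₂ := by
      simpa only [tail, ho', hne.symm, if_false, if_true] using hd₂
    rw [h]
    cases o e₁ <;> rfl
  have h₁' : G'.tail o e₁ = if o e₁ then a₁ else a₂ := by simp [tail, hG']
  have hmem₁ : e₁ ∈ G'.inducedEdges S ∪ G.cutEdges S \ {e₁, e₂} :=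
    .inl (by simp [inducedEdges, hG', ha₁, ha₂])
  have hmem₂ : e₂ ∉ G'.inducedEdges S ∪ G.cutEdges S \ {e₁, e₂} := by
    simp only [inducedEdges, hG', Set.mem_union, Set.mem_ofPred_eq,
      replaceEdge_fst_of_ne ha hne.symm, replaceEdge_snd_of_ne ha hne.symm]
    grind
  have hother (v : V) (hv : v ∈ S) (e : E) (hee₁ : e ≠ e₁) (hee₂ : e ≠ e₂) :
      G.tail o' e = v ↔
        e ∈ G'.inducedEdges S ∪ G.cutEdges S \ {e₁, e₂} ∧ G'.tail o e = v := by
    have ht : G'.tail o e = G.tail o' e := by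
      simp [tail, hG', ho', hee₁, hee₂, replaceEdge_fst_of_ne ha hee₁,
        replaceEdge_snd_of_ne ha hee₁]
    rw [ht, iff_and_self]
    rintro rfl
    rcases mem_inducedEdges_union_cutEdges hv with h | h
    · left
      simpa [inducedEdges, hG', replaceEdge_fst_of_ne ha hee₁, replaceEdge_snd_of_ne ha hee₁]
        using h
    · exact .inr ⟨h, by simp [hee₁, hee₂]⟩
  refine ⟨o', fun v hv => ?_⟩
  have hb₁v : b₁ ≠ v := fun h => hb₁ (h ▸ hv)
  have hb₂v : b₂ ≠ v := fun h => hb₂ (h ▸ hv)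
  rw [outDeg, outDegOn, outDegOn]
  cases hoe : o e₁
  · simp only [hoe, Bool.false_eq_true, if_false] at h₁ h₂ h₁'
    rw [← Set.ncard_image_of_injective _ (Equiv.swap e₁ e₂).injective]
    congr 1
    ext e
    rw [Equiv.image_eq_preimage_symm, Equiv.symm_swap]
    simp only [Set.mem_preimage, Set.mem_ofPred_eq, Set.mem_univ, true_and]
    by_cases hee₁ : e = e₁
    · subst hee₁
      simp [h₂, h₁', hmem₁]
    by_cases hee₂ : e = e₂
    · subst hee₂
      simp [h₁, hb₁v, hmem₂]
    rw [Equiv.swap_apply_of_ne_of_ne hee₁ hee₂, hother v hv e hee₁ hee₂]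
  · simp only [hoe, if_true] at h₁ h₂ h₁'
    congr 1
    ext e
    simp only [Set.mem_ofPred_eq, Set.mem_univ, true_and]
    by_cases hee₁ : e = e₁
    · subst hee₁
      simp [h₁, h₁', hmem₁]
    by_cases hee₂ : e = e₂
    · subst hee₂
      simp [h₂, hb₂v, hmem₂]
    rw [hother v hv e hee₁ hee₂]

theorem ConnectedOn.lift {S : Set V} {T : Set E} (hT : G.ConnectedOn T) {e₁ e₂ : E}
    (h : T ∩ G.cutEdges S = {e₁, e₂}) {a₁ a₂ : V} (ha₁ : a₁ ∈ S) (ha₂ : a₂ ∈ S)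
    (he₁ : G.fst e₁ = a₁ ∨ G.snd e₁ = a₁) (he₂ : G.fst e₂ = a₂ ∨ G.snd e₂ = a₂)
    (ha : a₁ ≠ a₂) :
    (G.replaceEdge e₁ ha).ConnectedWithin S (insert e₁ (T ∩ G.inducedEdges S)) := by
  have h₁ : e₁ ∈ T ∩ G.cutEdges S := by simp [h]
  have h₂ : e₂ ∈ T ∩ G.cutEdges S := by simp [h]
  have hni : e₁ ∉ T ∩ G.inducedEdges S := fun hi =>
    Set.disjoint_left.1 (disjoint_inducedEdges_cutEdges S) hi.2 h₁.2
  have hadj : (G.replaceEdge e₁ ha).AdjOn (insert e₁ (T ∩ G.inducedEdges S)) a₁ a₂ :=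
    ⟨e₁, Set.mem_insert _ _, .inl (by simp)⟩
  refine ⟨?_, reach_of_cut_ends hT
    (fun u v huv => adjOn_mono (Set.subset_insert _ _) (replaceEdge_adjOn ha hni huv)) ?_⟩
  · rintro e (rfl | he)
    · simp [ha₁, ha₂]
    · have hne : e ≠ e₁ := fun h => hni (h ▸ he)
      rw [replaceEdge_fst_of_ne ha hne, replaceEdge_snd_of_ne ha hne]
      exact he.2
  · rw [h]
    rintro e (rfl | rfl) e' (rfl | rfl) a haS a' haS' hea hea'
    · rw [eq_of_mem_cutEdges h₁.2 haS haS' hea hea']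
    · rw [eq_of_mem_cutEdges h₁.2 haS ha₁ hea he₁, eq_of_mem_cutEdges h₂.2 haS' ha₂ hea' he₂]
      exact .single hadj
    · rw [eq_of_mem_cutEdges h₁.2 haS' ha₁ hea' he₁, eq_of_mem_cutEdges h₂.2 haS ha₂ hea he₂]
      exact .single (adjOn_symm hadj)
    · rw [eq_of_mem_cutEdges h₂.2 haS haS' hea hea']

theorem hasTriplePacking_of_inter {S : Set V} {T : Fin 3 → Set E}
    (hd : ∀ i j, i ≠ j → Disjoint (T i) (T j))
    (hT : ∀ i, G.ConnectedWithin S (T i ∩ G.inducedEdges S)) : G.HasTriplePacking S :=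
  ⟨_, hT, fun i j hij => (hd i j hij).mono Set.inter_subset_left Set.inter_subset_left⟩

/-- The case of a cut crossed twice by one of the trees, which is connected on the far side. -/
theorem z3Connected_of_crossing_twice [Fintype V] [Fintype E] {S : Set V}
    (ih : ∀ G' : Multigraph V E, G'.HasTriplePacking S → G'.Z3ConnectedWithin S)
    (ih' : G.HasTriplePacking Sᶜ → G.Z3ConnectedWithin Sᶜ)
    {T : Fin 3 → Set E} (hT : ∀ i, G.ConnectedOn (T i))
    (hd : ∀ i j, i ≠ j → Disjoint (T i) (T j)) {i j k : Fin 3} (hij : i ≠ j) (hik : i ≠ k)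
    (hjk : j ≠ k) (hall : ∀ l, l = i ∨ l = j ∨ l = k)
    (hj : (T j ∩ G.cutEdges S).ncard = 1) (hk : (T k ∩ G.cutEdges S).ncard = 1)
    {e₁ e₂ : E} (hne : e₁ ≠ e₂) (hi : T i ∩ G.cutEdges S = {e₁, e₂})
    (hcon : G.ConnectedWithin Sᶜ (T i ∩ G.inducedEdges Sᶜ)) : G.Z3Connected := by
  have h₁ : e₁ ∈ T i ∩ G.cutEdges S := by simp [hi]
  have h₂ : e₂ ∈ T i ∩ G.cutEdges S := by simp [hi]
  obtain ⟨a₁, ha₁, b₁, hb₁, he₁⟩ := exists_cutEdge_ends h₁.2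
  obtain ⟨a₂, ha₂, b₂, hb₂, he₂⟩ := exists_cutEdge_ends h₂.2
  have hsub (l : Fin 3) (hl : l ≠ i) : (T l ∩ G.cutEdges S).Subsingleton := by
    have hl1 : (T l ∩ G.cutEdges S).ncard = 1 := by
      rcases hall l with rfl | rfl | rfl
      exacts [absurd rfl hl, hj, hk]
    obtain ⟨e, he⟩ := Set.ncard_eq_one.1 hl1
    simp [he]
  have hcompl : G.Z3ConnectedWithin Sᶜ := by
    refine ih' (hasTriplePacking_of_inter hd fun l => ?_)
    by_cases hl : l = i
    · rwa [hl]
    · exact (hT l).within_of_subsingleton (by rw [cutEdges_compl]; exact hsub l hl)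
  by_cases ha : a₁ = a₂
  · have hS : G.Z3ConnectedWithin S := by
      refine ih G (hasTriplePacking_of_inter hd fun l => ?_)
      by_cases hl : l = i
      · subst hl
        refine ⟨fun e he => he.2, reach_of_cut_ends (hT l) (fun _ _ => id) ?_⟩
        have hend (e : E) (he : e ∈ T l ∩ G.cutEdges S) (a : V) (haS : a ∈ S)
            (hea : G.fst e = a ∨ G.snd e = a) : a = a₁ := by
          have he' := he
          rw [hi] at he'
          rcases he' with rfl | rfl
          · exact eq_of_mem_cutEdges he.2 haS ha₁ hea (by tauto)
          · exact ha ▸ eq_of_mem_cutEdges he.2 haS ha₂ hea (by tauto)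
        intro e he e' he' a haS a' haS' hea hea'
        rw [hend e he a haS hea, hend e' he' a' haS' hea']
      · exact (hT l).within_of_subsingleton (hsub l hl)
    refine hS.z3Connected hcompl ?_
    rw [← Set.ncard_pair hne, ← hi]
    exact Set.ncard_le_ncard Set.inter_subset_right
  set G' := G.replaceEdge e₁ ha with hG'
  have hS : G'.Z3ConnectedWithin S := by
    refine ih G' ⟨fun l => if l = i then insert e₁ (T i ∩ G.inducedEdges S)
      else T l ∩ G.inducedEdges S, fun l => ?_, ?_⟩
    · by_cases hl : l = i
      · simp only [hl, if_true]
        exact (hT i).lift hi ha₁ ha₂ (by tauto) (by tauto) ha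
      · simp only [hl, if_false]
        exact ((hT l).within_of_subsingleton (hsub l hl)).replaceEdge ha fun h =>
          Set.disjoint_left.1 (hd l i hl) h.1 h₁.1
    · have hle (l : Fin 3) : (if l = i then insert e₁ (T i ∩ G.inducedEdges S)
          else T l ∩ G.inducedEdges S) ⊆ T l := by
        split_ifs with hl
        · subst hl
          exact Set.insert_subset h₁.1 Set.inter_subset_left
        · exact Set.inter_subset_left
      exact fun l m hlm => (hd l m hlm).mono (hle l) (hle m)
  intro f hf
  have hD : G.cutEdges S \ {e₁, e₂} ⊆ G'.cutEdges S := by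
    rintro e ⟨he, hne'⟩
    have hee₁ : e ≠ e₁ := by rintro rfl; simp at hne'
    simpa [cutEdges, hG', replaceEdge_fst_of_ne ha hee₁, replaceEdge_snd_of_ne ha hee₁] using he
  have hDcard : 2 ≤ (G.cutEdges S \ {e₁, e₂}).ncard := by
    rw [show 2 = (T j ∩ G.cutEdges S ∪ T k ∩ G.cutEdges S).ncard by
      rw [Set.ncard_union_eq ((hd j k hjk).mono Set.inter_subset_left Set.inter_subset_left),
        hj, hk]]
    refine Set.ncard_le_ncard ?_
    rw [← hi]
    rintro e (⟨he, hc⟩ | ⟨he, hc⟩)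
    · exact ⟨hc, fun h => Set.disjoint_left.1 (hd i j hij) h.1 he⟩
    · exact ⟨hc, fun h => Set.disjoint_left.1 (hd i k hik) h.1 he⟩
  obtain ⟨o, ho⟩ := hS.exists_outDegOn_union hD hDcard f
  obtain ⟨o', ho'⟩ := exists_outDeg_eq_of_lift hne ha₁ hb₁ ha₂ hb₂ he₁ he₂ ha o
  refine hcompl.extend hf (o := o') fun v hv => ?_
  have hv : v ∈ S := by simpa using hv
  rw [ho' v hv, ho v hv]

theorem z3Connected_of_small_cut [Fintype V] [Fintype E] {S : Set V}
    (ih : ∀ G' : Multigraph V E, G'.HasTriplePacking S → G'.Z3ConnectedWithin S)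
    (ih' : ∀ G' : Multigraph V E, G'.HasTriplePacking Sᶜ → G'.Z3ConnectedWithin Sᶜ)
    (hG : G.HasTriplePacking Set.univ) (hS : S.Nonempty) (hS' : S ≠ Set.univ)
    (hcut : (G.cutEdges S).ncard ≤ 4) : G.Z3Connected := by
  obtain ⟨T, hT, hd⟩ := hG
  have hpos (i : Fin 3) : 1 ≤ (T i ∩ G.cutEdges S).ncard :=
    (Set.ncard_pos).2 (ConnectedOn.inter_cutEdges_nonempty (hT i) hS hS')
  have hdc (i j : Fin 3) (hij : i ≠ j) :
      Disjoint (T i ∩ G.cutEdges S) (T j ∩ G.cutEdges S) :=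
    (hd i j hij).mono Set.inter_subset_left Set.inter_subset_left
  have hsum (i j k : Fin 3) (hij : i ≠ j) (hik : i ≠ k) (hjk : j ≠ k) :
      (T i ∩ G.cutEdges S).ncard + (T j ∩ G.cutEdges S).ncard + (T k ∩ G.cutEdges S).ncard ≤
        (G.cutEdges S).ncard := by
    rw [← Set.ncard_union_eq (hdc i j hij), ← Set.ncard_union_eq
      (Set.disjoint_union_left.2 ⟨hdc i k hik, hdc j k hjk⟩)]
    exact Set.ncard_le_ncard (by simp)
  by_cases hone : ∀ i, (T i ∩ G.cutEdges S).ncard = 1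
  · have hsub (i : Fin 3) : (T i ∩ G.cutEdges S).Subsingleton := by
      obtain ⟨e, he⟩ := Set.ncard_eq_one.1 (hone i)
      simp [he]
    refine Z3ConnectedWithin.z3Connected
      (ih G (hasTriplePacking_of_inter hd fun i =>
        ConnectedOn.within_of_subsingleton (hT i) (hsub i)))
      (ih' G (hasTriplePacking_of_inter hd fun i =>
        ConnectedOn.within_of_subsingleton (hT i) (by rw [cutEdges_compl]; exact hsub i))) ?_
    have := hsum 0 1 2 (by decide) (by decide) (by decide)
    simp only [hone] at this
    omega
  · obtain ⟨i, hi⟩ := not_forall.1 hone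
    obtain ⟨j, k, hij, hik, hjk, hall⟩ : ∃ j k : Fin 3, i ≠ j ∧ i ≠ k ∧ j ≠ k ∧
        ∀ l, l = i ∨ l = j ∨ l = k := by
      clear hi
      revert i
      decide
    have hs := hsum i j k hij hik hjk
    have hpi := hpos i
    have hpj := hpos j
    have hpk := hpos k
    have hj : (T j ∩ G.cutEdges S).ncard = 1 := by omega
    have hk : (T k ∩ G.cutEdges S).ncard = 1 := by omega
    obtain ⟨e₁, e₂, hne, he⟩ := Set.ncard_eq_two.1
      (show (T i ∩ G.cutEdges S).ncard = 2 by omega)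
    rcases ConnectedOn.within_or_within_compl (hT i) he with hcon | hcon
    · refine z3Connected_of_crossing_twice (S := Sᶜ) ih' (fun h => ?_) hT hd hij hik hjk hall
        (by rwa [cutEdges_compl]) (by rwa [cutEdges_compl]) hne (by rwa [cutEdges_compl]) ?_
      · rw [compl_compl] at h ⊢
        exact ih G h
      · rwa [compl_compl]
    · exact z3Connected_of_crossing_twice ih (ih' G) hT hd hij hik hjk hall hj hk hne he hcon

theorem z3Connected_of_hasTriplePacking
    (hyp : ∀ (W F : Type) [Fintype W] [Fintype F] (H : Multigraph W F),
      H.EdgeConnected 5 → H.Z3Connected) (n : ℕ) :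
    ∀ (V E : Type) [Fintype V] [Fintype E] (G : Multigraph V E), Nat.card V = n →
      G.HasTriplePacking Set.univ → G.Z3Connected := by
  classical
  induction n using Nat.strong_induction_on with
  | _ n ihn =>
  intro V E _ _ G hn hG
  by_cases hconn : G.EdgeConnected 5
  · exact hyp V E G hconn
  have hG0 : G.Connected := by
    obtain ⟨T, hT, -⟩ := hG
    exact ⟨by simp, fun u hu v hv => Relation.ReflTransGen.mono
      (fun _ _ => adjOn_mono (Set.subset_univ _)) _ _ ((hT 0).2 u hu v hv)⟩
  obtain ⟨S, hS, hS', hcut⟩ : ∃ S : Set V, S.Nonempty ∧ S ≠ Set.univ ∧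
      (G.cutEdges S).ncard < 5 := by
    simpa [EdgeConnected, hG0] using hconn
  have ih (S : Set V) (hS : S ≠ Set.univ) (G' : Multigraph V E) (h : G'.HasTriplePacking S) :
      G'.Z3ConnectedWithin S := by
    refine z3ConnectedWithin_of_induce (ihn (Nat.card S) ?_ _ _ _ rfl h.induce)
    rw [Nat.card_coe_set_eq, ← hn, ← Set.ncard_univ]
    exact Set.ncard_lt_ncard (Set.ssubset_univ_iff.2 hS)
  exact z3Connected_of_small_cut (ih S hS') (ih Sᶜ (by simpa using hS.ne_empty)) hG hS hS'
    (by omega)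

end Multigraph

/-- if every `5`-edge-connected graph is `Z₃`-connected, then
every graph containing `3` pairwise edge-disjoint spanning trees is
`Z₃`-connected. -/
theorem z3Connected_of_three_edge_disjoint_spanning_trees
    (hyp : ∀ (W F : Type) [Fintype W] [Fintype F] (H : Multigraph W F),
      H.EdgeConnected 5 → H.Z3Connected)
    {V E : Type} [Fintype V] [Fintype E] (G : Multigraph V E)
    (h : G.HasEdgeDisjointSpanningTrees 3) :
    G.Z3Connected := by
  obtain ⟨T, hT, hd⟩ := h
  exact Multigraph.z3Connected_of_hasTriplePacking hyp _ V E G rfl ⟨T, fun i => (hT i).1, hd⟩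
end

section
/- Let k be an integer with k ≥ 3. Suppose that every (2k−1)-edge-connected graph H admits a g-orientation for every mapping g : V(H) → Z_k with |E(H)| ≡ Σ_{v∈V(H)} g(v) (mod k). Then every graph G containing 2k−3 pairwise edge-disjoint spanning trees admits an f-orientation for every mapping f : V(G) → Z_k with |E(G)| ≡ Σ_{v∈V(G)} f(v) (mod k). -/
namespace Multigraph

section TailAssignments

open Classical

/-- The graph with edge endpoints `s` and `t` (loops allowed) has, for every admissible prescription
`f`, a choice of tails realizing `f` as the out-degrees modulo `k`. -/
def Orientable (k : ℕ) {V E : Type} [Fintype V] [Fintype E] (s t : E → V) : Prop :=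
  ∀ f : V → ZMod k, ∑ _e : E, (1 : ZMod k) = ∑ v, f v →
    ∃ τ : E → V, (∀ e, τ e = s e ∨ τ e = t e) ∧
      ∀ v, ∑ e, (if τ e = v then (1 : ZMod k) else 0) = f v

/-- The edges satisfying `p` and lying inside `X` connect `X`, expressed through cuts of `X`. -/
def ConnOn {V E : Type} (s t : E → V) (p : E → Prop) (X : Set V) : Prop :=
  ∀ A ⊆ X, A.Nonempty → A ≠ X →
    ∃ e, p e ∧ s e ∈ X ∧ t e ∈ X ∧ ¬(s e ∈ A ↔ t e ∈ A)

/-- The edges with exactly one endpoint in `S`. -/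
noncomputable def crossing {V E : Type} [Fintype E] (s t : E → V) (S : Set V) : Finset E :=
  Finset.univ.filter fun e => ¬(s e ∈ S ↔ t e ∈ S)

/-- The map contracting `X` to the single vertex `none`. -/
noncomputable def contract {V : Type} (X : Set V) (v : V) : Option {v // v ∉ X} :=
  if h : v ∈ X then none else some ⟨v, h⟩

variable {V E : Type}

lemma contract_eq_none {X : Set V} {v : V} : contract X v = none ↔ v ∈ X := by
  unfold contract; split_ifs <;> simp_all

lemma contract_eq_some {X : Set V} {v : V} {w : {v // v ∉ X}} :
    contract X v = some w ↔ v = w := by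
  unfold contract
  split_ifs with h
  · simp only [false_iff]
    rintro rfl
    exact w.2 h
  · simp [Subtype.ext_iff]

lemma contract_surjective {X : Set V} (hX : X.Nonempty) : Function.Surjective (contract X) := by
  rintro (_ | w)
  · exact ⟨hX.some, contract_eq_none.2 hX.some_mem⟩
  · exact ⟨w, contract_eq_some.2 rfl⟩

lemma mem_crossing [Fintype E] {s t : E → V} {S : Set V} {e : E} :
    e ∈ crossing s t S ↔ ¬(s e ∈ S ↔ t e ∈ S) := by
  simp [crossing]

lemma crossing_compl [Fintype E] (s t : E → V) (S : Set V) :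
    crossing s t Sᶜ = crossing s t S := by
  ext e
  simp only [mem_crossing, Set.mem_compl_iff]
  tauto

lemma ConnOn.comp_surjective {W : Type} {s t : E → V} {p : E → Prop}
    (h : ConnOn s t p Set.univ) {π : V → W} (hπ : Function.Surjective π) :
    ConnOn (π ∘ s) (π ∘ t) p Set.univ := by
  intro A _ hA hA'
  obtain ⟨e, he, -, -, h'⟩ := h (π ⁻¹' A) (Set.subset_univ _) (hA.preimage hπ) (by
    intro h
    apply hA'
    rw [Set.eq_univ_iff_forall] at h ⊢
    intro w
    obtain ⟨v, rfl⟩ := hπ w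
    exact h v)
  exact ⟨e, he, trivial, trivial, h'⟩

lemma ConnOn.induce {s t : E → V} {p : E → Prop} {X : Set V} (h : ConnOn s t p X) :
    ConnOn (fun e : {e // s e ∈ X ∧ t e ∈ X} => (⟨s e, e.2.1⟩ : {v // v ∈ X}))
      (fun e => ⟨t e, e.2.2⟩) (fun e => p e) Set.univ := by
  intro A _ hA hA'
  obtain ⟨e, he, h1, h2, h3⟩ := h (Subtype.val '' A) (by rintro _ ⟨x, -, rfl⟩; exact x.2)
    (hA.image _) (by
      intro h
      apply hA'
      rw [Set.eq_univ_iff_forall]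
      intro x
      obtain ⟨y, hy, hxy⟩ := h.symm.subset x.2
      rwa [← Subtype.ext hxy])
  refine ⟨⟨e, h1, h2⟩, he, trivial, trivial, ?_⟩
  simpa [h1, h2] using h3

lemma Orientable.of_contract {k : ℕ} [Fintype V] [Fintype E] {s t : E → V} (X : Set V)
    (hq : Orientable k (contract X ∘ s) (contract X ∘ t))
    (hi : Orientable k (fun e : {e // s e ∈ X ∧ t e ∈ X} => (⟨s e, e.2.1⟩ : {v // v ∈ X}))
      (fun e => ⟨t e, e.2.2⟩)) :
    Orientable k s t := by
  intro f hf
  have hsplit : ∑ v, f v = ∑ v : {v // v ∈ X}, f v + ∑ v : {v // v ∉ X}, f v :=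
    (Fintype.sum_subtype_add_sum_subtype (fun v => v ∈ X) f).symm
  obtain ⟨σ, hσ, hσf⟩ := hq
    (fun w => w.elim (∑ v : {v // v ∈ X}, f v) (fun v => f v)) (by
      rw [hf, hsplit, Fintype.sum_option]; rfl)
  have hρ : ∀ e, ∃ r, (r = s e ∨ r = t e) ∧ contract X r = σ e := by
    intro e
    rcases hσ e with h | h
    · exact ⟨_, Or.inl rfl, h.symm⟩
    · exact ⟨_, Or.inr rfl, h.symm⟩
  choose ρ hρ hρσ using hρ
  obtain ⟨τ, hτ, hτf⟩ := hi
    (fun v => f v - ∑ e : {e // ¬(s e ∈ X ∧ t e ∈ X)}, if ρ e = v then 1 else 0) (by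
      have h0 := hσf none
      simp only [Option.elim] at h0
      rw [Finset.sum_sub_distrib, ← h0, Finset.sum_comm,
        ← Fintype.sum_subtype_add_sum_subtype (fun e => s e ∈ X ∧ t e ∈ X)]
      have h1 : ∀ e : {e // s e ∈ X ∧ t e ∈ X}, σ e = none := by
        intro e
        rw [← hρσ, contract_eq_none]
        rcases hρ e with h | h <;> rw [h]
        exacts [e.2.1, e.2.2]
      have h2 : ∀ e : E, (∑ v : {v // v ∈ X}, if ρ e = v then (1 : ZMod k) else 0)
          = if σ e = none then 1 else 0 := by
        intro e
        have h3 : σ e = none ↔ ρ e ∈ X := by rw [← hρσ, contract_eq_none]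
        simp only [h3]
        split_ifs with h
        · rw [Finset.sum_eq_single (⟨ρ e, h⟩ : {v // v ∈ X})] <;> simp +contextual
          intro a ha hne h
          exact absurd h.symm hne
        · apply Finset.sum_eq_zero
          intro v _
          rw [if_neg]
          intro h'
          exact h (h' ▸ v.2)
      simp only [h1, h2, if_true]
      symm
      convert add_sub_cancel_right _ _)
  refine ⟨fun e => if h : s e ∈ X ∧ t e ∈ X then (τ ⟨e, h⟩ : V) else ρ e, ?_, ?_⟩
  · intro e
    by_cases h : s e ∈ X ∧ t e ∈ X
    · simp only [h, and_self, dite_true]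
      simpa [Subtype.ext_iff] using hτ ⟨e, h⟩
    · simpa only [h, dite_false] using hρ e
  · intro v
    by_cases hv : v ∈ X
    · rw [← Fintype.sum_subtype_add_sum_subtype (fun e => s e ∈ X ∧ t e ∈ X)]
      have h1 := hτf ⟨v, hv⟩
      rw [eq_sub_iff_add_eq] at h1
      rw [← h1]
      congr 1
      · refine Finset.sum_congr rfl fun e _ => ?_
        simp [e.2, Subtype.ext_iff]
      · refine Finset.sum_congr rfl fun e _ => ?_
        simp only [e.2, dite_false]
    · have h1 := hσf (some ⟨v, hv⟩)
      simp only [Option.elim] at h1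
      rw [← h1]
      refine Finset.sum_congr rfl fun e _ => ?_
      have h2 : σ e = some ⟨v, hv⟩ ↔ ρ e = v := by rw [← hρσ, contract_eq_some]
      by_cases h : s e ∈ X ∧ t e ∈ X
      · have h3 : (τ ⟨e, h⟩ : V) ≠ v := fun h' => hv (h' ▸ (τ ⟨e, h⟩).2)
        have h4 : ρ e ≠ v := by
          rcases hρ e with h' | h' <;> rw [h'] <;> intro h'' <;> apply hv <;> rw [← h'']
          exacts [h.1, h.2]
        simp only [h2, h, h4, and_self, dite_true, h3]
      · simp only [h2, h, dite_false]

lemma orientable_of_two_vertices {k : ℕ} [NeZero k] [Fintype V] [Fintype E] {s t : E → V}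
    {w w' : V} (hw : w ≠ w') (hV : ∀ x, x = w ∨ x = w')
    (hc : k - 1 ≤ (crossing s t {w}).card) : Orientable k s t := by
  intro f hf
  set L : ZMod k := ∑ e, if s e = w ∧ t e = w then 1 else 0 with hL
  obtain ⟨A, hA, hAc⟩ := Finset.exists_subset_card_eq
    (show (f w - L).val ≤ (crossing s t {w}).card by
      have := ZMod.val_lt (f w - L)
      omega)
  have key : ∀ e, ∃ r, (r = s e ∨ r = t e) ∧ (r = w ↔ e ∈ A ∨ (s e = w ∧ t e = w)) := by
    intro e
    by_cases he : e ∈ A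
    · have := mem_crossing.1 (hA he)
      simp only [Set.mem_singleton_iff] at this
      exact ⟨w, by tauto, by tauto⟩
    · by_cases h : s e = w
      · exact ⟨t e, Or.inr rfl, by tauto⟩
      · exact ⟨s e, Or.inl rfl, by tauto⟩
  choose τ hτ hτw using key
  have h1 : ∑ e, (if τ e = w then (1 : ZMod k) else 0) = f w := by
    have : ∀ e, (if τ e = w then (1 : ZMod k) else 0)
        = (if e ∈ A then 1 else 0) + if s e = w ∧ t e = w then 1 else 0 := by
      intro e
      by_cases he : e ∈ A
      · have := mem_crossing.1 (hA he)
        simp only [Set.mem_singleton_iff] at this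
        have h' : ¬ (s e = w ∧ t e = w) := by tauto
        simp [hτw, he, h']
      · simp [hτw, he]
    rw [Finset.sum_congr rfl fun e _ => this e, Finset.sum_add_distrib, ← hL]
    simp [hAc]
  refine ⟨τ, hτ, fun v => ?_⟩
  rcases hV v with rfl | rfl
  · exact h1
  · have h2 : ∑ x, f x = f w + f v := by
      have : (Finset.univ : Finset V) = {w, v} := by
        ext x; simpa using hV x
      rw [this, Finset.sum_pair hw]
    have h3 : ∀ e, (1 : ZMod k) = (if τ e = w then 1 else 0) + if τ e = v then 1 else 0 := by
      intro e
      rcases hV (τ e) with h | h <;> simp [h, hw, hw.symm]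
    rw [h2, Finset.sum_congr rfl fun e _ => h3 e, Finset.sum_add_distrib, h1] at hf
    exact add_left_cancel hf

/-- A graph is orientable if lifting the edges `x₁ v` and `v x₂` to a single edge `x₁ x₂` makes it so. -/
lemma Orientable.of_lift {k : ℕ} [Fintype V] [Fintype E] {s t : E → V} {e₁ e₂ : E} {v x₁ x₂ : V}
    (hne : e₁ ≠ e₂) (h₁ : s e₁ = v ∧ t e₁ = x₁ ∨ s e₁ = x₁ ∧ t e₁ = v)
    (h₂ : s e₂ = v ∧ t e₂ = x₂ ∨ s e₂ = x₂ ∧ t e₂ = v)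
    (h : Orientable k (fun e : {e // e ≠ e₂} => if e.1 = e₁ then x₁ else s e)
      (fun e => if e.1 = e₁ then x₂ else t e)) : Orientable k s t := by
  intro f hf
  have hdel : ∀ g : E → ZMod k, ∑ e, g e = ∑ e : {e // e ≠ e₂}, g e + g e₂ := by
    intro g
    rw [← Fintype.sum_subtype_add_sum_subtype (fun e => e ≠ e₂) g]
    congr 1
    rw [Finset.sum_eq_single (⟨e₂, by simp⟩ : {e // ¬ e ≠ e₂})]
    · rintro ⟨b, hb⟩ _ hb'
      exact absurd (Subtype.ext (not_not.1 hb)) hb'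
    · simp
  have hdel' : ∀ g : {e // e ≠ e₂} → ZMod k, ∑ e, g e
      = g ⟨e₁, hne⟩ + ∑ e ∈ Finset.univ.erase ⟨e₁, hne⟩, g e := fun g =>
    (Finset.add_sum_erase _ _ (Finset.mem_univ _)).symm
  obtain ⟨σ, hσ, hσf⟩ := h (fun u => f u - if v = u then 1 else 0) (by
    rw [Finset.sum_sub_distrib, ← hf, hdel]
    simp)
  have hσ₁ : σ ⟨e₁, hne⟩ = x₁ ∨ σ ⟨e₁, hne⟩ = x₂ := by simpa using hσ ⟨e₁, hne⟩
  refine ⟨fun e => if h : e = e₂ then (if σ ⟨e₁, hne⟩ = x₁ then v else x₂)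
    else if e = e₁ then (if σ ⟨e₁, hne⟩ = x₁ then x₁ else v) else σ ⟨e, h⟩, ?_, ?_⟩
  · intro e
    by_cases he₂ : e = e₂
    · subst he₂
      simp only [dite_true]
      split_ifs <;> grind
    · by_cases he₁ : e = e₁
      · subst he₁
        simp only [he₂, dite_false, if_true]
        split_ifs <;> grind
      · have := hσ ⟨e, he₂⟩
        simpa [he₁, he₂] using this
  · intro u
    have hu := hσf u
    rw [eq_sub_iff_add_eq] at hu
    rw [← hu, hdel, hdel', hdel']
    have hrest : ∀ e ∈ (Finset.univ.erase ⟨e₁, hne⟩ : Finset {e // e ≠ e₂}), e.1 ≠ e₁ := by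
      intro e he h
      exact (Finset.mem_erase.1 he).1 (Subtype.ext h)
    have hs : ∑ e ∈ (Finset.univ.erase ⟨e₁, hne⟩ : Finset {e // e ≠ e₂}),
        (if (if h : e.1 = e₂ then (if σ ⟨e₁, hne⟩ = x₁ then v else x₂)
          else if e.1 = e₁ then (if σ ⟨e₁, hne⟩ = x₁ then x₁ else v) else σ ⟨e, h⟩) = u
          then (1 : ZMod k) else 0)
        = ∑ e ∈ (Finset.univ.erase ⟨e₁, hne⟩ : Finset {e // e ≠ e₂}),
          if σ e = u then (1 : ZMod k) else 0 := by
      refine Finset.sum_congr rfl fun e he => ?_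
      simp [hrest e he, e.2]
    rw [hs]
    simp only [hne, dite_false, dite_true, if_true]
    by_cases hx : σ ⟨e₁, hne⟩ = x₁
    · simp only [hx, if_true]
    · have hx₂ := hσ₁.resolve_left hx
      rw [if_neg hx, if_neg hx, hx₂]
      ring

lemma connOn_of_unique_crossing {s t : E → V} {p : E → Prop} (h : ConnOn s t p Set.univ)
    {S : Set V} (hS : ∀ e e', p e → p e' → ¬(s e ∈ S ↔ t e ∈ S) → ¬(s e' ∈ S ↔ t e' ∈ S) → e = e') :
    ConnOn s t p S := by
  intro A hAS hA hA'
  have hA2 : (S \ A).Nonempty := Set.sdiff_nonempty.2 fun h => hA' (hAS.antisymm h)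
  obtain ⟨e, he, -, -, h1⟩ := h A (Set.subset_univ _) hA (by
    rintro rfl; exact hA' (Set.univ_subset_iff.1 hAS).symm)
  obtain ⟨e', he', -, -, h2⟩ := h (S \ A) (Set.subset_univ _) hA2 (by
    intro h
    obtain ⟨a, ha⟩ := hA
    exact (h.symm.subset (Set.mem_univ a)).2 ha)
  have hs := @hAS (s e)
  have ht := @hAS (t e)
  have hs' := @hAS (s e')
  have ht' := @hAS (t e')
  simp only [Set.mem_sdiff] at h2
  by_contra hcon
  push Not at hcon
  have c1 := hcon e he
  have c2 := hcon e' he'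
  have := hS e e' he he' (by clear hcon hS c2 h2 hs' ht'; tauto)
    (by clear hcon hS c1 h1 hs ht; tauto)
  subst this
  clear hcon hS
  tauto

lemma connOn_or_connOn_compl {s t : E → V} {p : E → Prop} (h : ConnOn s t p Set.univ)
    {S : Set V} {e₁ e₂ : E} (hS : ∀ e, p e → ¬(s e ∈ S ↔ t e ∈ S) → e = e₁ ∨ e = e₂) :
    ConnOn s t p S ∨ ConnOn s t p Sᶜ := by
  by_contra hcon
  rw [not_or] at hcon
  obtain ⟨hc1, hc2⟩ := hcon
  simp only [ConnOn, not_forall] at hc1 hc2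
  obtain ⟨A, hAS, hA, hA', hcA⟩ := hc1
  obtain ⟨B, hBS, hB, hB', hcB⟩ := hc2
  push Not at hcA hcB
  have hA2 : (S \ A).Nonempty := Set.sdiff_nonempty.2 fun h => hA' (hAS.antisymm h)
  have hB2 : (Sᶜ \ B).Nonempty := Set.sdiff_nonempty.2 fun h => hB' (hBS.antisymm h)
  obtain ⟨a, ha⟩ := hA
  obtain ⟨a', ha'⟩ := hA2
  obtain ⟨b, hb⟩ := hB
  obtain ⟨b', hb'⟩ := hB2
  have hAS' : ∀ x ∈ A, x ∈ S := fun x hx => hAS hx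
  have hBS' : ∀ x ∈ B, x ∉ S := fun x hx => hBS hx
  have hnc : ∀ e, p e → (s e ∈ S ↔ t e ∈ S) →
      (s e ∈ A ↔ t e ∈ A) ∧ (s e ∈ B ↔ t e ∈ B) := by
    intro e he h
    by_cases hs : s e ∈ S
    · exact ⟨hcA e he hs (h.1 hs), fun hb => absurd hs (hBS' _ hb),
        fun hb => absurd (h.1 hs) (hBS' _ hb)⟩
    · exact ⟨⟨fun ha => absurd (hAS' _ ha) hs, fun ha => absurd (h.2 (hAS' _ ha)) hs⟩,
        hcB e he hs (mt h.2 hs)⟩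
  have hcut : ∀ (C : Set V) (x y : V), x ∈ C → y ∉ C →
      (∀ e, p e → (s e ∈ S ↔ t e ∈ S) → (s e ∈ C ↔ t e ∈ C)) →
      (¬(s e₁ ∈ S ↔ t e₁ ∈ S) ∧ ¬(s e₁ ∈ C ↔ t e₁ ∈ C)) ∨
        (¬(s e₂ ∈ S ↔ t e₂ ∈ S) ∧ ¬(s e₂ ∈ C ↔ t e₂ ∈ C)) := by
    intro C x y hx hy hC
    obtain ⟨e, he, -, -, h'⟩ := h C (Set.subset_univ _) ⟨x, hx⟩ (by
      rintro rfl; exact hy trivial)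
    have h'' := mt (hC e he) h'
    rcases hS e he h'' with rfl | rfl
    exacts [Or.inl ⟨h'', h'⟩, Or.inr ⟨h'', h'⟩]
  have g₁ := hcut A a a' ha ha'.2 (fun e he h => (hnc e he h).1)
  have g₂ := hcut (S \ A) a' a ha' (fun h => h.2 ha)
    (fun e he h => and_congr h (not_congr (hnc e he h).1))
  have g₃ := hcut B b b' hb hb'.2 (fun e he h => (hnc e he h).2)
  have g₄ := hcut (Sᶜ \ B) b' b hb' (fun h => h.2 hb)
    (fun e he h => and_congr (not_congr h) (not_congr (hnc e he h).2))
  have g₅ := hcut (A ∪ B) a a' (Or.inl ha) (fun h => h.elim ha'.2 fun h => hBS' _ h ha'.1)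
    (fun e he h => or_congr (hnc e he h).1 (hnc e he h).2)
  have g₆ := hcut (A ∪ (Sᶜ \ B)) a a' (Or.inl ha) (fun h => h.elim ha'.2 fun h => h.1 ha'.1)
    (fun e he h => or_congr (hnc e he h).1 (and_congr (not_congr h) (not_congr (hnc e he h).2)))
  simp only [Set.mem_union, Set.mem_sdiff, Set.mem_compl_iff] at g₁ g₂ g₃ g₄ g₅ g₆
  have := hAS' (s e₁)
  have := hAS' (t e₁)
  have := hAS' (s e₂)
  have := hAS' (t e₂)
  have := hBS' (s e₁)
  have := hBS' (t e₁)
  have := hBS' (s e₂)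
  have := hBS' (t e₂)
  clear hcut hnc hAS hBS hA' hB' h hS hcA hcB hAS' hBS' ha ha' hb hb'
  grind (splits := 30)

lemma injOn_erase_of_surj {D : Finset E} {c : E → ℕ} {n : ℕ} (hD : D.card ≤ n + 1)
    (hc : ∀ i < n, ∃ e ∈ D, c e = i) {e₁ e₂ : E} (h₁ : e₁ ∈ D) (h₂ : e₂ ∈ D) (hne : e₁ ≠ e₂)
    (h : c e₁ = c e₂) : Set.InjOn c (D.erase e₂) := by
  rw [← Finset.card_image_iff]
  apply le_antisymm Finset.card_image_le
  rw [Finset.card_erase_of_mem h₂]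
  have : Finset.range n ⊆ (D.erase e₂).image c := by
    intro i hi
    obtain ⟨e, he, hei⟩ := hc i (Finset.mem_range.1 hi)
    rw [Finset.mem_image]
    by_cases h' : e = e₂
    · exact ⟨e₁, by simp [h₁, hne], by rw [h, ← h', hei]⟩
    · exact ⟨e, by simp [he, h'], hei⟩
  have := Finset.card_le_card this
  rw [Finset.card_range] at this
  omega

lemma cast_outDeg [Fintype E] (k : ℕ) (G : Multigraph V E) (o : E → Bool) (v : V) :
    (G.outDeg o v : ZMod k) = ∑ e, if G.tail o e = v then 1 else 0 := by
  have h : {e ∈ (Set.univ : Set E) | G.tail o e = v}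
      = ((Finset.univ.filter fun e => G.tail o e = v : Finset E) : Set E) := by
    ext e; simp
  rw [outDeg, outDegOn, h, Set.ncard_coe_finset, Finset.sum_boole]

/-- Every large-cut graph, loops allowed, is orientable as soon as loopless ones are. -/
lemma orientable_of_le_crossing {k m : ℕ} (hm : 0 < m)
    (hyp : ∀ (W F : Type) [Fintype W] [Fintype F] (H : Multigraph W F), H.EdgeConnected m →
      ∀ g : W → ZMod k, (Nat.card F : ZMod k) = ∑ w, g w → ∃ o : F → Bool, H.IsModOrientation k g o)
    [Fintype V] [Fintype E] {s t : E → V}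
    (h : ∀ S : Set V, S.Nonempty → S ≠ Set.univ → m ≤ (crossing s t S).card) :
    Orientable k s t := by
  intro f hf
  let H : Multigraph V {e // s e ≠ t e} := ⟨fun e => s e, fun e => t e, fun e => e.2⟩
  have hcut : ∀ S, (H.cutEdges S).ncard = (crossing s t S).card := by
    intro S
    rw [← Set.ncard_image_of_injective _ Subtype.val_injective, ← Set.ncard_coe_finset]
    congr 1
    ext e
    simp only [Set.mem_image, Finset.mem_coe, mem_crossing]
    constructor
    · rintro ⟨e, he, rfl⟩
      simp only [cutEdges, Set.mem_ofPred_eq, H] at he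
      tauto
    · intro he
      refine ⟨⟨e, fun h => he (by rw [h])⟩, ?_, rfl⟩
      simp only [cutEdges, Set.mem_ofPred_eq, H]
      tauto
  have hH : H.EdgeConnected m := by
    refine ⟨⟨fun _ _ => ⟨trivial, trivial⟩, fun u _ v _ => ?_⟩, fun S h1 h2 => ?_⟩
    · by_contra hv
      have := h {w | Relation.ReflTransGen (H.AdjOn Set.univ) u w} ⟨u, .refl⟩ (by
        intro h
        exact hv (h.symm.subset (Set.mem_univ v)))
      rw [← hcut] at this
      obtain ⟨e, he⟩ := Set.nonempty_of_ncard_ne_zero (hm.trans_le this).ne'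
      rcases he with ⟨h1, h2⟩ | ⟨h1, h2⟩
      · exact h2 (Relation.ReflTransGen.tail h1 ⟨e, trivial, Or.inl ⟨rfl, rfl⟩⟩)
      · exact h1 (Relation.ReflTransGen.tail h2 ⟨e, trivial, Or.inr ⟨rfl, rfl⟩⟩)
    · rw [hcut]
      exact h S h1 h2
  obtain ⟨o, ho⟩ := hyp V _ H hH
    (fun v => f v - ∑ e : {e // ¬ s e ≠ t e}, if s e = v then 1 else 0) (by
      rw [Finset.sum_sub_distrib, ← hf, Finset.sum_comm,
        ← Fintype.sum_subtype_add_sum_subtype (fun e => s e ≠ t e)]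
      simp)
  refine ⟨fun e => if h : s e ≠ t e then H.tail o ⟨e, h⟩ else s e, fun e => ?_, fun v => ?_⟩
  · by_cases h : s e ≠ t e
    · simp only [h, not_false_eq_true, ne_eq, dite_true, tail, H]
      split_ifs <;> simp
    · simp [h]
  · have hv := ho v
    rw [cast_outDeg, eq_sub_iff_add_eq] at hv
    rw [← hv, ← Fintype.sum_subtype_add_sum_subtype (fun e => s e ≠ t e)]
    congr 1
    · refine Finset.sum_congr rfl fun e _ => ?_
      simp [e.2]
    · refine Finset.sum_congr rfl fun e _ => ?_
      simp only [e.2, dite_false]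

lemma Orientable.of_delete {k : ℕ} [NeZero k] [Fintype V] [Fintype E] {s t : E → V}
    {X : Set V} {v : V}
    (hX : X = {v}ᶜ) (hc : k - 1 ≤ (crossing s t {v}).card)
    (h : Orientable k
      (fun e : {e // s e ∈ X ∧ t e ∈ X} => (⟨s e, e.2.1⟩ : {x // x ∈ X}))
      (fun e => ⟨t e, e.2.2⟩)) : Orientable k s t := by
  refine Orientable.of_contract X ?_ h
  refine orientable_of_two_vertices (w := some ⟨v, by simp [hX]⟩) (w' := none) (by simp) ?_ ?_
  · rintro (_ | ⟨x, hx⟩)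
    · exact Or.inr rfl
    · left
      simpa [hX] using hx
  · convert hc using 2
    ext e
    simp only [mem_crossing, Set.mem_singleton_iff, Function.comp_apply, contract_eq_some]

lemma connOn_lift {s t : E → V} {p : E → Prop} (h : ConnOn s t p Set.univ)
    {e₁ e₂ : E} {v x₁ x₂ : V} (hne : e₁ ≠ e₂)
    (h₁ : s e₁ = v ∧ t e₁ = x₁ ∨ s e₁ = x₁ ∧ t e₁ = v)
    (h₂ : s e₂ = v ∧ t e₂ = x₂ ∨ s e₂ = x₂ ∧ t e₂ = v) (hx₁ : x₁ ≠ v) (hx₂ : x₂ ≠ v)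
    (hp : ∀ e e', p e → p e' → e ≠ e₂ → e' ≠ e₂ → ¬(s e = v ↔ t e = v) → ¬(s e' = v ↔ t e' = v) →
      e = e')
    (hp' : ∀ e e', p e → p e' → e ≠ e₁ → e' ≠ e₁ → ¬(s e = v ↔ t e = v) → ¬(s e' = v ↔ t e' = v) →
      e = e') (hpe : p e₂ → p e₁) :
    ConnOn (fun e : {e // e ≠ e₂} => if e.1 = e₁ then x₁ else s e)
      (fun e => if e.1 = e₁ then x₂ else t e) (fun e => p e) {v}ᶜ := by
  intro A hAS hA hA'
  have hA2 : ({v}ᶜ \ A).Nonempty := Set.sdiff_nonempty.2 fun h => hA' (hAS.antisymm h)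
  have hvA : v ∉ A := fun h => hAS h rfl
  obtain ⟨e, he, -, -, h1⟩ := h A (Set.subset_univ _) hA (fun h => hvA (h ▸ trivial))
  obtain ⟨e', he', -, -, h2⟩ := h ({v}ᶜ \ A) (Set.subset_univ _) hA2
    (fun h => (h.symm.subset (Set.mem_univ v)).1 rfl)
  simp only [Set.mem_sdiff, Set.mem_compl_iff, Set.mem_singleton_iff] at h2
  have inner : ∀ e, p e → s e ≠ v → t e ≠ v → ¬(s e ∈ A ↔ t e ∈ A) →
      ∃ e : {e // e ≠ e₂}, p e ∧ (if e.1 = e₁ then x₁ else s e) ∈ ({v}ᶜ : Set V) ∧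
        (if e.1 = e₁ then x₂ else t e) ∈ ({v}ᶜ : Set V) ∧
        ¬((if e.1 = e₁ then x₁ else s e) ∈ A ↔ (if e.1 = e₁ then x₂ else t e) ∈ A) := by
    intro e he hs ht hc
    have n₁ : e ≠ e₁ := by
      rintro rfl
      exact h₁.elim (fun h => hs h.1) (fun h => ht h.2)
    have n₂ : e ≠ e₂ := by
      rintro rfl
      exact h₂.elim (fun h => hs h.1) (fun h => ht h.2)
    exact ⟨⟨e, n₂⟩, he, by simpa [n₁] using hs, by simpa [n₁] using ht, by simpa [n₁] using hc⟩
  by_cases hin : s e ≠ v ∧ t e ≠ v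
  · exact inner e he hin.1 hin.2 h1
  by_cases hin' : s e' ≠ v ∧ t e' ≠ v
  · exact inner e' he' hin'.1 hin'.2 (by simpa [hin'.1, hin'.2, not_iff_not] using h2)
  have hc : ¬(s e = v ↔ t e = v) := by
    intro h
    rw [← not_or, ← h, or_self, not_not] at hin
    rw [hin, h.1 hin] at h1
    exact h1 Iff.rfl
  have hc' : ¬(s e' = v ↔ t e' = v) := by
    intro h
    rw [← not_or, ← h, or_self, not_not] at hin'
    rw [hin', h.1 hin'] at h2
    exact h2 Iff.rfl
  have hee : e ≠ e' := by
    rintro rfl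
    clear hp hp' inner h₁ h₂ hin' hc' he he'
    rcases not_and_or.1 hin with h | h <;> rw [not_not] at h <;> rw [h] at h1 h2 hc <;> tauto
  have hcase : e = e₁ ∧ e' = e₂ ∨ e = e₂ ∧ e' = e₁ := by
    have c := hp e e' he he'
    have c' := hp' e e' he he'
    clear hp hp' inner h₁ h₂ hin' hin h1 h2
    grind
  clear hp hp' inner hin hin' hc hc'
  have key : p e₁ ∧ ¬(x₁ ∈ A ↔ x₂ ∈ A) := by
    rcases hcase with ⟨rfl, rfl⟩ | ⟨rfl, rfl⟩
    · refine ⟨he, ?_⟩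
      rcases h₁ with ⟨a, b⟩ | ⟨a, b⟩ <;> rcases h₂ with ⟨c, d⟩ | ⟨c, d⟩ <;>
        simp only [a, b, c, d] at h1 h2 <;> tauto
    · refine ⟨he', ?_⟩
      rcases h₁ with ⟨a, b⟩ | ⟨a, b⟩ <;> rcases h₂ with ⟨c, d⟩ | ⟨c, d⟩ <;>
        simp only [a, b, c, d] at h1 h2 <;> tauto
  exact ⟨⟨e₁, hne⟩, key.1, by simpa using hx₁, by simpa using hx₂, by simpa using key.2⟩

theorem orientable_of_connOn {k : ℕ} (hk : 3 ≤ k)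
    (hyp : ∀ (W F : Type) [Fintype W] [Fintype F] (H : Multigraph W F),
      H.EdgeConnected (2 * k - 1) → ∀ g : W → ZMod k, (Nat.card F : ZMod k) = ∑ w, g w →
        ∃ o : F → Bool, H.IsModOrientation k g o)
    (N : ℕ) : ∀ (V E : Type) [Fintype V] [Fintype E] (s t : E → V) (c : E → ℕ),
      Fintype.card V = N → (∀ i < 2 * k - 3, ConnOn s t (fun e => c e = i) Set.univ) →
      Orientable k s t := by
  induction N using Nat.strong_induction_on with
  | _ N ih =>
  intro V E _ _ s t c hN hc
  subst hN
  have : NeZero k := ⟨by omega⟩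
  by_cases hbig : ∀ S : Set V, S.Nonempty → S ≠ Set.univ → 2 * k - 1 ≤ (crossing s t S).card
  · exact orientable_of_le_crossing (by omega) hyp hbig
  push Not at hbig
  obtain ⟨S, hS, hS', hcard⟩ := hbig
  have hsurj : ∀ X : Set V, X.Nonempty → X ≠ Set.univ →
      ∀ i < 2 * k - 3, ∃ e ∈ crossing s t X, c e = i := by
    intro X hX hX' i hi
    obtain ⟨e, he, -, -, h⟩ := hc i hi X (Set.subset_univ _) hX hX'
    exact ⟨e, mem_crossing.2 h, he⟩
  have hside : ∃ X : Set V, X.Nonempty ∧ X ≠ Set.univ ∧ (crossing s t X).card < 2 * k - 1 ∧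
      ∀ i < 2 * k - 3, ConnOn s t (fun e => c e = i) X := by
    by_cases hinj : Set.InjOn c (crossing s t S)
    · refine ⟨S, hS, hS', hcard, fun i hi => connOn_of_unique_crossing (hc i hi) ?_⟩
      intro e e' he he' h h'
      exact hinj (mem_crossing.2 h) (mem_crossing.2 h') (he.trans he'.symm)
    · simp only [Set.InjOn, not_forall] at hinj
      obtain ⟨e₁, h₁, e₂, h₂, hce, hne⟩ := hinj
      have hi₂ := injOn_erase_of_surj (by omega) (hsurj S hS hS') h₁ h₂ hne hce
      have huniq : ∀ i < 2 * k - 3, c e₁ ≠ i → ∀ e e', c e = i → c e' = i →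
          ¬(s e ∈ S ↔ t e ∈ S) → ¬(s e' ∈ S ↔ t e' ∈ S) → e = e' := by
        intro i hi hine e e' he he' h h'
        refine hi₂ ?_ ?_ (he.trans he'.symm)
        · rw [Finset.mem_coe, Finset.mem_erase, mem_crossing]
          exact ⟨by rintro rfl; exact hine (hce.trans he), h⟩
        · rw [Finset.mem_coe, Finset.mem_erase, mem_crossing]
          exact ⟨by rintro rfl; exact hine (hce.trans he'), h'⟩
      have htwo : ∀ e, c e = c e₁ → ¬(s e ∈ S ↔ t e ∈ S) → e = e₁ ∨ e = e₂ := by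
        intro e he h
        by_cases h2 : e = e₂
        · exact Or.inr h2
        · left
          refine hi₂ ?_ ?_ he
          · rw [Finset.mem_coe, Finset.mem_erase, mem_crossing]
            exact ⟨h2, h⟩
          · rw [Finset.mem_coe, Finset.mem_erase]
            exact ⟨hne, h₁⟩
      have hor : c e₁ < 2 * k - 3 → ConnOn s t (fun e => c e = c e₁) S ∨
          ConnOn s t (fun e => c e = c e₁) Sᶜ :=
        fun h => connOn_or_connOn_compl (hc _ h) htwo
      by_cases hdec : c e₁ < 2 * k - 3 → ConnOn s t (fun e => c e = c e₁) S
      · refine ⟨S, hS, hS', hcard, fun i hi => ?_⟩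
        by_cases hie : c e₁ = i
        · subst hie; exact hdec hi
        · exact connOn_of_unique_crossing (hc i hi) (huniq i hi hie)
      · refine ⟨Sᶜ, Set.nonempty_compl.2 hS', by simpa using hS.ne_empty,
          by rwa [crossing_compl], fun i hi => ?_⟩
        by_cases hie : c e₁ = i
        · subst hie
          exact (hor hi).resolve_left fun h => hdec fun _ => h
        · refine connOn_of_unique_crossing (hc i hi) fun e e' he he' h h' =>
            huniq i hi hie e e' he he' ?_ ?_
          · rwa [Set.mem_compl_iff, Set.mem_compl_iff, not_iff_not] at h
          · rwa [Set.mem_compl_iff, Set.mem_compl_iff, not_iff_not] at h'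
  clear! S
  obtain ⟨X, hX, hX', hcard, hconn⟩ := hside
  by_cases hnt : X.Nontrivial
  · refine Orientable.of_contract X ?_ ?_
    · refine ih _ ?_ _ _ _ _ c rfl fun i hi => (hc i hi).comp_surjective (contract_surjective hX)
      refine Fintype.card_lt_of_surjective_not_injective _ (contract_surjective hX) ?_
      obtain ⟨a, ha, b, hb, hab⟩ := hnt
      exact fun h => hab (h ((contract_eq_none.2 ha).trans (contract_eq_none.2 hb).symm))
    · refine ih _ ?_ _ _ _ _ (fun e => c e) rfl fun i hi => (hconn i hi).induce
      obtain ⟨x, hx⟩ := (Set.ne_univ_iff_exists_notMem X).1 hX'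
      exact Fintype.card_subtype_lt hx
  obtain ⟨v, rfl⟩ : ∃ v, X = {v} := by
    obtain ⟨v, hv⟩ := hX
    exact ⟨v, (Set.not_nontrivial_iff.1 hnt).eq_singleton_of_mem hv⟩
  obtain ⟨Y, hY⟩ : ∃ Y : Set V, Y = {v}ᶜ := ⟨_, rfl⟩
  have hlt : Fintype.card {x // x ∈ Y} < Fintype.card V :=
    Fintype.card_subtype_lt (x := v) (by simp [hY])
  have hsurj := hsurj {v} hX hX'
  by_cases hinj : Set.InjOn c (crossing s t {v})
  · refine Orientable.of_delete hY ?_ (ih _ hlt _ _ _ _ (fun e => c e) rfl fun i hi => ?_)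
    · have : Finset.range (2 * k - 3) ⊆ (crossing s t {v}).image c := by
        intro i hi
        exact Finset.mem_image.2 (hsurj i (Finset.mem_range.1 hi))
      have := (Finset.card_le_card this).trans Finset.card_image_le
      rw [Finset.card_range] at this
      omega
    · subst hY
      refine ConnOn.induce (connOn_of_unique_crossing (hc i hi) fun e e' he he' h h' => ?_)
      rw [Set.mem_compl_iff, Set.mem_compl_iff, not_iff_not] at h h'
      exact hinj (mem_crossing.2 h) (mem_crossing.2 h') (he.trans he'.symm)
  simp only [Set.InjOn, not_forall] at hinj
  obtain ⟨e₁, m₁, e₂, m₂, hce, hne⟩ := hinj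
  have hi₂ := injOn_erase_of_surj (by omega) hsurj m₁ m₂ hne hce
  have hi₁ := injOn_erase_of_surj (by omega) hsurj m₂ m₁ (Ne.symm hne) hce.symm
  have hend : ∀ e ∈ crossing s t {v}, ∃ x, x ≠ v ∧ (s e = v ∧ t e = x ∨ s e = x ∧ t e = v) := by
    intro e he
    rw [mem_crossing, Set.mem_singleton_iff, Set.mem_singleton_iff] at he
    by_cases h : s e = v
    · exact ⟨t e, by tauto, by tauto⟩
    · exact ⟨s e, h, by tauto⟩
  obtain ⟨x₁, hx₁, h₁⟩ := hend e₁ m₁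
  obtain ⟨x₂, hx₂, h₂⟩ := hend e₂ m₂
  have hmem : ∀ e e', e ≠ e' → ¬(s e = v ↔ t e = v) → e ∈ (crossing s t {v}).erase e' :=
    fun e e' h h' => Finset.mem_erase.2 ⟨h, mem_crossing.2 h'⟩
  refine Orientable.of_lift hne h₁ h₂ (Orientable.of_delete hY ?_
    (ih _ hlt _ _ _ _ (fun e => c e.1) rfl fun i hi => ?_))
  · have : (Finset.range (2 * k - 3)).erase (c e₁) ⊆
        (crossing (fun e : {e // e ≠ e₂} => if e.1 = e₁ then x₁ else s e)
          (fun e => if e.1 = e₁ then x₂ else t e) {v}).image (fun e => c e.1) := by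
      intro i hi
      rw [Finset.mem_erase, Finset.mem_range] at hi
      obtain ⟨e, he, rfl⟩ := hsurj i hi.2
      have n₁ : e ≠ e₁ := by rintro rfl; exact hi.1 rfl
      have n₂ : e ≠ e₂ := by rintro rfl; exact hi.1 hce.symm
      refine Finset.mem_image.2 ⟨⟨e, n₂⟩, ?_, rfl⟩
      rw [mem_crossing] at he ⊢
      simpa only [n₁, if_false] using he
    have := (Finset.card_le_card this).trans Finset.card_image_le
    have h' := Finset.pred_card_le_card_erase (s := Finset.range (2 * k - 3)) (a := c e₁)
    rw [Finset.card_range] at h'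
    omega
  · subst hY
    refine ConnOn.induce (p := fun e : {e // e ≠ e₂} => c e = i)
      (connOn_lift (p := fun e => c e = i) (hc i hi) hne h₁ h₂ hx₁ hx₂ ?_ ?_ (fun h => hce.trans h))
    · intro e e' he he' n n' h h'
      exact hi₂ (hmem _ _ n h) (hmem _ _ n' h') (he.trans he'.symm)
    · intro e e' he he' n n' h h'
      exact hi₁ (hmem _ _ n h) (hmem _ _ n' h') (he.trans he'.symm)

lemma ConnectedOn.connOn {G : Multigraph V E} {F : Set E} (h : G.ConnectedOn F) :
    ConnOn G.fst G.snd (fun e => e ∈ F) Set.univ := by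
  intro A _ hA hA'
  obtain ⟨a, ha⟩ := hA
  obtain ⟨b, hb⟩ := (Set.ne_univ_iff_exists_notMem A).1 hA'
  by_contra hcon
  push Not at hcon
  have hall : ∀ w, Relation.ReflTransGen (G.AdjOn F) a w → w ∈ A := by
    intro w hw
    induction hw with
    | refl => exact ha
    | tail _ hadj ih =>
      obtain ⟨e, he, ⟨rfl, rfl⟩ | ⟨rfl, rfl⟩⟩ := hadj
      · exact (hcon e he trivial trivial).1 ih
      · exact (hcon e he trivial trivial).2 ih
  exact hb (hall b (h.2 a trivial b trivial))

end TailAssignments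

end Multigraph

/-- let `k ≥ 3` and suppose that every `(2k - 1)`-edge-connected
graph `H` admits a `g`-orientation for every `g` with `|E(H)| ≡ ∑ g (mod k)`.
Then every graph `G` containing `2k - 3` pairwise edge-disjoint spanning trees
admits an `f`-orientation for every `f` with `|E(G)| ≡ ∑ f (mod k)`. -/
theorem mod_orientation_of_two_k_sub_three_spanning_trees
    (k : ℕ) (hk : 3 ≤ k)
    (hyp : ∀ (W F : Type) [Fintype W] [Fintype F] (H : Multigraph W F),
      H.EdgeConnected (2 * k - 1) →
        ∀ g : W → ZMod k, (Nat.card F : ZMod k) = ∑ w, g w →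
          ∃ o : F → Bool, H.IsModOrientation k g o)
    {V E : Type} [Fintype V] [Fintype E] (G : Multigraph V E)
    (hG : G.HasEdgeDisjointSpanningTrees (2 * k - 3))
    (f : V → ZMod k) (hf : (Nat.card E : ZMod k) = ∑ v, f v) :
    ∃ o : E → Bool, G.IsModOrientation k f o := by
  classical
  obtain ⟨T, hT, hdis⟩ := hG
  let c : E → ℕ := fun e => if h : ∃ i, e ∈ T i then (h.choose : ℕ) else 2 * k - 3
  have hc : ∀ i e, e ∈ T i → c e = i := by
    intro i e he
    have h : ∃ i, e ∈ T i := ⟨i, he⟩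
    have hch : h.choose = i := by
      by_contra hne
      exact Set.disjoint_left.1 (hdis _ _ hne) h.choose_spec he
    simp only [c, h, dite_true, hch]
  have hconn : ∀ i < 2 * k - 3,
      Multigraph.ConnOn G.fst G.snd (fun e => c e = i) Set.univ := by
    intro i hi A h1 h2 h3
    obtain ⟨e, he, h⟩ := Multigraph.ConnectedOn.connOn (hT ⟨i, hi⟩).1 A h1 h2 h3
    exact ⟨e, hc _ _ he, h⟩
  obtain ⟨τ, hτ, hτf⟩ :=
    Multigraph.orientable_of_connOn hk hyp _ V E G.fst G.snd c rfl hconn f (by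
      rw [← hf]; simp)
  refine ⟨fun e => decide (τ e = G.fst e), fun v => ?_⟩
  have htail : ∀ e, G.tail (fun e => decide (τ e = G.fst e)) e = τ e := by
    intro e
    have := hτ e
    simp only [Multigraph.tail, decide_eq_true_eq]
    split_ifs with h
    · exact h.symm
    · exact (this.resolve_left h).symm
  rw [Multigraph.cast_outDeg, ← hτf v]
  simp only [htail]
end

section
/- Every 6-edge-connected graph admits a nowhere-zero 3-flow. -/
set_option linter.unusedSectionVars false

namespace BoundaryNet

variable {V : Type} [DecidableEq V]

/-- The undirected edge underlying an arc. -/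
def und (a : V × V) : Sym2 V := s(a.1, a.2)

/-- Out-degree minus in-degree of `v`, modulo `6`, in a multiset of arcs. -/
def bdry (M : Multiset (V × V)) (v : V) : ZMod 6 :=
  ((M.map Prod.fst).count v : ZMod 6) - ((M.map Prod.snd).count v : ZMod 6)

/-- The indicator of the edges with exactly one end in `A`. -/
def crossing (A : Finset V) : Sym2 V → ℕ :=
  Sym2.lift ⟨fun u v => if (u ∈ A ↔ v ∈ A) then 0 else 1, fun u v => by simp only [iff_comm]⟩

/-- The number of edges in `L` with exactly one end in `A`. -/
def cut (L : Multiset (Sym2 V)) (A : Finset V) : ℕ := (L.map (crossing A)).sum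

/-- The circular norm on `ZMod 6`. -/
def circ (a : ZMod 6) : ℕ := min a.val (6 - a.val)

@[simp] lemma und_mk (u v : V) : und (u, v) = s(u, v) := rfl

@[simp] lemma crossing_mk (A : Finset V) (u v : V) :
    crossing A s(u, v) = if (u ∈ A ↔ v ∈ A) then 0 else 1 := rfl

@[simp] lemma bdry_zero (v : V) : bdry (0 : Multiset (V × V)) v = 0 := by simp [bdry]

lemma bdry_cons (a : V × V) (M : Multiset (V × V)) (v : V) :
    bdry (a ::ₘ M) v =
      (if v = a.1 then 1 else 0) - (if v = a.2 then 1 else 0) + bdry M v := by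
  simp only [bdry, Multiset.map_cons, Multiset.count_cons]
  push_cast
  ring

lemma bdry_add (M M' : Multiset (V × V)) (v : V) :
    bdry (M + M') v = bdry M v + bdry M' v := by
  simp only [bdry, Multiset.map_add, Multiset.count_add]
  push_cast
  ring

lemma sum_count (S : Multiset V) (B : Finset V) :
    ∑ v ∈ B, S.count v = S.countP (· ∈ B) := by
  induction S using Multiset.induction_on with
  | empty => simp
  | cons a S ih =>
    simp only [Multiset.count_cons, Finset.sum_add_distrib, ih, Multiset.countP_cons,
      Finset.sum_ite_eq']

lemma sum_count_cast (S : Multiset V) (B : Finset V) :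
    ∑ v ∈ B, (S.count v : ZMod 6) = (S.countP (· ∈ B) : ZMod 6) := by
  rw [← sum_count]
  push_cast
  rfl

lemma sum_bdry_cons (a : V × V) (M : Multiset (V × V)) (B : Finset V) :
    ∑ v ∈ B, bdry (a ::ₘ M) v =
      (if a.1 ∈ B then 1 else 0) - (if a.2 ∈ B then 1 else 0) + ∑ v ∈ B, bdry M v := by
  simp only [bdry_cons, Finset.sum_add_distrib, Finset.sum_sub_distrib, Finset.sum_ite_eq']

lemma sum_bdry_eq_zero (M : Multiset (V × V)) (B : Finset V)
    (h : ∀ a ∈ M, (a.1 ∈ B ↔ a.2 ∈ B)) : ∑ v ∈ B, bdry M v = 0 := by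
  induction M using Multiset.induction_on with
  | empty => simp
  | cons a M ih =>
    rw [sum_bdry_cons, ih fun e he => h e (Multiset.mem_cons_of_mem he)]
    have := h a (Multiset.mem_cons_self a M)
    simp [this]

lemma bdry_eq_zero (M : Multiset (V × V)) (v : V)
    (h : ∀ a ∈ M, v ∉ und a) : bdry M v = 0 := by
  induction M using Multiset.induction_on with
  | empty => simp
  | cons a M ih =>
    rw [bdry_cons, ih fun e he => h e (Multiset.mem_cons_of_mem he)]
    have := h a (Multiset.mem_cons_self a M)
    simp only [und, Sym2.mem_iff, not_or] at this
    simp [this.1, this.2]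

@[simp] lemma cut_zero (A : Finset V) : cut 0 A = 0 := by simp [cut]

@[simp] lemma cut_cons (e : Sym2 V) (L : Multiset (Sym2 V)) (A : Finset V) :
    cut (e ::ₘ L) A = crossing A e + cut L A := by simp [cut]

@[simp] lemma cut_add (L L' : Multiset (Sym2 V)) (A : Finset V) :
    cut (L + L') A = cut L A + cut L' A := by simp [cut]

lemma cut_congr (L : Multiset (Sym2 V)) (A B : Finset V)
    (h : ∀ e ∈ L, crossing A e = crossing B e) : cut L A = cut L B := by
  unfold cut
  rw [Multiset.map_congr rfl h]

lemma cut_eq_zero (L : Multiset (Sym2 V)) (A : Finset V)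
    (h : ∀ e ∈ L, crossing A e = 0) : cut L A = 0 := by
  unfold cut
  rw [Multiset.map_congr rfl h]
  simp

lemma crossing_congr {A B : Finset V} {e : Sym2 V} (h : ∀ v ∈ e, (v ∈ A ↔ v ∈ B)) :
    crossing A e = crossing B e := by
  induction e using Sym2.ind with
  | _ u v => simp [h u (by simp), h v (by simp)]

lemma crossing_sdiff {W A : Finset V} {e : Sym2 V} (h : ∀ v ∈ e, v ∈ W) :
    crossing (W \ A) e = crossing A e := by
  induction e using Sym2.ind with
  | _ u v => simp [h u (by simp), h v (by simp), not_iff_not]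

lemma crossing_eq_zero {A : Finset V} {e : Sym2 V} (h : ∀ v ∈ e, v ∈ A) :
    crossing A e = 0 := by
  induction e using Sym2.ind with
  | _ u v => simp [h u (by simp), h v (by simp)]

lemma crossing_eq_zero' {A : Finset V} {e : Sym2 V} (h : ∀ v ∈ e, v ∉ A) :
    crossing A e = 0 := by
  induction e using Sym2.ind with
  | _ u v => simp [h u (by simp), h v (by simp)]

lemma cut_star_of_notMem (Y : Multiset V) (x : V) (B : Finset V) (hx : x ∉ B) :
    cut (Y.map fun y => s(x, y)) B = Y.countP (· ∈ B) := by
  induction Y using Multiset.induction_on with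
  | empty => simp
  | cons a Y ih =>
    simp only [Multiset.map_cons, cut_cons, ih, crossing_mk, Multiset.countP_cons, hx, false_iff]
    split_ifs <;> first | contradiction | omega

lemma cut_star_of_mem (Y : Multiset V) (x : V) (B : Finset V) (hx : x ∈ B) :
    cut (Y.map fun y => s(x, y)) B = Y.countP (· ∉ B) := by
  induction Y using Multiset.induction_on with
  | empty => simp
  | cons a Y ih =>
    simp only [Multiset.map_cons, cut_cons, ih, crossing_mk, Multiset.countP_cons, hx, true_iff]
    split_ifs <;> first | contradiction | omega

/-- Lift an orientation along a map of edges. -/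
lemma exists_lift_arcs {U : Type} (π : V → U) (L : Multiset (Sym2 V)) :
    ∀ M₁ : Multiset (U × U), M₁.map (fun a => s(a.1, a.2)) = L.map (Sym2.map π) →
      ∃ M : Multiset (V × V), M.map und = L ∧ M.map (Prod.map π π) = M₁ := by
  classical
  induction L using Multiset.induction_on with
  | empty =>
    intro M₁ h
    exact ⟨0, by simp, (Multiset.map_eq_zero.1 (h.trans (Multiset.map_zero _))).symm⟩
  | cons e L ih =>
    intro M₁ h
    rw [Multiset.map_cons] at h
    obtain ⟨a, ha, hae, hM⟩ := (Multiset.map_eq_cons _ _ _ _).2 h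
    obtain ⟨M, hML, hMM⟩ := ih _ hM
    have hlift : ∃ c : V × V, und c = e ∧ Prod.map π π c = a := by
      induction e using Sym2.ind with
      | _ u v =>
        rw [Sym2.map_mk, Sym2.eq_iff] at hae
        rcases hae with ⟨h1, h2⟩ | ⟨h1, h2⟩
        · exact ⟨(u, v), rfl, Prod.ext h1.symm h2.symm⟩
        · exact ⟨(v, u), Sym2.eq_swap, Prod.ext h1.symm h2.symm⟩
    obtain ⟨c, hc, hca⟩ := hlift
    refine ⟨c ::ₘ M, by simp [hc, hML], ?_⟩
    rw [Multiset.map_cons, hMM, hca, Multiset.cons_erase ha]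

lemma exists_arcs (L : Multiset (Sym2 V)) : ∃ M : Multiset (V × V), M.map und = L := by
  induction L using Multiset.induction_on with
  | empty => exact ⟨0, by simp⟩
  | cons e L ih =>
    obtain ⟨M, hM⟩ := ih
    induction e using Sym2.ind with
    | _ u v => exact ⟨(u, v) ::ₘ M, by simp [hM]⟩

/-- An orientation of a graph in which two edges at `x` were split off can be pulled back. -/
lemma exists_arcs_of_split_off {x y w : V} {L : Multiset (Sym2 V)} {M : Multiset (V × V)}
    (h : M.map und = s(y, w) ::ₘ L) :
    ∃ M' : Multiset (V × V), M'.map und = s(x, y) ::ₘ s(x, w) ::ₘ L ∧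
      ∀ v, bdry M' v = bdry M v := by
  obtain ⟨a, ha, hae, hM⟩ := (Multiset.map_eq_cons _ _ _ _).2 h
  have hMa := Multiset.cons_erase ha
  have hcases : a = (y, w) ∨ a = (w, y) := by
    rcases a with ⟨a1, a2⟩
    rw [und_mk, Sym2.eq_iff] at hae
    rcases hae with ⟨rfl, rfl⟩ | ⟨rfl, rfl⟩ <;> simp
  rcases hcases with rfl | rfl
  · refine ⟨(y, x) ::ₘ (x, w) ::ₘ M.erase (y, w), ?_, fun v => ?_⟩
    · simp [hM, Sym2.eq_swap (a := y)]
    · rw [← hMa]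
      simp only [bdry_cons, Multiset.erase_cons_head]
      ring
  · refine ⟨(x, y) ::ₘ (w, x) ::ₘ M.erase (w, y), ?_, fun v => ?_⟩
    · simp [hM, Sym2.eq_swap (a := w)]
    · rw [← hMa]
      simp only [bdry_cons, Multiset.erase_cons_head]
      ring

/-- The boundary has the parity of the degree. -/
lemma bdry_parity (M : Multiset (V × V)) (v : V) :
    ((cut (M.map und) {v} : ℕ) : ZMod 6) + bdry M v ∈ ({0, 2, 4} : Finset (ZMod 6)) := by
  induction M using Multiset.induction_on with
  | empty => simp
  | cons a M ih =>
    rcases a with ⟨a1, a2⟩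
    rw [Multiset.map_cons, cut_cons, bdry_cons, und_mk, crossing_mk]
    generalize bdry M v = r at *
    push_cast
    generalize ((cut (M.map und) {v} : ℕ) : ZMod 6) = c at *
    simp only [Finset.mem_singleton, eq_comm (a := v)]
    revert ih
    by_cases h1 : a1 = v <;> by_cases h2 : a2 = v <;> simp only [h1, h2, if_true, if_false,
      iff_true, iff_false, not_true_eq_false] <;>
      revert r c <;> decide


/-- A graph with vertex set `W` and edges `L`, a target boundary `b`, and for each vertex the
numbers `p` and `q` of already oriented edges entering it from, respectively leaving it to, a
root outside `W`. The target `b` only concerns the edges in `L`. -/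
structure Net (V : Type) where
  W : Finset V
  L : Multiset (Sym2 V)
  b : V → ZMod 6
  p : V → ℕ
  q : V → ℕ

namespace Net

/-- The number of edges leaving `A`, including those to the root. -/
def deg (N : Net V) (A : Finset V) : ℕ := cut N.L A + ∑ v ∈ A, (N.p v + N.q v)

/-- The total boundary of `A`, including the edges to the root. -/
def tau (N : Net V) (A : Finset V) : ZMod 6 := ∑ v ∈ A, (N.b v + N.q v - N.p v)

/-- The edges of the net have an orientation with the prescribed boundary. -/
def Orientable (N : Net V) : Prop :=
  ∃ M : Multiset (V × V), M.map und = N.L ∧ ∀ v ∈ N.W, bdry M v = N.b v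

/-- The hypotheses on a net under which an orientation exists. -/
structure Good (N : Net V) : Prop where
  mem : ∀ e ∈ N.L, ∀ v ∈ e, v ∈ N.W
  noloop : ∀ e ∈ N.L, ¬ e.IsDiag
  sum : ∑ v ∈ N.W, N.b v = 0
  par : ∀ A ⊆ N.W, (N.deg A + circ (N.tau A)) % 2 = 0
  low : ∀ A ⊆ N.W, A.Nonempty → A ≠ N.W → 4 + circ (N.tau A) ≤ N.deg A
  high : N.deg N.W ≤ 4 + circ (N.tau N.W)

/-- The induction measure. -/
def size (N : Net V) : ℕ ×ₗ ℕ ×ₗ ℕ :=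
  toLex (N.W.card, toLex (Multiset.card N.L, ∑ v ∈ N.W, (N.p v + N.q v)))

lemma size_lt_of_W {N N' : Net V} (h : N'.W.card < N.W.card) : N'.size < N.size := by
  simp only [size, Prod.Lex.toLex_lt_toLex]
  exact Or.inl h

lemma size_lt_of_L {N N' : Net V} (h : N'.W = N.W)
    (h' : Multiset.card N'.L < Multiset.card N.L) : N'.size < N.size := by
  simp only [size, Prod.Lex.toLex_lt_toLex]
  exact Or.inr ⟨by rw [h], Or.inl h'⟩

lemma size_lt_of_pq {N N' : Net V} (h : N'.W = N.W) (h' : N'.L = N.L)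
    (hlt : ∑ v ∈ N'.W, (N'.p v + N'.q v) < ∑ v ∈ N.W, (N.p v + N.q v)) :
    N'.size < N.size := by
  simp only [size, Prod.Lex.toLex_lt_toLex]
  exact Or.inr ⟨by rw [h], Or.inr ⟨by rw [h'], hlt⟩⟩

/-- A minimal counterexample. -/
structure Critical (N : Net V) : Prop extends Good N where
  ih : ∀ N' : Net V, N'.size < N.size → N'.Good → N'.Orientable
  not_orientable : ¬ N.Orientable

lemma circ_add_le (a b : ZMod 6) : circ (a + b) ≤ circ a + circ b := by
  revert a b; decide

lemma circ_neg (a : ZMod 6) : circ (-a) = circ a := by revert a; decide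

lemma circ_le (a : ZMod 6) : circ a ≤ 3 := by revert a; decide

/-! ### Reversal -/

/-- Reverse all directions. -/
def rev (N : Net V) : Net V := ⟨N.W, N.L, fun v => -N.b v, N.q, N.p⟩

lemma rev_rev (N : Net V) : N.rev.rev = N := by simp [rev]

lemma deg_rev (N : Net V) (A : Finset V) : N.rev.deg A = N.deg A := by
  simp only [deg, rev, add_comm (N.q _)]

lemma tau_rev (N : Net V) (A : Finset V) : N.rev.tau A = -N.tau A := by
  simp only [tau, rev, ← Finset.sum_neg_distrib]
  refine Finset.sum_congr rfl fun v _ => ?_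
  ring

lemma size_rev (N : Net V) : N.rev.size = N.size := by
  simp only [size, rev, add_comm (N.q _)]

lemma Good.rev {N : Net V} (h : N.Good) : N.rev.Good where
  mem := h.mem
  noloop := h.noloop
  sum := by
    have := h.sum
    simp only [Net.rev, Finset.sum_neg_distrib, this, neg_zero]
  par A hA := by rw [deg_rev, tau_rev, circ_neg]; exact h.par A hA
  low A hA := by rw [deg_rev, tau_rev, circ_neg]; exact h.low A hA
  high := by rw [deg_rev, tau_rev, circ_neg]; exact h.high

lemma bdry_swap (M : Multiset (V × V)) (v : V) : bdry (M.map Prod.swap) v = -bdry M v := by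
  simp [bdry]

lemma Orientable.rev {N : Net V} (h : N.Orientable) : N.rev.Orientable := by
  obtain ⟨M, hM, hb⟩ := h
  refine ⟨M.map Prod.swap, ?_, fun v hv => ?_⟩
  · rw [Multiset.map_map]
    refine Eq.trans ?_ hM
    exact Multiset.map_congr rfl fun a _ => Sym2.eq_swap
  · rw [bdry_swap, hb v hv]
    rfl

lemma Critical.rev {N : Net V} (h : N.Critical) : N.rev.Critical where
  toGood := h.toGood.rev
  ih N' hs hN' := by
    rw [size_rev] at hs
    rw [← rev_rev N']
    exact (h.ih N'.rev (by rwa [size_rev]) hN'.rev).rev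
  not_orientable ho := h.not_orientable (by rw [← rev_rev N]; exact ho.rev)

/-! ### Degrees and boundaries of unions -/

lemma Good.cut_univ {N : Net V} (h : N.Good) : cut N.L N.W = 0 :=
  cut_eq_zero _ _ fun e he => crossing_eq_zero (h.mem e he)

lemma Good.deg_univ {N : Net V} (h : N.Good) : N.deg N.W = ∑ v ∈ N.W, (N.p v + N.q v) := by
  rw [deg, h.cut_univ, zero_add]

lemma Good.deg_sdiff {N : Net V} (h : N.Good) {A : Finset V} (hA : A ⊆ N.W) :
    N.deg (N.W \ A) + N.deg A = 2 * cut N.L A + N.deg N.W := by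
  have h1 : cut N.L (N.W \ A) = cut N.L A :=
    cut_congr _ _ _ fun e he => crossing_sdiff (h.mem e he)
  have h2 := Finset.sum_sdiff (f := fun v => N.p v + N.q v) hA
  rw [h.deg_univ, deg, deg, h1]
  omega

lemma tau_sdiff (N : Net V) {A : Finset V} (hA : A ⊆ N.W) :
    N.tau (N.W \ A) + N.tau A = N.tau N.W :=
  Finset.sum_sdiff hA

lemma tau_singleton (N : Net V) (x : V) : N.tau {x} = N.b x + N.q x - N.p x := by
  simp [tau]

lemma deg_singleton (N : Net V) (x : V) : N.deg {x} = cut N.L {x} + (N.p x + N.q x) := by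
  simp [deg]

lemma tau_insert (N : Net V) {x : V} {A : Finset V} (hx : x ∉ A) :
    N.tau (insert x A) = N.tau {x} + N.tau A := by
  simp [tau, Finset.sum_insert hx]

/-- A net on at most one vertex is orientable. -/
lemma Good.orientable_of_card_le_one {N : Net V} (h : N.Good) (hW : N.W.card ≤ 1) :
    N.Orientable := by
  have hL : N.L = 0 := by
    refine Multiset.eq_zero_of_forall_notMem fun e he => h.noloop e he ?_
    have hm := h.mem e he
    induction e using Sym2.ind with
    | _ u v => exact Finset.card_le_one.1 hW u (hm u (by simp)) v (hm v (by simp))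
  refine ⟨0, by simp [hL], fun v hv => ?_⟩
  have hs := h.sum
  have : Nonempty V := ⟨v⟩
  rw [Finset.card_le_one_iff_subset_singleton] at hW
  obtain ⟨w, hw⟩ := hW
  obtain rfl : v = w := by simpa using hw hv
  have : N.W = {v} := Finset.Subset.antisymm hw (by simpa using hv)
  rw [this, Finset.sum_singleton] at hs
  simp [hs]

lemma Critical.two_le_card {N : Net V} (h : N.Critical) : 2 ≤ N.W.card := by
  by_contra hc
  exact h.not_orientable (h.toGood.orientable_of_card_le_one (by omega))

lemma Critical.two_le_cut {N : Net V} (h : N.Critical) {x : V} (hx : x ∈ N.W) :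
    2 ≤ cut N.L {x} := by
  have h2 := h.two_le_card
  have hs : ({x} : Finset V) ⊆ N.W := by simpa using hx
  have hne : ({x} : Finset V) ≠ N.W := by
    rintro he
    rw [← he] at h2
    simp at h2
  have h1 := h.low {x} hs (by simp) hne
  have h3 := h.low (N.W \ {x}) Finset.sdiff_subset
    (Finset.sdiff_nonempty.2 fun hsub => hne (Finset.Subset.antisymm hs hsub))
    (fun he => by
      have : x ∈ N.W \ {x} := by rw [he]; exact hx
      simp at this)
  have h4 := h.deg_sdiff hs
  have h5 := circ_add_le (N.tau (N.W \ {x})) (N.tau {x})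
  rw [N.tau_sdiff hs] at h5
  have h6 := h.high
  omega

/-! ### Edges at a vertex -/

lemma Good.exists_star {N : Net V} (h : N.Good) (x : V) :
    ∃ (Y : Multiset V) (L' : Multiset (Sym2 V)), N.L = (Y.map fun y => s(x, y)) + L' ∧
      (∀ e ∈ L', x ∉ e) ∧ x ∉ Y ∧ (∀ y ∈ Y, y ∈ N.W) ∧ Multiset.card Y = cut N.L {x} := by
  obtain ⟨Y, hY⟩ : ∃ Y : Multiset V, N.L.filter (x ∈ ·) = Y.map fun y => s(x, y) := by
    have : ∀ L : Multiset (Sym2 V), (∀ e ∈ L, x ∈ e) →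
        ∃ Y : Multiset V, L = Y.map fun y => s(x, y) := by
      intro L
      induction L using Multiset.induction_on with
      | empty => exact fun _ => ⟨0, by simp⟩
      | cons e L ih =>
        intro he
        obtain ⟨Y, hY⟩ := ih fun f hf => he f (Multiset.mem_cons_of_mem hf)
        obtain ⟨y, hy⟩ := Sym2.mem_iff_exists.1 (he e (Multiset.mem_cons_self e L))
        exact ⟨y ::ₘ Y, by simp [hY, hy]⟩
    exact this _ fun e he => (Multiset.mem_filter.1 he).2
  have hL : N.L = (Y.map fun y => s(x, y)) + N.L.filter (fun e => ¬ x ∈ e) := by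
    rw [← hY, Multiset.filter_add_not]
  have hmem : ∀ y ∈ Y, s(x, y) ∈ N.L := fun y hy => by
    rw [hL]
    exact Multiset.mem_add.2 (Or.inl (Multiset.mem_map_of_mem _ hy))
  have hxY : x ∉ Y := fun hxY => h.noloop _ (hmem x hxY) rfl
  refine ⟨Y, _, hL, fun e he => (Multiset.mem_filter.1 he).2, hxY,
    fun y hy => h.mem _ (hmem y hy) y (by simp), ?_⟩
  rw [hL, cut_add, cut_star_of_mem _ _ _ (by simp), cut_eq_zero (N.L.filter _) _, add_zero,
    Multiset.countP_eq_card.2]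
  · rintro y hy hyx
    exact hxY (by rwa [Finset.mem_singleton.1 hyx] at hy)
  · intro e he
    refine crossing_eq_zero' fun v hv hvx => (Multiset.mem_filter.1 he).2 ?_
    rwa [Finset.mem_singleton.1 hvx] at hv

lemma cut_insert_of_notMem {L : Multiset (Sym2 V)} {x : V} (h : ∀ e ∈ L, x ∉ e)
    (B : Finset V) : cut L (insert x B) = cut L B :=
  cut_congr _ _ _ fun e he => crossing_congr fun v hv => by
    have : v ≠ x := by rintro rfl; exact h e he hv
    simp [this]

lemma cut_star_insert {L : Multiset (Sym2 V)} {x : V} {B : Finset V} (h : ∀ e ∈ L, x ∉ e)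
    {Y : Multiset V} (hxY : x ∉ Y) (hx : x ∉ B) :
    cut ((Y.map fun y => s(x, y)) + L) (insert x B) =
      Multiset.countP (· ∉ B) Y + cut L B := by
  rw [cut_add, cut_insert_of_notMem h, cut_star_of_mem _ _ _ (by simp)]
  congr 1
  refine Multiset.countP_congr rfl fun y hy => ?_
  have : y ≠ x := by rintro rfl; exact hxY hy
  simp [this]


/-! ### Contraction -/

/-- The edges of the net with both ends in `A`. -/
def inner (N : Net V) (A : Finset V) : Multiset (Sym2 V) := N.L.filter fun e => e.toFinset ⊆ A

/-- The edges of the net with at least one end outside `A`. -/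
def outer (N : Net V) (A : Finset V) : Multiset (Sym2 V) := N.L.filter fun e => ¬ e.toFinset ⊆ A

lemma inner_add_outer (N : Net V) (A : Finset V) : N.inner A + N.outer A = N.L :=
  Multiset.filter_add_not _ _

/-- Send all of `A` to `a`. -/
def collapse (A : Finset V) (a : V) (v : V) : V := if v ∈ A then a else v

/-- The preimage of `B` under `collapse A a`, when `B` meets `A` at most in `a`. -/
def expand (A : Finset V) (a : V) (B : Finset V) : Finset V := if a ∈ B then B ∪ A else B

/-- Contract the set `A` to its element `a`. -/
def contract (N : Net V) (A : Finset V) (a : V) : Net V where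
  W := insert a (N.W \ A)
  L := (N.outer A).map (Sym2.map (collapse A a))
  b v := if v = a then ∑ u ∈ A, N.b u else N.b v
  p v := if v = a then ∑ u ∈ A, N.p u else N.p v
  q v := if v = a then ∑ u ∈ A, N.q u else N.q v

lemma sum_expand {R : Type} [AddCommMonoid R] (f : V → R) {W A B : Finset V} {a : V}
    (ha : a ∈ A) (hB : B ⊆ insert a (W \ A)) :
    ∑ v ∈ B, (if v = a then ∑ u ∈ A, f u else f v) = ∑ v ∈ expand A a B, f v := by
  have hBA : ∀ v ∈ B, v ≠ a → v ∉ A := fun v hv hva => by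
    have := hB hv
    simp only [Finset.mem_insert, hva, Finset.mem_sdiff, false_or] at this
    exact this.2
  unfold expand
  split_ifs with h
  · have hU : B ∪ A = B.erase a ∪ A := by
      ext v
      simp only [Finset.mem_union, Finset.mem_erase]
      by_cases hva : v = a
      · simp [hva, ha]
      · simp [hva]
    rw [hU, Finset.sum_union, ← Finset.add_sum_erase _ _ h, if_pos rfl, add_comm]
    · congr 1
      exact Finset.sum_congr rfl fun v hv => if_neg (Finset.ne_of_mem_erase hv)
    · exact Finset.disjoint_left.2 fun v hv =>
        hBA v (Finset.mem_of_mem_erase hv) (Finset.ne_of_mem_erase hv)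
  · refine Finset.sum_congr rfl fun v hv => if_neg ?_
    rintro rfl
    exact h hv

lemma mem_expand_iff {W A B : Finset V} {a : V} (hB : B ⊆ insert a (W \ A)) (v : V) :
    v ∈ expand A a B ↔ collapse A a v ∈ B := by
  unfold expand collapse
  by_cases haB : a ∈ B <;> by_cases hv : v ∈ A <;> simp only [haB, hv, if_true, if_false,
    Finset.mem_union, or_true, or_false, iff_false]
  intro hvB
  have := hB hvB
  simp only [Finset.mem_insert, Finset.mem_sdiff, hv, not_true_eq_false, and_false, or_false]
    at this
  exact haB (this ▸ hvB)

lemma crossing_map {A B W : Finset V} {a : V} (hB : B ⊆ insert a (W \ A))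
    (e : Sym2 V) :
    crossing B (e.map (collapse A a)) = crossing (expand A a B) e := by
  induction e using Sym2.ind with
  | _ u v => simp [mem_expand_iff hB]

lemma cut_inner_expand (N : Net V) {A B W : Finset V} {a : V}
    (hB : B ⊆ insert a (W \ A)) : cut (N.inner A) (expand A a B) = 0 := by
  refine cut_eq_zero _ _ fun e he => ?_
  have hA := (Multiset.mem_filter.1 he).2
  rw [← crossing_map hB]
  induction e using Sym2.ind with
  | _ u v =>
    have hu : u ∈ A := hA (by simp)
    have hv : v ∈ A := hA (by simp)
    simp [collapse, hu, hv]

section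

variable {N : Net V} {A : Finset V} {a : V}

lemma deg_contract (ha : a ∈ A) {B : Finset V}
    (hB : B ⊆ (N.contract A a).W) : (N.contract A a).deg B = N.deg (expand A a B) := by
  have hB' : B ⊆ insert a (N.W \ A) := hB
  have h1 : cut (N.contract A a).L B = cut N.L (expand A a B) := by
    rw [← inner_add_outer N A, cut_add, cut_inner_expand N hB', zero_add]
    simp only [contract, cut, Multiset.map_map, Function.comp_def, crossing_map hB']
  simp only [deg, h1, Finset.sum_add_distrib]
  rw [← sum_expand N.p ha hB', ← sum_expand N.q ha hB']
  rfl

lemma tau_contract (ha : a ∈ A) {B : Finset V}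
    (hB : B ⊆ (N.contract A a).W) : (N.contract A a).tau B = N.tau (expand A a B) := by
  have hB' : B ⊆ insert a (N.W \ A) := hB
  simp only [tau]
  rw [← sum_expand (fun v => N.b v + N.q v - N.p v) ha hB']
  refine Finset.sum_congr rfl fun v _ => ?_
  simp only [contract]
  split_ifs
  · rw [Finset.sum_sub_distrib, Finset.sum_add_distrib]
    push_cast
    rfl
  · rfl

lemma expand_subset (hA : A ⊆ N.W) (ha : a ∈ A) {B : Finset V}
    (hB : B ⊆ (N.contract A a).W) : expand A a B ⊆ N.W := fun v hv => by
  have hB' : B ⊆ insert a (N.W \ A) := hB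
  by_cases hvA : v ∈ A
  · exact hA hvA
  · rw [mem_expand_iff hB', collapse, if_neg hvA] at hv
    have := hB' hv
    simp only [Finset.mem_insert, Finset.mem_sdiff] at this
    rcases this with rfl | h
    · exact absurd ha hvA
    · exact h.1

lemma expand_eq_univ (hA : A ⊆ N.W) (ha : a ∈ A) {B : Finset V}
    (hB : B ⊆ (N.contract A a).W) : expand A a B = N.W ↔ B = (N.contract A a).W := by
  have hB' : B ⊆ insert a (N.W \ A) := hB
  constructor
  · intro h
    refine Finset.Subset.antisymm hB fun v hv => ?_
    have hv' : v ∈ insert a (N.W \ A) := hv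
    simp only [Finset.mem_insert, Finset.mem_sdiff] at hv'
    rcases hv' with rfl | ⟨h1, h2⟩
    · have : v ∈ expand A v B := h ▸ hA ha
      simpa [mem_expand_iff hB', collapse, ha] using this
    · have : v ∈ expand A a B := h ▸ h1
      simpa [mem_expand_iff hB', collapse, h2] using this
  · intro h
    refine Finset.Subset.antisymm (expand_subset hA ha hB) fun v hv => ?_
    rw [mem_expand_iff hB', h]
    simp only [contract, collapse]
    split_ifs with hvA <;> simp [hvA, hv]

lemma expand_nonempty {B : Finset V} (hB : B.Nonempty) : (expand A a B).Nonempty := by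
  unfold expand
  split_ifs
  · exact hB.mono Finset.subset_union_left
  · exact hB

lemma Good.contract (h : N.Good) (hA : A ⊆ N.W) (ha : a ∈ A) : (N.contract A a).Good where
  mem e he v hv := by
    obtain ⟨f, hf, rfl⟩ := Multiset.mem_map.1 he
    obtain ⟨u, hu, rfl⟩ := Sym2.mem_map.1 hv
    have := h.mem f (Multiset.mem_filter.1 hf).1 u hu
    simp only [Net.contract, collapse]
    split_ifs with huA <;> simp [huA, this]
  noloop e he := by
    obtain ⟨f, hf, rfl⟩ := Multiset.mem_map.1 he
    obtain ⟨hfL, hfA⟩ := Multiset.mem_filter.1 hf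
    have hl := h.noloop f hfL
    induction f using Sym2.ind with
    | _ u v =>
      rw [Sym2.map_mk, Sym2.mk_isDiag_iff]
      rw [Sym2.mk_isDiag_iff] at hl
      simp only [collapse]
      have : ¬ (u ∈ A ∧ v ∈ A) := fun huv => hfA (by
        intro w hw
        rw [Sym2.mem_toFinset, Sym2.mem_iff] at hw
        rcases hw with rfl | rfl
        exacts [huv.1, huv.2])
      split_ifs with h1 h2 h2
      · exact absurd ⟨h1, h2⟩ this
      · rintro rfl; exact h2 ha
      · rintro rfl; exact h1 ha
      · exact hl
  sum := by
    rw [← h.sum, ← (expand_eq_univ hA ha (Finset.Subset.refl _)).2 rfl]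
    exact sum_expand N.b ha (Finset.Subset.refl _)
  par B hB := by
    rw [deg_contract ha hB, tau_contract ha hB]
    exact h.par _ (expand_subset hA ha hB)
  low B hB hne hB' := by
    rw [deg_contract ha hB, tau_contract ha hB]
    exact h.low _ (expand_subset hA ha hB) (expand_nonempty hne)
      fun he => hB' ((expand_eq_univ hA ha hB).1 he)
  high := by
    rw [deg_contract ha (Finset.Subset.refl _), tau_contract ha (Finset.Subset.refl _),
      (expand_eq_univ hA ha (Finset.Subset.refl _)).2 rfl]
    exact h.high

lemma card_contract (hA : A ⊆ N.W) : (N.contract A a).W.card + A.card ≤ N.W.card + 1 := by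
  have h1 := Finset.card_insert_le a (N.W \ A)
  have h2 := Finset.card_sdiff_add_card_eq_card hA
  simp only [contract]
  omega

end

/-- The net on `A` left over after the edges outside `A` have been oriented as in `M`. -/
def residual (N : Net V) (A : Finset V) (M : Multiset (V × V)) : Net V where
  W := A
  L := N.inner A
  b v := N.b v - bdry M v
  p v := N.p v + (M.map Prod.snd).count v
  q v := N.q v + (M.map Prod.fst).count v

section

variable {N : Net V} {A : Finset V} {M : Multiset (V × V)}

lemma tau_residual (B : Finset V) : (N.residual A M).tau B = N.tau B := by
  refine Finset.sum_congr rfl fun v _ => ?_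
  simp only [residual, bdry]
  push_cast
  ring

lemma cut_eq_sum_of_forall_not_subset {A B : Finset V} (M : Multiset (V × V))
    (h : ∀ a ∈ M, ¬ (und a).toFinset ⊆ A) (hB : B ⊆ A) :
    cut (M.map und) B = ∑ v ∈ B, ((M.map Prod.snd).count v + (M.map Prod.fst).count v) := by
  rw [Finset.sum_add_distrib, sum_count, sum_count]
  induction M using Multiset.induction_on with
  | empty => simp
  | cons a M ih =>
    rcases a with ⟨u, v⟩
    have h1 := h _ (Multiset.mem_cons_self _ _)
    have h2 : ¬ (u ∈ B ∧ v ∈ B) := fun huv => h1 fun w hw => by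
      rw [Sym2.mem_toFinset, und_mk, Sym2.mem_iff] at hw
      rcases hw with rfl | rfl
      exacts [hB huv.1, hB huv.2]
    simp only [Multiset.map_cons, cut_cons, ih fun e he => h e (Multiset.mem_cons_of_mem he),
      Multiset.countP_cons, und_mk, crossing_mk]
    by_cases hu : u ∈ B <;> by_cases hv : v ∈ B <;> simp_all <;> omega

lemma deg_residual (hM : M.map und = N.outer A) {B : Finset V} (hB : B ⊆ A) :
    (N.residual A M).deg B = N.deg B := by
  have h1 := cut_eq_sum_of_forall_not_subset M (A := A) (fun a ha => by
    have : und a ∈ N.outer A := hM ▸ Multiset.mem_map_of_mem _ ha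
    exact (Multiset.mem_filter.1 this).2) hB
  simp only [deg, residual]
  rw [← N.inner_add_outer A, cut_add, ← hM, h1, add_assoc, ← Finset.sum_add_distrib]
  congr 1
  refine Finset.sum_congr rfl fun v _ => ?_
  ring

lemma Orientable.of_residual (hM : M.map und = N.outer A)
    (hb : ∀ v ∈ N.W, v ∉ A → bdry M v = N.b v) (h : (N.residual A M).Orientable) :
    N.Orientable := by
  obtain ⟨M', hM', hb'⟩ := h
  refine ⟨M' + M, ?_, fun v hv => ?_⟩
  · rw [Multiset.map_add, hM', hM]
    exact N.inner_add_outer A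
  · rw [bdry_add]
    by_cases hvA : v ∈ A
    · rw [hb' v hvA]
      simp [residual]
    · rw [hb v hv hvA, bdry_eq_zero M' v, zero_add]
      intro a ha hva
      have : und a ∈ N.inner A := by
        have := Multiset.mem_map_of_mem und ha
        rw [hM'] at this
        exact this
      exact hvA ((Multiset.mem_filter.1 this).2 (by simpa using hva))

end

lemma bdry_map_collapse {A : Finset V} {a : V} (ha : a ∈ A) (M : Multiset (V × V)) :
    bdry (M.map (Prod.map (collapse A a) (collapse A a))) a = ∑ v ∈ A, bdry M v ∧
      ∀ v ∉ A, bdry (M.map (Prod.map (collapse A a) (collapse A a))) v = bdry M v := by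
  have key : ∀ u, (a = collapse A a u ↔ u ∈ A) := fun u => by
    unfold collapse
    split_ifs with hu
    · simp [hu]
    · simp only [hu, iff_false]
      rintro rfl
      exact hu ha
  have key' : ∀ v ∉ A, ∀ u, (v = collapse A a u ↔ v = u) := fun v hv u => by
    unfold collapse
    split_ifs with hu
    · constructor
      · rintro rfl; exact absurd ha hv
      · rintro rfl; exact absurd hu hv
    · rfl
  induction M using Multiset.induction_on with
  | empty => simp
  | cons c M ih =>
    rcases c with ⟨u, w⟩
    refine ⟨?_, fun v hv => ?_⟩
    · rw [Multiset.map_cons, bdry_cons, ih.1, sum_bdry_cons]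
      simp only [Prod.map_apply, key]
    · rw [Multiset.map_cons, bdry_cons, ih.2 v hv, bdry_cons]
      simp only [Prod.map_apply, key' v hv]

/-- An orientation of the contracted net reduces the orientation problem to a net on `A`. -/
lemma exists_residual {N : Net V} {A : Finset V} {a : V}
    (ha : a ∈ A) {M₁ : Multiset (V × V)} (hM₁ : M₁.map und = (N.contract A a).L)
    (hb₁ : ∀ v ∈ (N.contract A a).W, bdry M₁ v = (N.contract A a).b v) :
    ∃ N₂ : Net V, N₂.W = A ∧ N₂.L = N.inner A ∧ (∀ B ⊆ A, N₂.deg B = N.deg B) ∧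
      (∀ B, N₂.tau B = N.tau B) ∧ ∑ v ∈ A, N₂.b v = 0 ∧
      (∀ w ∉ A, (a, w) ∈ M₁ → ∃ u ∈ A, 0 < N₂.q u) ∧ (N₂.Orientable → N.Orientable) := by
  obtain ⟨M, hM, hMM⟩ := exists_lift_arcs (collapse A a) _ M₁ hM₁
  have hbd := bdry_map_collapse ha M
  rw [hMM] at hbd
  refine ⟨N.residual A M, rfl, rfl, fun B hB => deg_residual hM hB, fun B => tau_residual B,
    ?_, fun w hw haw => ?_, Orientable.of_residual hM fun v hv hvA => ?_⟩
  · simp only [residual, Finset.sum_sub_distrib]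
    rw [← hbd.1, hb₁ a (by simp [Net.contract])]
    simp [Net.contract]
  · rw [← hMM] at haw
    obtain ⟨⟨u, v⟩, huv, he⟩ := Multiset.mem_map.1 haw
    simp only [Prod.map_apply, Prod.mk.injEq] at he
    have hu : u ∈ A := by
      by_contra hu
      rw [collapse, if_neg hu] at he
      exact hu (he.1 ▸ ha)
    refine ⟨u, hu, ?_⟩
    have : 0 < (M.map Prod.fst).count u :=
      Multiset.count_pos.2 (Multiset.mem_map.2 ⟨_, huv, rfl⟩)
    simp only [residual]
    omega
  · have hva : v ≠ a := by rintro rfl; exact hvA ha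
    rw [← hbd.2 v hvA, hb₁ v (by simp [Net.contract, hv, hvA])]
    simp [Net.contract, hva]


/-! ### First reductions for a minimal counterexample -/

lemma Good.of_inner {N N₂ : Net V} (h : N.Good) {A : Finset V} (hA : A ⊆ N.W) (hAW : A ≠ N.W)
    (hW : N₂.W = A) (hL : N₂.L = N.inner A) (hdeg : ∀ B ⊆ A, N₂.deg B = N.deg B)
    (htau : ∀ B, N₂.tau B = N.tau B) (hsum : ∑ v ∈ A, N₂.b v = 0)
    (hhigh : N.deg A ≤ 4 + circ (N.tau A)) : N₂.Good where
  mem e he v hv := by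
    rw [hL] at he
    rw [hW]
    exact (Multiset.mem_filter.1 he).2 (by simpa using hv)
  noloop e he := by
    rw [hL] at he
    exact h.noloop e (Multiset.mem_filter.1 he).1
  sum := by rw [hW, hsum]
  par B hB := by
    rw [hW] at hB
    rw [hdeg B hB, htau]
    exact h.par B (hB.trans hA)
  low B hB hne _ := by
    rw [hW] at hB
    rw [hdeg B hB, htau]
    refine h.low B (hB.trans hA) hne ?_
    rintro rfl
    exact hAW (Finset.Subset.antisymm hA hB)
  high := by rwa [hW, hdeg A (Finset.Subset.refl A), htau]

lemma Critical.exists_contract {N : Net V} (h : N.Critical) {A : Finset V} {a : V}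
    (hA : A ⊆ N.W) (ha : a ∈ A) (h2 : 2 ≤ A.card) :
    ∃ M : Multiset (V × V), M.map und = (N.contract A a).L ∧
      ∀ v ∈ (N.contract A a).W, bdry M v = (N.contract A a).b v := by
  refine h.ih _ (size_lt_of_W ?_) (h.toGood.contract hA ha)
  have := card_contract (a := a) hA
  omega

lemma Critical.six_le_deg {N : Net V} (h : N.Critical) {A : Finset V} (hA : A ⊆ N.W)
    (h2 : 2 ≤ A.card) (hne : A ≠ N.W) : 6 + circ (N.tau A) ≤ N.deg A := by
  by_contra hlt
  obtain ⟨a, ha⟩ : A.Nonempty := Finset.card_pos.1 (by omega)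
  have hlow := h.low A hA ⟨a, ha⟩ hne
  have hpar := h.par A hA
  obtain ⟨M₁, hM₁, hb₁⟩ := h.exists_contract hA ha h2
  obtain ⟨N₂, hW, hL, hdeg, htau, hsum, -, ho⟩ := exists_residual ha hM₁ hb₁
  refine h.not_orientable (ho (h.ih N₂ (size_lt_of_W ?_)
    (h.toGood.of_inner hA hne hW hL hdeg htau hsum (by omega))))
  rw [hW]
  exact Finset.card_lt_card (Finset.ssubset_iff_subset_ne.2 ⟨hA, hne⟩)

lemma even_iff_mem (z : ZMod 6) : Even z ↔ z ∈ ({0, 2, 4} : Finset (ZMod 6)) := by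
  unfold Even
  revert z; decide

lemma Good.even_deg_add_tau {N : Net V} (h : N.Good) {A : Finset V} (hA : A ⊆ N.W) :
    Even ((N.deg A : ZMod 6) + N.tau A) := by
  have h1 : Even ((N.deg A + circ (N.tau A) : ℕ) : ZMod 6) :=
    (Nat.even_iff.2 (h.par A hA)).natCast
  push_cast at h1
  have h2 : ∀ t : ZMod 6, Even (t - (circ t : ZMod 6)) := by
    intro t
    rw [even_iff_mem]
    revert t
    decide
  have h3 := h1.add (h2 (N.tau A))
  rwa [add_assoc, add_sub_cancel] at h3

lemma Critical.not_parallel {N : Net V} (h : N.Critical) {x y : V} {L : Multiset (Sym2 V)}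
    (hL : N.L = s(x, y) ::ₘ s(x, y) ::ₘ L) : False := by
  have he : s(x, y) ∈ N.L := by simp [hL]
  have hx : x ∈ N.W := h.mem _ he x (by simp)
  have hy : y ∈ N.W := h.mem _ he y (by simp)
  have hxy : x ≠ y := h.noloop _ he
  have hA : ({x, y} : Finset V) ⊆ N.W := by
    intro v hv
    rw [Finset.mem_insert, Finset.mem_singleton] at hv
    rcases hv with rfl | rfl <;> assumption
  have hxA : x ∈ ({x, y} : Finset V) := by simp
  obtain ⟨M₁, hM₁, hb₁⟩ := h.exists_contract hA hxA (by rw [Finset.card_pair hxy])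
  obtain ⟨N₂, hW, hL₂, hdeg, htau, hsum, -, ho⟩ := exists_residual hxA hM₁ hb₁
  refine h.not_orientable (ho ?_)
  have hsub : (s(x, y)).toFinset ⊆ ({x, y} : Finset V) := fun v hv => by
    simpa using hv
  obtain ⟨R, hR, hRA⟩ : ∃ R : Multiset (Sym2 V), N₂.L = s(x, y) ::ₘ s(x, y) ::ₘ R ∧
      ∀ e ∈ R, ∀ v ∈ e, v ∈ ({x, y} : Finset V) := by
    refine ⟨L.filter fun e => e.toFinset ⊆ {x, y}, ?_, fun e he v hv => ?_⟩
    · simp only [hL₂, inner, hL, Multiset.filter_cons, hsub, if_true, Multiset.singleton_add]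
    · exact (Multiset.mem_filter.1 he).2 (by simpa using hv)
  obtain ⟨M, hM⟩ := exists_arcs R
  have h1 := bdry_parity M x
  rw [← even_iff_mem, hM] at h1
  have h2 := h.toGood.even_deg_add_tau (A := {x}) (by simpa using hx)
  rw [← hdeg {x} (by simp), ← htau, deg_singleton, tau_singleton, hR] at h2
  have hr : Even (N₂.b x - bdry M x) := by
    have h3 := ((h2.sub h1).sub ⟨(1 : ZMod 6), rfl⟩).sub ⟨(N₂.q x : ZMod 6), rfl⟩
    simp only [cut_cons, crossing_mk, Finset.mem_singleton, hxy.symm, iff_false,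
      not_true_eq_false, if_false, Nat.cast_add, Nat.cast_one] at h3
    have key : ∀ c b d p q : ZMod 6,
        1 + (1 + c) + (p + q) + (b + q - p) - (c + d) - (1 + 1) - (q + q) = b - d := by
      intros; ring
    rwa [key] at h3
  have hz := sum_bdry_eq_zero M {x, y} fun a ha => by
    have := hRA _ (hM ▸ Multiset.mem_map_of_mem _ ha)
    exact iff_of_true (this a.1 (by simp [und])) (this a.2 (by simp [und]))
  rw [Finset.sum_pair hxy] at hz hsum
  rw [even_iff_mem] at hr
  simp only [Finset.mem_insert, Finset.mem_singleton] at hr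
  have key : ∀ M' : Multiset (V × V), M'.map und = N₂.L →
      bdry M' x = N₂.b x → bdry M' y = -bdry M' x → N₂.Orientable := by
    intro M' k1 k2 k3
    refine ⟨M', k1, fun v hv => ?_⟩
    rw [hW, Finset.mem_insert, Finset.mem_singleton] at hv
    rcases hv with rfl | rfl
    · exact k2
    · rw [k3, k2]
      exact (eq_neg_of_add_eq_zero_right hsum).symm
  have hy' := eq_neg_of_add_eq_zero_right hz
  rcases hr with hr | hr | hr <;> rw [sub_eq_iff_eq_add] at hr
  · refine key ((x, y) ::ₘ (y, x) ::ₘ M) (by simp [hR, hM, Sym2.eq_swap (a := y)]) ?_ ?_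
    · rw [hr]; simp [bdry_cons, hxy]
    · simp [bdry_cons, hxy, hxy.symm, hy']
  · refine key ((x, y) ::ₘ (x, y) ::ₘ M) (by simp [hR, hM]) ?_ ?_
    · rw [hr]; simp only [bdry_cons, hxy, if_true, if_false]; ring
    · simp only [bdry_cons, hxy, hxy.symm, if_true, if_false, hy']; ring
  · refine key ((y, x) ::ₘ (y, x) ::ₘ M) (by simp [hR, hM, Sym2.eq_swap (a := y)]) ?_ ?_
    · rw [hr]; simp only [bdry_cons, hxy, if_true, if_false]
      generalize bdry M x = r
      revert r; decide
    · simp only [bdry_cons, hxy, hxy.symm, if_true, if_false, hy']; ring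

lemma bdry_cons_eq {M : Multiset (V × V)} {x y v : V} {r : ZMod 6}
    (h : bdry M v = r - (if v = x then 1 else 0) + (if v = y then 1 else 0)) :
    bdry ((x, y) ::ₘ M) v = r := by
  rw [bdry_cons, h]
  ring

lemma Critical.exists_edge {N : Net V} (h : N.Critical) :
    ∃ x y L, N.L = s(x, y) ::ₘ L := by
  obtain ⟨x, hx⟩ : N.W.Nonempty := Finset.card_pos.1 (by have := h.two_le_card; omega)
  have h2 := h.two_le_cut hx
  obtain ⟨Y, L', hL, -, -, -, hc⟩ := h.toGood.exists_star x
  obtain ⟨y, hy⟩ := Multiset.card_pos_iff_exists_mem.1 (show 0 < Multiset.card Y by omega)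
  obtain ⟨Y', rfl⟩ := Multiset.exists_cons_of_mem hy
  exact ⟨x, y, _, by rw [hL, Multiset.map_cons, Multiset.cons_add]⟩

lemma Critical.deg_univ_eq {N : Net V} (h : N.Critical) :
    N.deg N.W = 4 + circ (N.tau N.W) := by
  by_contra hne
  have hhigh := h.high
  have hparW := h.par N.W (Finset.Subset.refl _)
  obtain ⟨x, y, L', hL⟩ := h.exists_edge
  have he : s(x, y) ∈ N.L := by simp [hL]
  have hx : x ∈ N.W := h.mem _ he x (by simp)
  have hy : y ∈ N.W := h.mem _ he y (by simp)
  let N' : Net V := ⟨N.W, L', fun v => N.b v - (if v = x then 1 else 0) + (if v = y then 1 else 0),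
    fun v => N.p v + (if v = y then 1 else 0), fun v => N.q v + (if v = x then 1 else 0)⟩
  have hdeg : ∀ B, N'.deg B = N.deg B + 2 * (if x ∈ B ∧ y ∈ B then 1 else 0) := by
    intro B
    simp only [N', deg, hL, cut_cons, crossing_mk, Finset.sum_add_distrib, Finset.sum_ite_eq']
    by_cases h1 : x ∈ B <;> by_cases h2 : y ∈ B <;> simp [h1, h2] <;> omega
  have htau : ∀ B, N'.tau B = N.tau B := by
    intro B
    refine Finset.sum_congr rfl fun v _ => ?_
    simp only [N']
    push_cast
    ring
  have hgood : N'.Good :=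
    { mem := fun e he => h.mem e (by rw [hL]; exact Multiset.mem_cons_of_mem he)
      noloop := fun e he => h.noloop e (by rw [hL]; exact Multiset.mem_cons_of_mem he)
      sum := by
        simp only [N', Finset.sum_add_distrib, Finset.sum_sub_distrib, Finset.sum_ite_eq', hx, hy,
          h.sum, if_true]
        ring
      par := fun A hA => by
        have := h.par A hA
        rw [hdeg, htau]
        omega
      low := fun A hA hne hW => by
        have := h.low A hA hne hW
        rw [hdeg, htau]
        omega
      high := by
        rw [hdeg, htau]
        simp only [N', hx, hy]
        simp only [and_self, if_true]
        omega }
  obtain ⟨M, hM, hb⟩ := h.ih N' (size_lt_of_L rfl (by simp [N', hL])) hgood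
  exact h.not_orientable ⟨(x, y) ::ₘ M, by simp [hM, hL, N'], fun v hv => bdry_cons_eq (hb v hv)⟩

lemma circ_sub_one (t : ZMod 6) :
    (circ (t - 1) + 1 + circ t) % 2 = 0 ∧ circ (t - 1) ≤ circ t + 1 ∧
      circ t ≤ circ (t - 1) + 1 := by
  revert t; decide

lemma circ_add_one (t : ZMod 6) :
    (circ (t + 1) + 1 + circ t) % 2 = 0 ∧ circ (t + 1) ≤ circ t + 1 ∧
      circ t ≤ circ (t + 1) + 1 := by
  revert t; decide

lemma Critical.not_of_edge {N : Net V} (h : N.Critical) {x y : V} {L' : Multiset (Sym2 V)}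
    (hL : N.L = s(x, y) ::ₘ L') (hox : 5 + circ (N.tau {x} - 1) ≤ N.deg {x})
    (hoy : 5 + circ (N.tau {y} + 1) ≤ N.deg {y}) : False := by
  have he : s(x, y) ∈ N.L := by simp [hL]
  have hx : x ∈ N.W := h.mem _ he x (by simp)
  have hy : y ∈ N.W := h.mem _ he y (by simp)
  have hxy : x ≠ y := h.noloop _ he
  let N' : Net V := ⟨N.W, L', fun v => N.b v - (if v = x then 1 else 0) + (if v = y then 1 else 0),
    N.p, N.q⟩
  have hdeg : ∀ B, N'.deg B + (if (x ∈ B ↔ y ∈ B) then 0 else 1) = N.deg B := by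
    intro B
    simp only [N', deg, hL, cut_cons, crossing_mk]
    omega
  have htau : ∀ B, N'.tau B =
      N.tau B - (if x ∈ B then 1 else 0) + (if y ∈ B then 1 else 0) := by
    intro B
    simp only [N', tau, Finset.sum_add_distrib, Finset.sum_sub_distrib, Finset.sum_ite_eq']
    ring
  have hgood : N'.Good :=
    { mem := fun e he => h.mem e (by rw [hL]; exact Multiset.mem_cons_of_mem he)
      noloop := fun e he => h.noloop e (by rw [hL]; exact Multiset.mem_cons_of_mem he)
      sum := by
        simp only [N', Finset.sum_add_distrib, Finset.sum_sub_distrib, Finset.sum_ite_eq', hx, hy,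
          h.sum, if_true]
        ring
      par := fun A hA => by
        have h1 := h.par A hA
        have h2 := hdeg A
        have h3 := circ_sub_one (N.tau A)
        have h4 := circ_add_one (N.tau A)
        rw [htau]
        by_cases hxA : x ∈ A <;> by_cases hyA : y ∈ A <;>
          simp only [hxA, hyA, if_true, if_false, sub_add_cancel, sub_zero, add_zero, iff_false,
            iff_true, not_true_eq_false] at h2 ⊢ <;> omega
      low := fun A hA hne hW => by
        have h1 := h.low A hA hne hW
        have h2 := hdeg A
        have h3 := circ_sub_one (N.tau A)
        have h4 := circ_add_one (N.tau A)
        have h5 : 2 ≤ A.card → _ := fun hc => h.six_le_deg hA hc hW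
        have h6 : A.card ≤ 1 → x ∈ A → A = {x} := fun hc hxA =>
          Finset.eq_singleton_iff_unique_mem.2
            ⟨hxA, fun z hz => Finset.card_le_one.1 hc z hz x hxA⟩
        have h7 : A.card ≤ 1 → y ∈ A → A = {y} := fun hc hyA =>
          Finset.eq_singleton_iff_unique_mem.2
            ⟨hyA, fun z hz => Finset.card_le_one.1 hc z hz y hyA⟩
        rw [htau]
        rcases le_or_gt A.card 1 with hc | hc
        · by_cases hxA : x ∈ A
          · obtain rfl := h6 hc hxA
            simp only [Finset.mem_singleton, hxy.symm, if_true, if_false, iff_false,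
              not_true_eq_false, add_zero] at h2 ⊢
            omega
          · by_cases hyA : y ∈ A
            · obtain rfl := h7 hc hyA
              simp only [Finset.mem_singleton, hxy, if_true, if_false, false_iff,
                not_true_eq_false, sub_zero] at h2 ⊢
              omega
            · simp only [hxA, hyA, if_true, if_false, sub_zero, add_zero] at h2 ⊢
              omega
        · have h8 := h5 hc
          by_cases hxA : x ∈ A <;> by_cases hyA : y ∈ A <;>
            simp only [hxA, hyA, if_true, if_false, sub_add_cancel, sub_zero, add_zero, iff_false,
              iff_true, not_true_eq_false] at h2 ⊢ <;> omega
      high := by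
        have h1 := h.high
        have h2 := hdeg N.W
        rw [htau]
        simp only [N', hx, hy, if_true, sub_add_cancel] at h2 ⊢
        omega }
  obtain ⟨M, hM, hb⟩ := h.ih N' (size_lt_of_L rfl (by simp [N', hL])) hgood
  exact h.not_orientable ⟨(x, y) ::ₘ M, by simp [hM, hL, N'], fun v hv => bdry_cons_eq (hb v hv)⟩

lemma Critical.deg_lt_of_p_pos {N : Net V} (h : N.Critical) {x : V} (hx : x ∈ N.W)
    (hp : 0 < N.p x) : N.deg {x} < 5 + circ (N.tau {x} + 1) := by
  by_contra! hox
  let N' : Net V := ⟨N.W, N.L, N.b, fun v => N.p v - (if v = x then 1 else 0), N.q⟩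
  have hp' : ∀ v, N.p v = N'.p v + (if v = x then 1 else 0) := fun v => by
    simp only [N']
    split_ifs with hv
    · subst hv; omega
    · rfl
  have hdeg : ∀ B, N'.deg B + (if x ∈ B then 1 else 0) = N.deg B := by
    intro B
    simp only [deg, hp', Finset.sum_add_distrib, Finset.sum_ite_eq']
    simp only [N']
    omega
  have htau : ∀ B, N'.tau B = N.tau B + (if x ∈ B then 1 else 0) := by
    intro B
    simp only [tau, hp', Nat.cast_add, Nat.cast_ite, Nat.cast_one, Nat.cast_zero,
      Finset.sum_add_distrib, Finset.sum_sub_distrib, Finset.sum_ite_eq']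
    simp only [N']
    ring
  have hgood : N'.Good :=
    { mem := h.mem
      noloop := h.noloop
      sum := h.sum
      par := fun A hA => by
        have h1 := h.par A hA
        have h2 := hdeg A
        have h4 := circ_add_one (N.tau A)
        rw [htau]
        split_ifs at h2 ⊢
        · omega
        · rw [add_zero]; omega
      low := fun A hA hne hW => by
        have h1 := h.low A hA hne hW
        have h2 := hdeg A
        have h4 := circ_add_one (N.tau A)
        rw [htau]
        split_ifs at h2 ⊢ with hxA
        · rcases le_or_gt A.card 1 with hc | hc
          · obtain rfl : A = {x} := Finset.eq_singleton_iff_unique_mem.2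
              ⟨hxA, fun z hz => Finset.card_le_one.1 hc z hz x hxA⟩
            omega
          · have := h.six_le_deg hA hc hW
            omega
        · rw [add_zero]; omega
      high := by
        have h1 := h.high
        have h2 := hdeg N.W
        have h4 := circ_add_one (N.tau N.W)
        rw [htau]
        simp only [N', hx, if_true] at h2 ⊢
        omega }
  refine h.not_orientable (h.ih N' (size_lt_of_pq rfl rfl ?_) hgood)
  have : N'.W = N.W := rfl
  simp only [hp', this, Finset.sum_add_distrib, Finset.sum_ite_eq', hx, if_true]
  simp only [N']
  omega

lemma Critical.deg_lt_of_q_pos {N : Net V} (h : N.Critical) {x : V} (hx : x ∈ N.W)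
    (hq : 0 < N.q x) : N.deg {x} < 5 + circ (N.tau {x} - 1) := by
  have := h.rev.deg_lt_of_p_pos hx hq
  rwa [deg_rev, tau_rev, ← circ_neg, neg_add, neg_neg, ← sub_eq_add_neg] at this


/-! ### Splitting off a vertex of degree four -/

lemma Good.deg_erase {N : Net V} (h : N.Good) {x : V} (hx : x ∈ N.W) :
    N.deg (N.W.erase x) + N.deg {x} = 2 * cut N.L {x} + N.deg N.W := by
  rw [← Finset.sdiff_singleton_eq_erase]
  exact h.deg_sdiff (by simpa using hx)

lemma tau_erase (N : Net V) {x : V} (hx : x ∈ N.W) :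
    N.tau (N.W.erase x) + N.tau {x} = N.tau N.W := by
  rw [← Finset.sdiff_singleton_eq_erase]
  exact N.tau_sdiff (by simpa using hx)

lemma Critical.nodup_star {N : Net V} (h : N.Critical) {x : V} {Y : Multiset V}
    {L' : Multiset (Sym2 V)} (hL : N.L = (Y.map fun y => s(x, y)) + L') : Y.Nodup := by
  refine Multiset.nodup_iff_ne_cons_cons.2 fun y t hY => ?_
  refine h.not_parallel (x := x) (y := y) (L := t.map (fun y => s(x, y)) + L') ?_
  rw [hL, hY]
  simp

lemma Critical.three_le_card {N : Net V} (h : N.Critical) : 3 ≤ N.W.card := by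
  obtain ⟨x, hx⟩ : N.W.Nonempty := Finset.card_pos.1 (by have := h.two_le_card; omega)
  obtain ⟨Y, L', hL, -, hxY, hYW, hc⟩ := h.toGood.exists_star x
  have h1 : Y.toFinset.card ≤ (N.W.erase x).card := Finset.card_le_card fun y hy => by
    rw [Multiset.mem_toFinset] at hy
    refine Finset.mem_erase.2 ⟨?_, hYW y hy⟩
    rintro rfl
    exact hxY hy
  rw [Multiset.toFinset_card_of_nodup (h.nodup_star hL), Finset.card_erase_of_mem hx] at h1
  have := h.two_le_cut hx
  omega

lemma Critical.six_le_deg_erase {N : Net V} (h : N.Critical) {x : V} (hx : x ∈ N.W) :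
    6 + circ (N.tau (N.W.erase x)) ≤ N.deg (N.W.erase x) := by
  have := h.three_le_card
  refine h.six_le_deg (Finset.erase_subset _ _) ?_ fun he => ?_
  · rw [Finset.card_erase_of_mem hx]; omega
  · rw [← he] at hx
    simp at hx

lemma deg_of_star {N : Net V} {x : V} {Y : Multiset V} {L' : Multiset (Sym2 V)}
    (hL : N.L = (Y.map fun y => s(x, y)) + L') {B : Finset V} (hxB : x ∉ B) :
    N.deg B = Y.countP (· ∈ B) + cut L' B + ∑ v ∈ B, (N.p v + N.q v) := by
  rw [deg, hL, cut_add, cut_star_of_notMem _ _ _ hxB]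

lemma Good.sum_erase {N : Net V} (h : N.Good) {x : V} (hx : x ∈ N.W) :
    ∑ v ∈ N.W.erase x, N.b v = -N.b x := by
  exact eq_neg_of_add_eq_zero_right (by rw [Finset.add_sum_erase _ _ hx, h.sum])

lemma ne_of_subset_erase {W B : Finset V} {x : V} (hx : x ∈ W) (hB : B ⊆ W.erase x) :
    B ⊆ W ∧ x ∉ B ∧ B ≠ W := by
  have hxB : x ∉ B := fun hxB => by simpa using hB hxB
  exact ⟨hB.trans (Finset.erase_subset _ _), hxB, fun he => hxB (he ▸ hx)⟩

lemma Critical.not_tight_of_root_free {N : Net V} (h : N.Critical) {x : V} (hx : x ∈ N.W)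
    (hdeg : N.deg {x} = 4) (htau : N.tau {x} = 0) (hp : N.p x = 0) (hq : N.q x = 0) :
    False := by
  obtain ⟨Y, L', hL, hxL, hxY, hYW, hc⟩ := h.toGood.exists_star x
  have hnd := h.nodup_star hL
  have hd := deg_singleton N x
  have hdW := h.toGood.deg_erase hx
  have htW := tau_erase N hx
  have hbx := tau_singleton N x
  have hhigh := h.high
  rw [htau, hp, hq, Nat.cast_zero, add_zero, sub_zero] at hbx
  obtain ⟨y₁, y₂, y₃, y₄, rfl⟩ := Multiset.card_eq_four.1 (show Multiset.card Y = 4 by omega)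
  simp only [Multiset.insert_eq_cons, Multiset.nodup_cons, Multiset.mem_cons,
    Multiset.mem_singleton, not_or, Multiset.nodup_singleton, and_true] at hnd hxY hYW
  have hYx : ∀ y, y = y₁ ∨ y = y₂ ∨ y = y₃ ∨ y = y₄ → y ∈ N.W.erase x := by
    rintro y hy
    refine Finset.mem_erase.2 ⟨?_, hYW y hy⟩
    rintro rfl
    tauto
  simp only [forall_eq_or_imp, forall_eq] at hYx
  obtain ⟨m₁, m₂, m₃, m₄⟩ := hYx
  let N' : Net V := ⟨N.W.erase x, s(y₁, y₂) ::ₘ s(y₃, y₄) ::ₘ L', N.b, N.p, N.q⟩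
  have hdeg' : ∀ B, x ∉ B → N'.deg B + 2 * (if y₁ ∈ B ∧ y₂ ∈ B then 1 else 0) +
      2 * (if y₃ ∈ B ∧ y₄ ∈ B then 1 else 0) = N.deg B := by
    intro B hxB
    rw [deg_of_star hL hxB]
    simp only [N', deg, cut_cons, crossing_mk, Multiset.insert_eq_cons, Multiset.countP_cons,
      ← Multiset.cons_zero, Multiset.countP_zero]
    by_cases h1 : y₁ ∈ B <;> by_cases h2 : y₂ ∈ B <;> by_cases h3 : y₃ ∈ B <;>
      by_cases h4 : y₄ ∈ B <;> simp [h1, h2, h3, h4] <;> omega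
  have htau' : ∀ B, N'.tau B = N.tau B := fun B => rfl
  have hmem : ∀ e ∈ N'.L, e = s(y₁, y₂) ∨ e = s(y₃, y₄) ∨ e ∈ L' := fun e he => by
    simpa [N'] using he
  have hxN' : ∀ e ∈ N'.L, x ∉ e := by
    intro e he
    rcases hmem e he with rfl | rfl | he'
    · simpa using ⟨hxY.1, hxY.2.1⟩
    · simpa using ⟨hxY.2.2.1, hxY.2.2.2⟩
    · exact hxL e he'
  have hL' : ∀ e ∈ L', e ∈ N.L := fun e he => by rw [hL]; exact Multiset.mem_add.2 (Or.inr he)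
  have hgood : N'.Good :=
    { mem := fun e he => by
        rcases hmem e he with rfl | rfl | he'
        · simp only [Sym2.mem_iff]
          rintro v (rfl | rfl) <;> assumption
        · simp only [Sym2.mem_iff]
          rintro v (rfl | rfl) <;> assumption
        · intro v hv
          refine Finset.mem_erase.2 ⟨?_, h.mem e (hL' e he') v hv⟩
          rintro rfl
          exact hxL e he' hv
      noloop := fun e he => by
        rcases hmem e he with rfl | rfl | he'
        · exact hnd.1.1
        · exact hnd.2.2
        · exact h.noloop e (hL' e he')
      sum := (h.toGood.sum_erase hx).trans (by rw [← hbx, neg_zero])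
      par := fun B hB => by
        obtain ⟨hBW, hxB, -⟩ := ne_of_subset_erase hx hB
        have h1 := hdeg' B hxB
        have h2 := h.par B hBW
        rw [htau']
        omega
      low := fun B hB hne hB' => by
        obtain ⟨hBW, hxB, hBne⟩ := ne_of_subset_erase hx hB
        have h1 := hdeg' B hxB
        rw [htau']
        by_cases h12 : y₁ ∈ B ∧ y₂ ∈ B
        · by_cases h34 : y₃ ∈ B ∧ y₄ ∈ B
          · have hlow := h.low (insert x B) (Finset.insert_subset hx hBW)
              (Finset.insert_nonempty _ _) (fun he => hB' (by
                show B = N.W.erase x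
                rw [← he, Finset.erase_insert hxB]))
            rw [tau_insert N hxB, htau, zero_add] at hlow
            have h2 : N.deg (insert x B) = N'.deg B := by
              rw [deg, hL, cut_star_insert hxL (by simpa using hxY) hxB, Finset.sum_insert hxB]
              simp only [N', deg, cut_cons, crossing_mk, Multiset.insert_eq_cons,
                Multiset.countP_cons, ← Multiset.cons_zero, Multiset.countP_zero, h12, h34, hp, hq]
              simp
            omega
          · have h2 := h.six_le_deg hBW (Finset.one_lt_card.2 ⟨_, h12.1, _, h12.2, hnd.1.1⟩) hBne
            simp only [h34, if_false] at h1
            split_ifs at h1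
            omega
        · by_cases h34 : y₃ ∈ B ∧ y₄ ∈ B
          · have h2 := h.six_le_deg hBW (Finset.one_lt_card.2 ⟨_, h34.1, _, h34.2, hnd.2.2⟩) hBne
            simp only [h12, if_false] at h1
            split_ifs at h1
            omega
          · have h2 := h.low B hBW hne hBne
            simp only [h12, h34, if_false] at h1
            omega
      high := by
        show N'.deg (N.W.erase x) ≤ 4 + circ (N.tau (N.W.erase x))
        have h1 := hdeg' (N.W.erase x) (by simp)
        simp only [m₁, m₂, m₃, m₄, and_self, if_true] at h1
        rw [htau, add_zero] at htW
        rw [htW]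
        omega }
  have hcard := Finset.card_erase_lt_of_mem hx
  obtain ⟨M, hM, hb⟩ := h.ih N' (size_lt_of_W hcard) hgood
  obtain ⟨M₁, hM₁, hb₁⟩ := exists_arcs_of_split_off (x := x) hM
  obtain ⟨M₂, hM₂, hb₂⟩ := exists_arcs_of_split_off (x := x) (y := y₃) (w := y₄) (M := M₁)
    (L := s(x, y₁) ::ₘ s(x, y₂) ::ₘ L') (by
      rw [hM₁, Multiset.cons_swap (s(x, y₂)), Multiset.cons_swap (s(x, y₁))])
  refine h.not_orientable ⟨M₂, ?_, fun v hv => ?_⟩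
  · rw [hM₂, hL]
    simp only [Multiset.insert_eq_cons, ← Multiset.cons_zero, Multiset.map_cons, Multiset.cons_add,
      Multiset.map_zero, zero_add]
    rw [Multiset.cons_swap (s(x, y₄)), Multiset.cons_swap (s(x, y₃)),
      Multiset.cons_swap (s(x, y₄)) (s(x, y₂)), Multiset.cons_swap (s(x, y₃)) (s(x, y₂))]
  · rw [hb₂, hb₁]
    by_cases hvx : v = x
    · subst hvx
      rw [← hbx]
      exact bdry_eq_zero M v fun a ha => hxN' _ (hM ▸ Multiset.mem_map_of_mem _ ha)
    · exact hb v (Finset.mem_erase.2 ⟨hvx, hv⟩)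

lemma Critical.not_tight_of_p {N : Net V} (h : N.Critical) {x : V} (hx : x ∈ N.W)
    (hdeg : N.deg {x} = 4) (htau : N.tau {x} = 0) (hp : N.p x = 1) (hq : N.q x = 0) :
    False := by
  obtain ⟨Y, L', hL, hxL, hxY, hYW, hc⟩ := h.toGood.exists_star x
  have hnd := h.nodup_star hL
  have hd := deg_singleton N x
  have hdW := h.toGood.deg_erase hx
  have htW := tau_erase N hx
  have hbx := tau_singleton N x
  have hhigh := h.high
  rw [htau, hp, hq, Nat.cast_zero, add_zero, Nat.cast_one, eq_comm, sub_eq_zero] at hbx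
  obtain ⟨y₁, y₂, y₃, rfl⟩ := Multiset.card_eq_three.1 (show Multiset.card Y = 3 by omega)
  simp only [Multiset.insert_eq_cons, Multiset.nodup_cons, Multiset.mem_cons,
    Multiset.mem_singleton, not_or, Multiset.nodup_singleton, and_true] at hnd hxY hYW
  have hYx : ∀ y, y = y₁ ∨ y = y₂ ∨ y = y₃ → y ∈ N.W.erase x := by
    rintro y hy
    refine Finset.mem_erase.2 ⟨?_, hYW y hy⟩
    rintro rfl
    tauto
  simp only [forall_eq_or_imp, forall_eq] at hYx
  obtain ⟨m₁, m₂, m₃⟩ := hYx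
  let N' : Net V := ⟨N.W.erase x, s(y₂, y₃) ::ₘ L', fun v => N.b v + (if v = y₁ then 1 else 0),
    fun v => N.p v + (if v = y₁ then 1 else 0), N.q⟩
  have hdeg' : ∀ B, x ∉ B → N'.deg B + 2 * (if y₂ ∈ B ∧ y₃ ∈ B then 1 else 0) = N.deg B := by
    intro B hxB
    rw [deg_of_star hL hxB]
    simp only [N', deg, cut_cons, crossing_mk, Multiset.insert_eq_cons, Multiset.countP_cons,
      ← Multiset.cons_zero, Multiset.countP_zero, Finset.sum_add_distrib, Finset.sum_ite_eq']
    by_cases h1 : y₁ ∈ B <;> by_cases h2 : y₂ ∈ B <;> by_cases h3 : y₃ ∈ B <;>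
      simp [h1, h2, h3] <;> omega
  have htau' : ∀ B, N'.tau B = N.tau B := fun B => by
    refine Finset.sum_congr rfl fun v _ => ?_
    simp only [N']
    push_cast
    ring
  have hmem : ∀ e ∈ N'.L, e = s(y₂, y₃) ∨ e ∈ L' := fun e he => by simpa [N'] using he
  have hxN' : ∀ e ∈ N'.L, x ∉ e := by
    intro e he
    rcases hmem e he with rfl | he'
    · simpa using hxY.2
    · exact hxL e he'
  have hL' : ∀ e ∈ L', e ∈ N.L := fun e he => by rw [hL]; exact Multiset.mem_add.2 (Or.inr he)
  have hgood : N'.Good :=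
    { mem := fun e he => by
        rcases hmem e he with rfl | he'
        · simp only [Sym2.mem_iff]
          rintro v (rfl | rfl) <;> assumption
        · intro v hv
          refine Finset.mem_erase.2 ⟨?_, h.mem e (hL' e he') v hv⟩
          rintro rfl
          exact hxL e he' hv
      noloop := fun e he => by
        rcases hmem e he with rfl | he'
        · exact hnd.2
        · exact h.noloop e (hL' e he')
      sum := by
        simp only [N', Finset.sum_add_distrib, Finset.sum_ite_eq', m₁, if_true,
          h.toGood.sum_erase hx, hbx, neg_add_cancel]
      par := fun B hB => by
        obtain ⟨hBW, hxB, -⟩ := ne_of_subset_erase hx hB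
        have h1 := hdeg' B hxB
        have h2 := h.par B hBW
        rw [htau']
        omega
      low := fun B hB hne hB' => by
        obtain ⟨hBW, hxB, hBne⟩ := ne_of_subset_erase hx hB
        have h1 := hdeg' B hxB
        rw [htau']
        by_cases h23 : y₂ ∈ B ∧ y₃ ∈ B
        · have h2 := h.six_le_deg hBW (Finset.one_lt_card.2 ⟨_, h23.1, _, h23.2, hnd.2⟩) hBne
          split_ifs at h1
          omega
        · have h2 := h.low B hBW hne hBne
          simp only [h23, if_false] at h1
          omega
      high := by
        show N'.deg (N.W.erase x) ≤ 4 + circ (N'.tau (N.W.erase x))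
        have h1 := hdeg' (N.W.erase x) (by simp)
        simp only [m₂, m₃, and_self, if_true] at h1
        rw [htau, add_zero] at htW
        rw [htau', htW]
        omega }
  have hcard := Finset.card_erase_lt_of_mem hx
  obtain ⟨M, hM, hb⟩ := h.ih N' (size_lt_of_W hcard) hgood
  obtain ⟨M₁, hM₁, hb₁⟩ := exists_arcs_of_split_off (x := x) hM
  refine h.not_orientable ⟨(x, y₁) ::ₘ M₁, ?_, fun v hv => ?_⟩
  · rw [Multiset.map_cons, hM₁, hL]
    simp
  · rw [bdry_cons, hb₁]
    by_cases hvx : v = x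
    · subst hvx
      rw [hbx, bdry_eq_zero M v fun a ha => hxN' _ (hM ▸ Multiset.mem_map_of_mem _ ha)]
      simp [hxY.1]
    · rw [hb v (Finset.mem_erase.2 ⟨hvx, hv⟩)]
      simp [hvx, N']

lemma Critical.not_tight {N : Net V} (h : N.Critical) {x : V} (hx : x ∈ N.W)
    (hdeg : N.deg {x} = 4) (htau : N.tau {x} = 0) : False := by
  have hd := deg_singleton N x
  have hdW := h.toGood.deg_erase hx
  have htW := tau_erase N hx
  have h6 := h.six_le_deg_erase hx
  have hhigh := h.high
  rw [htau, add_zero] at htW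
  rw [htW] at h6
  have hcases : N.p x = 0 ∧ N.q x = 0 ∨ N.p x = 1 ∧ N.q x = 0 ∨ N.p x = 0 ∧ N.q x = 1 := by omega
  rcases hcases with ⟨hp, hq⟩ | ⟨hp, hq⟩ | ⟨hp, hq⟩
  · exact h.not_tight_of_root_free hx hdeg htau hp hq
  · exact h.not_tight_of_p hx hdeg htau hp hq
  · exact h.rev.not_tight_of_p hx (by rw [deg_rev, hdeg]) (by rw [tau_rev, htau, neg_zero]) hq hp


/-! ### Structure of a minimal counterexample -/

/-- A vertex whose degree is the smallest allowed for its boundary `1` or `2`. -/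
def Tight (N : Net V) (x : V) : Prop :=
  N.tau {x} = 1 ∧ N.deg {x} = 5 ∨ N.tau {x} = 2 ∧ N.deg {x} = 6

lemma Critical.low_singleton {N : Net V} (h : N.Critical) {x : V} (hx : x ∈ N.W) :
    4 + circ (N.tau {x}) ≤ N.deg {x} := by
  refine h.low {x} (by simpa using hx) (by simp) fun he => ?_
  have := h.two_le_card
  rw [← he] at this
  simp at this

lemma circ_cases {t : ZMod 6} (h : circ t + 1 ≤ circ (t + 1)) : t = 0 ∨ t = 1 ∨ t = 2 := by
  revert t; decide

lemma Critical.tight_of_lt {N : Net V} (h : N.Critical) {x : V} (hx : x ∈ N.W)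
    (hlt : N.deg {x} < 5 + circ (N.tau {x} + 1)) : N.Tight x := by
  have h1 := h.low_singleton hx
  have h2 := h.par {x} (by simpa using hx)
  have h3 := circ_add_one (N.tau {x})
  have h4 : N.deg {x} = 4 + circ (N.tau {x}) := by omega
  rcases circ_cases (t := N.tau {x}) (by omega) with ht | ht | ht
  · exact (h.not_tight hx (by rw [h4, ht]; rfl) ht).elim
  · exact Or.inl ⟨ht, by rw [h4, ht]; rfl⟩
  · exact Or.inr ⟨ht, by rw [h4, ht]; rfl⟩

lemma Tight.five_add_le {N : Net V} {x : V} (h : N.Tight x) :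
    5 + circ (N.tau {x} - 1) ≤ N.deg {x} := by
  rcases h with ⟨h1, h2⟩ | ⟨h1, h2⟩ <;> rw [h1, h2] <;> decide

lemma Critical.tight_of_adj {N : Net V} (h : N.Critical) {x y : V} (hx : N.Tight x)
    (hxy : s(x, y) ∈ N.L) : N.Tight y := by
  refine h.tight_of_lt (h.mem _ hxy y (by simp)) ?_
  by_contra! hy
  obtain ⟨L', hL⟩ := Multiset.exists_cons_of_mem hxy
  exact h.not_of_edge hL hx.five_add_le hy

lemma Critical.tight_of_p_pos {N : Net V} (h : N.Critical) {x : V} (hx : x ∈ N.W)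
    (hp : 0 < N.p x) : ∀ y ∈ N.W, N.Tight y := by
  classical
  have hxt := h.tight_of_lt hx (h.deg_lt_of_p_pos hx hp)
  by_contra! hc
  obtain ⟨y, hy, hyt⟩ := hc
  let C := N.W.filter N.Tight
  have hCW : C ⊆ N.W := Finset.filter_subset _ _
  have hxC : x ∈ C := Finset.mem_filter.2 ⟨hx, hxt⟩
  have hyC : y ∉ C := fun hyC => hyt (Finset.mem_filter.1 hyC).2
  have hcut : cut N.L C = 0 := cut_eq_zero _ _ fun e he => by
    have hm := h.mem e he
    induction e using Sym2.ind with
    | _ u v =>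
      have h1 := hm u (by simp)
      have h2 := hm v (by simp)
      have h3 : u ∈ C ↔ v ∈ C := by
        simp only [C, Finset.mem_filter, h1, h2, true_and]
        exact ⟨fun hu => h.tight_of_adj hu he,
          fun hv => h.tight_of_adj hv (by rwa [Sym2.eq_swap])⟩
      simp [h3]
  have h1 := h.low C hCW ⟨x, hxC⟩ fun he => hyC (he ▸ hy)
  have h2 := h.low (N.W \ C) Finset.sdiff_subset ⟨y, Finset.mem_sdiff.2 ⟨hy, hyC⟩⟩ fun he => by
    rw [← he] at hx
    exact (Finset.mem_sdiff.1 hx).2 hxC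
  have h3 := h.deg_sdiff hCW
  have h4 := circ_add_le (N.tau (N.W \ C)) (N.tau C)
  rw [N.tau_sdiff hCW] at h4
  have h5 := h.high
  omega

lemma Critical.q_eq_zero {N : Net V} (h : N.Critical) (ht : ∀ y ∈ N.W, N.Tight y) {y : V}
    (hy : y ∈ N.W) : N.q y = 0 := by
  by_contra hq
  have h1 := h.deg_lt_of_q_pos hy (Nat.pos_of_ne_zero hq)
  have h2 := (ht y hy).five_add_le
  omega

lemma Critical.deg_tau_univ {N : Net V} (h : N.Critical) (ht : ∀ y ∈ N.W, N.Tight y) :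
    N.deg N.W = 5 ∧ N.tau N.W = 1 := by
  have h1 : N.deg N.W = ∑ v ∈ N.W, N.p v :=
    h.deg_univ.trans (Finset.sum_congr rfl fun v hv => by rw [h.q_eq_zero ht hv, add_zero])
  have h2 : N.tau N.W = -(N.deg N.W : ZMod 6) := by
    have : N.tau N.W = ∑ v ∈ N.W, (N.b v - N.p v) :=
      Finset.sum_congr rfl fun v hv => by rw [h.q_eq_zero ht hv, Nat.cast_zero, add_zero]
    rw [this, h1, Finset.sum_sub_distrib, h.sum, zero_sub]
    push_cast
    rfl
  have h3 := h.deg_univ_eq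
  have h4 := circ_le (N.tau N.W)
  rw [h2] at h3 h4 ⊢
  generalize N.deg N.W = d at *
  have : d = 4 ∨ d = 5 ∨ d = 6 ∨ d = 7 := by omega
  rcases this with rfl | rfl | rfl | rfl <;> revert h3 <;> decide

/-! ### Removing a vertex with all its edges oriented -/

lemma bdry_map_right (K : Multiset V) (x v : V) :
    bdry (K.map fun y => (y, x)) v = K.count v - if v = x then (Multiset.card K : ZMod 6) else 0 := by
  simp only [bdry, Multiset.map_map, Function.comp_def, Multiset.map_id', Multiset.map_const',
    Multiset.count_replicate, eq_comm (a := x)]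
  push_cast
  rfl

lemma bdry_map_left (K : Multiset V) (x v : V) :
    bdry (K.map fun y => (x, y)) v = (if v = x then (Multiset.card K : ZMod 6) else 0) - K.count v := by
  simp only [bdry, Multiset.map_map, Function.comp_def, Multiset.map_id', Multiset.map_const',
    Multiset.count_replicate, eq_comm (a := x)]
  push_cast
  rfl

lemma circ_sub_natCast (t : ZMod 6) (k : ℕ) : (circ (t - k) + circ t + k) % 2 = 0 := by
  induction k with
  | zero => simp; omega
  | succ k ih =>
    have := circ_sub_one (t - k)
    rw [Nat.cast_succ, ← sub_sub]
    omega

/-- Remove `x` after orienting the edges to `K` and `I` towards `x` and those to `O` away from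
`x`, where the edges to `I` and `O` become edges to the root. -/
lemma Good.exists_arcs_of_star {N : Net V} (h : N.Good) {x : V} (hx : x ∈ N.W)
    {K I O : Multiset V} {L' : Multiset (Sym2 V)}
    (hL : N.L = ((K + I + O).map fun y => s(x, y)) + L') (hxL : ∀ e ∈ L', x ∉ e)
    (hxY : x ∉ K + I + O) (hYW : ∀ y ∈ K + I + O, y ∈ N.W)
    (hb : N.b x = Multiset.card O - Multiset.card K - Multiset.card I)
    (hlow : ∀ B ⊆ N.W.erase x, B.Nonempty → B ≠ N.W.erase x →
      4 + circ (N.tau B - K.countP (· ∈ B)) + K.countP (· ∈ B) ≤ N.deg B)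
    (hhigh : N.deg (N.W.erase x) ≤
      4 + circ (N.tau (N.W.erase x) - Multiset.card K) + Multiset.card K)
    (ih : ∀ N' : Net V, N'.W.card < N.W.card → N'.Good → N'.Orientable) :
    ∃ M : Multiset (V × V), M.map und = N.L ∧ (∀ v ∈ N.W, bdry M v = N.b v) ∧
      ∀ y ∈ K, (y, x) ∈ M := by
  let N' : Net V := ⟨N.W.erase x, L', fun v => N.b v - K.count v - I.count v + O.count v,
    fun v => N.p v + O.count v, fun v => N.q v + I.count v⟩
  have hcount : ∀ Z : Multiset V, (∀ y ∈ Z, y ∈ K + I + O) →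
      Z.countP (· ∈ N.W.erase x) = Multiset.card Z := fun Z hZ =>
    Multiset.countP_eq_card.2 fun y hy => Finset.mem_erase.2
      ⟨by rintro rfl; exact hxY (hZ _ hy), hYW y (hZ y hy)⟩
  have hK := hcount K fun y hy => by simp [hy]
  have hI := hcount I fun y hy => by simp [hy]
  have hO := hcount O fun y hy => by simp [hy]
  have hdeg : ∀ B, x ∉ B → N'.deg B + K.countP (· ∈ B) = N.deg B := fun B hB => by
    rw [deg_of_star hL hB]
    simp only [N', deg, Finset.sum_add_distrib, sum_count, Multiset.countP_add]
    omega
  have htau : ∀ B, N'.tau B = N.tau B - K.countP (· ∈ B) := fun B => by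
    simp only [tau, ← sum_count_cast, ← Finset.sum_sub_distrib]
    refine Finset.sum_congr rfl fun v _ => ?_
    simp only [N']
    push_cast
    ring
  have hgood : N'.Good :=
    { mem := fun e he v hv => Finset.mem_erase.2
        ⟨by rintro rfl; exact hxL e he hv,
          h.mem e (by rw [hL]; exact Multiset.mem_add.2 (Or.inr he)) v hv⟩
      noloop := fun e he => h.noloop e (by rw [hL]; exact Multiset.mem_add.2 (Or.inr he))
      sum := by
        simp only [N', Finset.sum_add_distrib, Finset.sum_sub_distrib, sum_count_cast, hK, hI, hO,
          h.sum_erase hx, hb]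
        ring
      par := fun B hB => by
        obtain ⟨hBW, hxB, -⟩ := ne_of_subset_erase hx hB
        have h1 := h.par B hBW
        have h2 := hdeg B hxB
        have h3 := circ_sub_natCast (N.tau B) (K.countP (· ∈ B))
        rw [htau]
        omega
      low := fun B hB hne hB' => by
        have h1 := hlow B hB hne hB'
        have h2 := hdeg B (ne_of_subset_erase hx hB).2.1
        rw [htau]
        omega
      high := by
        have h2 := hdeg (N.W.erase x) (by simp)
        rw [htau]
        simp only [N', hK] at h2 ⊢
        omega }
  obtain ⟨M, hM, hbM⟩ := ih N' (Finset.card_erase_lt_of_mem hx) hgood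
  refine ⟨(K.map fun y => (y, x)) + (I.map fun y => (y, x)) + (O.map fun y => (x, y)) + M,
    ?_, fun v hv => ?_, fun y hy => ?_⟩
  · rw [hL, Multiset.map_add, hM]
    simp only [Multiset.map_add, Multiset.map_map, Function.comp_def, und_mk]
    simp only [Sym2.eq_swap (b := x)]
    rfl
  · simp only [bdry_add, bdry_map_left, bdry_map_right]
    by_cases hvx : v = x
    · subst hvx
      simp only [Multiset.mem_add, not_or] at hxY
      rw [bdry_eq_zero M v fun a ha => hxL _ (by
        have := Multiset.mem_map_of_mem und ha
        rwa [hM] at this)]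
      simp only [if_true, Multiset.count_eq_zero_of_notMem hxY.1.1,
        Multiset.count_eq_zero_of_notMem hxY.1.2, Multiset.count_eq_zero_of_notMem hxY.2, hb]
      ring
    · rw [hbM v (Finset.mem_erase.2 ⟨hvx, hv⟩)]
      simp only [hvx, if_false, N']
      ring
  · simp [hy]

lemma exists_eq_add_of_three_le {Y : Multiset V} (h : 3 ≤ Multiset.card Y) :
    ∃ y y' y'' O, Y = {y} + {y', y''} + O := by
  obtain ⟨n, hn⟩ := Nat.exists_eq_add_of_le' h
  obtain ⟨y, Y₁, rfl, hY₁⟩ := Multiset.card_eq_succ_iff.1 hn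
  obtain ⟨y', Y₂, rfl, hY₂⟩ := Multiset.card_eq_succ_iff.1 hY₁
  obtain ⟨y'', O, rfl, -⟩ := Multiset.card_eq_succ_iff.1 hY₂
  exact ⟨y, y', y'', O, by
    simp only [Multiset.insert_eq_cons, Multiset.singleton_add, Multiset.cons_add]⟩

lemma Critical.not_two_root_edges {N : Net V} (h : N.Critical) (ht : ∀ y ∈ N.W, N.Tight y)
    {x : V} (hx : x ∈ N.W) (hp : N.p x = 2) : False := by
  obtain ⟨Y, L', hL, hxL, hxY, hYW, hc⟩ := h.toGood.exists_star x
  have hd := deg_singleton N x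
  have hdW := h.toGood.deg_erase hx
  have htW := tau_erase N hx
  have hbx := tau_singleton N x
  obtain ⟨h5, h1⟩ := h.deg_tau_univ ht
  rw [hp, h.q_eq_zero ht hx, Nat.cast_zero, add_zero] at hbx
  rw [hp, h.q_eq_zero ht hx] at hd
  have hcard : 3 ≤ Multiset.card Y := by
    rcases ht x hx with ⟨-, ht'⟩ | ⟨-, ht'⟩ <;> omega
  obtain ⟨y, y', y'', O, rfl⟩ := exists_eq_add_of_three_le hcard
  simp only [Multiset.card_add, Multiset.card_singleton, Multiset.card_pair] at hc
  refine h.not_orientable ((h.toGood.exists_arcs_of_star hx hL hxL hxY hYW ?_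
    (fun B hB hne _ => ?_) ?_ fun N' hN' => h.ih N' (size_lt_of_W hN')).imp
    fun M hM => ⟨hM.1, hM.2.1⟩)
  · rcases ht x hx with ⟨ht', ht''⟩ | ⟨ht', ht''⟩ <;> rw [ht', eq_comm, sub_eq_iff_eq_add] at hbx
    · have : Multiset.card O = 0 := by omega
      rw [hbx, this, Multiset.card_singleton, Multiset.card_pair]
      decide
    · have : Multiset.card O = 1 := by omega
      rw [hbx, this, Multiset.card_singleton, Multiset.card_pair]
      decide
  · obtain ⟨hBW, hxB, hBne⟩ := ne_of_subset_erase hx hB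
    have h2 := h.low B hBW hne hBne
    rw [← Multiset.cons_zero, Multiset.countP_cons, Multiset.countP_zero]
    split_ifs with hyB
    · rcases le_or_gt B.card 1 with hc | hc
      · obtain rfl : B = {y} := Finset.eq_singleton_iff_unique_mem.2
          ⟨hyB, fun z hz => Finset.card_le_one.1 hc z hz y hyB⟩
        have := (ht y (by simpa using hBW)).five_add_le
        simp only [zero_add, Nat.cast_one]
        omega
      · have h3 := h.six_le_deg hBW hc hBne
        have h4 := circ_sub_one (N.tau B)
        simp only [zero_add, Nat.cast_one]
        omega
    · simpa using h2
  · rw [Multiset.card_singleton, Nat.cast_one]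
    rcases ht x hx with ⟨ht', ht''⟩ | ⟨ht', ht''⟩ <;>
      rw [ht', h1, ← eq_sub_iff_add_eq] at htW <;> rw [htW]
    · have : circ (1 - 1 - 1) = 1 := by decide
      omega
    · have : circ (1 - 2 - 1) = 2 := by decide
      omega

lemma Critical.p_le_two {N : Net V} (h : N.Critical) (ht : ∀ y ∈ N.W, N.Tight y)
    {x : V} (hx : x ∈ N.W) : N.p x ≤ 2 := by
  have hd := deg_singleton N x
  have hdW := h.toGood.deg_erase hx
  have htW := tau_erase N hx
  have h6 := h.six_le_deg_erase hx
  obtain ⟨h5, h1⟩ := h.deg_tau_univ ht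
  rcases ht x hx with ⟨ht', ht''⟩ | ⟨ht', ht''⟩ <;>
    rw [ht', h1, ← eq_sub_iff_add_eq] at htW <;> rw [htW] at h6
  · omega
  · have : circ (1 - 2) = 1 := by decide
    omega


/-! ### A vertex with a single edge to the root -/

lemma Critical.five_add_le {N : Net V} (h : N.Critical) (ht : ∀ y ∈ N.W, N.Tight y)
    {B : Finset V} (hB : B ⊆ N.W) (hne : B.Nonempty) (hBW : B ≠ N.W) :
    5 + circ (N.tau B - 1) ≤ N.deg B := by
  rcases le_or_gt B.card 1 with hc | hc
  · obtain ⟨y, hy⟩ := hne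
    obtain rfl : B = {y} := Finset.eq_singleton_iff_unique_mem.2
      ⟨hy, fun z hz => Finset.card_le_one.1 hc z hz y hy⟩
    exact (ht y (hB hy)).five_add_le
  · have h1 := h.six_le_deg hB hc hBW
    have h2 := circ_sub_one (N.tau B)
    omega

lemma contract_star {N : Net V} {A : Finset V} {a x : V} (ha : a ∈ A) (hxA : x ∉ A)
    {Y : Multiset V} {L' : Multiset (Sym2 V)} (hL : N.L = (Y.map fun y => s(x, y)) + L')
    (hxL : ∀ e ∈ L', x ∉ e) (hxY : x ∉ Y) :
    ∃ L'' : Multiset (Sym2 V),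
      (N.contract A a).L = ((Y.map (collapse A a)).map fun y => s(x, y)) + L'' ∧
        (∀ e ∈ L'', x ∉ e) ∧ x ∉ Y.map (collapse A a) := by
  have hx : ∀ u, collapse A a u = x → u = x := fun u hu => by
    unfold collapse at hu
    split_ifs at hu
    · exact absurd (hu ▸ ha) hxA
    · exact hu
  refine ⟨(L'.filter fun e => ¬ e.toFinset ⊆ A).map (Sym2.map (collapse A a)), ?_, ?_, ?_⟩
  · have h1 : (Y.map fun y => s(x, y)).filter (fun e => ¬ e.toFinset ⊆ A) =
        Y.map fun y => s(x, y) := Multiset.filter_eq_self.2 fun e he hsub => by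
      obtain ⟨y, -, rfl⟩ := Multiset.mem_map.1 he
      exact hxA (hsub (by simp))
    simp only [contract, outer, hL, Multiset.filter_add, h1, Multiset.map_add, Multiset.map_map,
      Function.comp_def, Sym2.map_mk]
    simp only [collapse, hxA, if_false]
  · intro e he hxe
    obtain ⟨f, hf, rfl⟩ := Multiset.mem_map.1 he
    obtain ⟨u, hu, hux⟩ := Sym2.mem_map.1 hxe
    exact hxL f (Multiset.mem_filter.1 hf).1 (hx u hux ▸ hu)
  · intro h
    obtain ⟨u, hu, hux⟩ := Multiset.mem_map.1 h
    exact hxY (hx u hux ▸ hu)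

lemma expand_erase {N : Net V} {A : Finset V} {a x : V} (hA : A ⊆ N.W) (ha : a ∈ A)
    (hxA : x ∉ A) : expand A a ((N.contract A a).W.erase x) = N.W.erase x := by
  have hax : a ≠ x := by rintro rfl; exact hxA ha
  ext v
  have hm : v ∈ expand A a ((N.contract A a).W.erase x) ↔
      collapse A a v ∈ (N.contract A a).W.erase x :=
    mem_expand_iff (W := N.W) (Finset.erase_subset _ _) v
  rw [hm, Finset.mem_erase, Finset.mem_erase]
  simp only [contract, collapse, Finset.mem_insert, Finset.mem_sdiff]
  by_cases hv : v ∈ A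
  · simp only [hv, if_true, true_or, and_true, hA hv]
    exact iff_of_true hax (by rintro rfl; exact hxA hv)
  · have : v ≠ a := by rintro rfl; exact hv ha
    simp [hv, this]

lemma circ_sub_two (t : ZMod 6) :
    circ (t - 2) ≤ circ t + 2 ∧ (circ (t - 2) ≤ circ t ∨ t = 0 ∨ t = -1) := by
  revert t; decide

/-- The sets at which orienting two edges from them to the outside is obstructed. -/
def Blocked (N : Net V) (A : Finset V) : Prop :=
  N.deg A = 6 + circ (N.tau A) ∧ (N.tau A = 0 ∨ N.tau A = -1)

lemma Critical.exists_arcs_contract {N : Net V} (h : N.Critical) (ht : ∀ y ∈ N.W, N.Tight y)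
    {x y z : V} {Y : Multiset V} {L' : Multiset (Sym2 V)} (hx : x ∈ N.W) (hp : N.p x = 1)
    (hL : N.L = ((y ::ₘ z ::ₘ Y).map fun y => s(x, y)) + L') (hxL : ∀ e ∈ L', x ∉ e)
    (hxY : x ∉ y ::ₘ z ::ₘ Y) (hY : Multiset.card (y ::ₘ z ::ₘ Y) = cut N.L {x})
    {A : Finset V} (hA : A ⊆ N.W) (hxA : x ∉ A) (hy : y ∈ A) (hz : z ∉ A)
    (hmax : ∀ B ⊆ N.W, A ⊆ B → x ∉ B → z ∈ B → ¬ N.Blocked B) :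
    ∃ M : Multiset (V × V), M.map und = (N.contract A y).L ∧
      (∀ v ∈ (N.contract A y).W, bdry M v = (N.contract A y).b v) ∧ (y, x) ∈ M := by
  have hd := deg_singleton N x
  have hdW := h.toGood.deg_erase hx
  have htW := tau_erase N hx
  have hbx := tau_singleton N x
  obtain ⟨h5, h1⟩ := h.deg_tau_univ ht
  rw [hp, h.q_eq_zero ht hx, Nat.cast_zero, add_zero, Nat.cast_one] at hbx
  rw [hp, h.q_eq_zero ht hx] at hd
  rw [Multiset.card_cons, Multiset.card_cons] at hY
  obtain ⟨c, Y₁, rfl, hY₁⟩ := Multiset.card_eq_succ_iff.1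
    (show Multiset.card Y = Multiset.card Y - 1 + 1 by
      rcases ht x hx with ⟨-, ht'⟩ | ⟨-, ht'⟩ <;> omega)
  obtain ⟨d, O, rfl, -⟩ := Multiset.card_eq_succ_iff.1
    (show Multiset.card Y₁ = Multiset.card Y₁ - 1 + 1 by
      rw [Multiset.card_cons] at hY
      rcases ht x hx with ⟨-, ht'⟩ | ⟨-, ht'⟩ <;> omega)
  rw [Multiset.card_cons, Multiset.card_cons] at hY
  obtain ⟨L'', hL'', hxL'', hxY''⟩ := contract_star hy hxA hL hxL hxY
  have hyx : x ≠ y := by rintro rfl; exact hxA hy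
  have hxN : x ∈ (N.contract A y).W := by simp [contract, hx, hxA]
  have hgood := h.toGood.contract hA hy
  have hsplit : (y ::ₘ z ::ₘ c ::ₘ d ::ₘ O).map (collapse A y) =
      {y, z} + {collapse A y c, collapse A y d} + O.map (collapse A y) := by
    have h2 : collapse A y y = y := by simp [collapse]
    have h3 : collapse A y z = z := by simp [collapse, hz]
    simp only [Multiset.map_cons, h2, h3, Multiset.insert_eq_cons, Multiset.singleton_add,
      Multiset.cons_add]
  rw [hsplit] at hL'' hxY''
  have hYW : ∀ u ∈ ({y, z} + {collapse A y c, collapse A y d} + O.map (collapse A y) : Multiset V),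
      u ∈ (N.contract A y).W := fun u hu => by
    refine hgood.mem s(x, u) ?_ u (by simp)
    rw [hL'']
    exact Multiset.mem_add.2 (Or.inl (Multiset.mem_map_of_mem _ hu))
  have hcontract := card_contract (a := y) hA
  have hApos : 0 < A.card := Finset.card_pos.2 ⟨y, hy⟩
  obtain ⟨M, hM, hb, hK⟩ : ∃ M : Multiset (V × V), M.map und = (N.contract A y).L ∧
      (∀ v ∈ (N.contract A y).W, bdry M v = (N.contract A y).b v) ∧
        ∀ u ∈ ({y, z} : Multiset V), (u, x) ∈ M := by
    refine hgood.exists_arcs_of_star hxN hL'' hxL'' hxY'' hYW ?_ (fun B hB hne hB' => ?_) ?_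
      fun N' hN' => h.ih N' (size_lt_of_W (by omega))
    · have : (N.contract A y).b x = N.b x := by simp [contract, hyx]
      rw [this, Multiset.card_map, Multiset.card_pair, Multiset.card_pair]
      rcases ht x hx with ⟨ht', ht''⟩ | ⟨ht', ht''⟩ <;> rw [ht', eq_comm, sub_eq_iff_eq_add] at hbx
      · have : Multiset.card O = 0 := by omega
        rw [hbx, this]
        decide
      · have : Multiset.card O = 1 := by omega
        rw [hbx, this]
        decide
    · obtain ⟨hBW, hxB, hBne⟩ := ne_of_subset_erase hxN hB
      rw [deg_contract hy hBW, tau_contract hy hBW]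
      have hEW := expand_subset hA hy hBW
      have hEne : (expand A y B).Nonempty := expand_nonempty hne
      have hE : expand A y B ≠ N.W := fun he => hBne ((expand_eq_univ hA hy hBW).1 he)
      have h2 := h.five_add_le ht hEW hEne hE
      have h3 := h.low _ hEW hEne hE
      rw [Multiset.insert_eq_cons, Multiset.countP_cons, ← Multiset.cons_zero,
        Multiset.countP_cons, Multiset.countP_zero]
      by_cases hyB : y ∈ B
      · by_cases hzB : z ∈ B
        · have hAE : A ⊆ expand A y B := by
            rw [expand, if_pos hyB]
            exact Finset.subset_union_right
          have hzE : z ∈ expand A y B := by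
            rw [mem_expand_iff hBW, collapse, if_neg hz]
            exact hzB
          have hxE : x ∉ expand A y B := by
            rw [mem_expand_iff hBW, collapse, if_neg hxA]
            exact hxB
          have h4 := hmax _ hEW hAE hxE hzE
          have h5 := h.six_le_deg hEW (Finset.one_lt_card.2 ⟨y, hAE hy, z, hzE, by
            rintro rfl
            exact hz hy⟩) hE
          have h6 := h.par _ hEW
          have h7 := circ_sub_two (N.tau (expand A y B))
          have h8 : N.deg (expand A y B) = 6 + circ (N.tau (expand A y B)) →
              ¬ (N.tau (expand A y B) = 0 ∨ N.tau (expand A y B) = -1) := fun h9 h10 =>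
            h4 ⟨h9, h10⟩
          simp only [hyB, hzB, if_true, zero_add, Nat.reduceAdd, Nat.cast_ofNat]
          by_cases h9 : N.deg (expand A y B) = 6 + circ (N.tau (expand A y B))
          · have h10 := h7.2.resolve_right (h8 h9)
            omega
          · omega
        · simp only [hyB, hzB, if_true, if_false, zero_add, Nat.cast_one]
          omega
      · by_cases hzB : z ∈ B
        · simp only [hyB, hzB, if_true, if_false, zero_add, add_zero, Nat.cast_one]
          omega
        · simpa [hyB, hzB] using h3
    · rw [deg_contract hy (Finset.erase_subset _ _), tau_contract hy (Finset.erase_subset _ _),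
        expand_erase hA hy hxA, Multiset.card_pair, Nat.cast_ofNat]
      rcases ht x hx with ⟨ht', ht''⟩ | ⟨ht', ht''⟩ <;>
        rw [ht', h1, ← eq_sub_iff_add_eq] at htW <;> rw [htW]
      · have : circ (1 - 1 - 2) = 2 := by decide
        omega
      · have : circ (1 - 2 - 2) = 3 := by decide
        omega
  exact ⟨M, hM, hb, hK y (by simp)⟩

/-- A set with one more edge to the root than allowed is handled once some edge of the root comes
from the set. -/
lemma Critical.orientable_of_q_pos {N N₂ : Net V} (h : N.Critical)
    (ht : ∀ y ∈ N.W, N.Tight y) {A : Finset V} (hA : A ⊆ N.W) (hAW : A ≠ N.W)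
    (hW : N₂.W = A) (hL : N₂.L = N.inner A) (hdeg : ∀ B ⊆ A, N₂.deg B = N.deg B)
    (htau : ∀ B, N₂.tau B = N.tau B) (hsum : ∑ v ∈ A, N₂.b v = 0)
    {u : V} (hu : u ∈ A) (hq : 0 < N₂.q u) (hA' : N.Blocked A) : N₂.Orientable := by
  let N' : Net V := ⟨N₂.W, N₂.L, N₂.b, N₂.p, fun v => N₂.q v - (if v = u then 1 else 0)⟩
  have hq' : ∀ v, N₂.q v = N'.q v + (if v = u then 1 else 0) := fun v => by
    simp only [N']
    split_ifs with hv
    · subst hv; omega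
    · rfl
  have hdeg' : ∀ B ⊆ A, N'.deg B + (if u ∈ B then 1 else 0) = N.deg B := fun B hB => by
    rw [← hdeg B hB]
    simp only [deg, hq', Finset.sum_add_distrib, Finset.sum_ite_eq']
    simp only [N']
    omega
  have htau' : ∀ B, N'.tau B = N.tau B - (if u ∈ B then 1 else 0) := fun B => by
    rw [← htau B]
    simp only [tau, hq', Nat.cast_add, Nat.cast_ite, Nat.cast_one, Nat.cast_zero,
      Finset.sum_add_distrib, Finset.sum_sub_distrib, Finset.sum_ite_eq']
    simp only [N']
    ring
  have hgood : N'.Good :=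
    { mem := fun e he v hv => by
        have he' : e ∈ N.inner A := hL ▸ he
        show v ∈ N₂.W
        rw [hW]
        exact (Multiset.mem_filter.1 he').2 (by simpa using hv)
      noloop := fun e he => by
        have he' : e ∈ N.inner A := hL ▸ he
        exact h.noloop e (Multiset.mem_filter.1 he').1
      sum := by
        show ∑ v ∈ N₂.W, N₂.b v = 0
        rw [hW, hsum]
      par := fun B hB => by
        have hB' : B ⊆ A := hW ▸ hB
        have h1 := h.par B (hB'.trans hA)
        have h2 := hdeg' B hB'
        have h3 := circ_sub_one (N.tau B)
        rw [htau']
        split_ifs at h2 ⊢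
        · omega
        · rw [sub_zero]; omega
      low := fun B hB hne _ => by
        have hB' : B ⊆ A := hW ▸ hB
        have hBW : B ≠ N.W := fun he => hAW (Finset.Subset.antisymm hA (he ▸ hB'))
        have h1 := h.five_add_le ht (hB'.trans hA) hne hBW
        have h2 := hdeg' B hB'
        have h3 := h.low B (hB'.trans hA) hne hBW
        rw [htau']
        split_ifs at h2 ⊢
        · omega
        · rw [sub_zero]; omega
      high := by
        have hWA : N'.W = A := hW
        have h1 := hdeg' A (Finset.Subset.refl A)
        rw [hWA, htau']
        rw [if_pos hu] at h1 ⊢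
        obtain ⟨h2, h3 | h3⟩ := hA' <;> rw [h3] at h2 ⊢ <;> rw [h2] at h1
        · have : circ 0 + 1 = circ (0 - 1) := by decide
          omega
        · have : circ (-1) + 1 = circ (-1 - 1) := by decide
          omega }
  refine h.ih N' (size_lt_of_W ?_) hgood
  have hWA : N'.W = A := hW
  rw [hWA]
  exact Finset.card_lt_card (Finset.ssubset_iff_subset_ne.2 ⟨hA, hAW⟩)

lemma Critical.not_one_root_edge {N : Net V} (h : N.Critical) (ht : ∀ y ∈ N.W, N.Tight y)
    {x : V} (hx : x ∈ N.W) (hp : N.p x = 1) : False := by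
  classical
  obtain ⟨Y, L', hL, hxL, hxY, hYW, hc⟩ := h.toGood.exists_star x
  have hnd := h.nodup_star hL
  have hd := deg_singleton N x
  obtain ⟨h5, h1⟩ := h.deg_tau_univ ht
  have hqx := h.q_eq_zero ht hx
  rw [hp, hqx] at hd
  have hxt := ht x hx
  obtain ⟨y, hyY⟩ := Multiset.card_pos_iff_exists_mem.1 (show 0 < Multiset.card Y by
    rcases hxt with ⟨-, ht'⟩ | ⟨-, ht'⟩ <;> omega)
  have hyx : y ≠ x := by rintro rfl; exact hxY hyY
  obtain ⟨A, hAF, hAmax⟩ := Finset.exists_max_image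
    (N.W.powerset.filter fun A => y ∈ A ∧ x ∉ A ∧ (A = {y} ∨ N.Blocked A)) Finset.card
    ⟨{y}, by simp [hYW y hyY, hyx.symm]⟩
  simp only [Finset.mem_filter, Finset.mem_powerset] at hAF hAmax
  obtain ⟨hA, hyA, hxA, hAF⟩ := hAF
  have hAW : A ≠ N.W := by rintro rfl; exact hxA hx
  obtain ⟨z, hzY, hzA⟩ : ∃ z ∈ Y, z ∉ A := by
    by_contra! hYA
    rcases hAF with rfl | ⟨hAd, hAt⟩
    · have h2 : Y.toFinset.card ≤ ({y} : Finset V).card := Finset.card_le_card fun z hz =>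
        hYA z (Multiset.mem_toFinset.1 hz)
      rw [Multiset.toFinset_card_of_nodup hnd, Finset.card_singleton] at h2
      rcases hxt with ⟨-, ht'⟩ | ⟨-, ht'⟩ <;> omega
    · have h2 := deg_of_star hL hxA
      rw [Multiset.countP_eq_card.2 hYA] at h2
      have h3 : N.deg (insert x A) = cut L' A + ∑ v ∈ A, (N.p v + N.q v) + 1 := by
        rw [deg, hL, cut_star_insert hxL hxY hxA, Finset.sum_insert hxA, hp, hqx,
          Multiset.countP_eq_zero.2 fun z hz hzA => hzA (hYA z hz)]
        omega
      have h4 : circ (N.tau A) ≤ 1 := by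
        rcases hAt with hAt | hAt <;> rw [hAt] <;> decide
      by_cases hW : insert x A = N.W
      · rw [hW] at h3
        rcases hxt with ⟨-, ht'⟩ | ⟨-, ht'⟩ <;> omega
      · have h6 := h.six_le_deg (Finset.insert_subset hx hA)
          (Finset.one_lt_card.2 ⟨x, by simp, y, by simp [hyA], hyx.symm⟩) hW
        rcases hxt with ⟨-, ht'⟩ | ⟨-, ht'⟩ <;> omega
  obtain ⟨Y₁, rfl⟩ := Multiset.exists_cons_of_mem hyY
  have hzY₁ : z ∈ Y₁ := (Multiset.mem_cons.1 hzY).resolve_left (by rintro rfl; exact hzA hyA)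
  obtain ⟨Y₂, rfl⟩ := Multiset.exists_cons_of_mem hzY₁
  obtain ⟨M₁, hM₁, hb₁, hyM₁⟩ := h.exists_arcs_contract ht hx hp hL hxL hxY hc hA hxA hyA hzA
    fun B hB hAB hxB hzB hBb => by
      have h2 := hAmax B ⟨hB, hAB hyA, hxB, Or.inr hBb⟩
      exact hzA (Finset.eq_of_subset_of_card_le hAB h2 ▸ hzB)
  obtain ⟨N₂, hW, hL₂, hdeg, htau, hsum, hq, ho⟩ := exists_residual hyA hM₁ hb₁
  refine h.not_orientable (ho ?_)
  rcases hAF with hAy | hAb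
  · refine h.ih N₂ (size_lt_of_W ?_) (h.toGood.of_inner hA hAW hW hL₂ hdeg htau hsum ?_)
    · rw [hW]
      exact Finset.card_lt_card (Finset.ssubset_iff_subset_ne.2 ⟨hA, hAW⟩)
    · rw [hAy]
      rcases ht y (hA hyA) with ⟨h2, h3⟩ | ⟨h2, h3⟩ <;> rw [h2, h3] <;> decide
  · obtain ⟨u, hu, hqu⟩ := hq x hxA hyM₁
    exact h.orientable_of_q_pos ht hA hAW hW hL₂ hdeg htau hsum hu hqu hAb

lemma Critical.p_eq_zero {N : Net V} (h : N.Critical) {x : V} (hx : x ∈ N.W) : N.p x = 0 := by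
  by_contra hp
  have ht := h.tight_of_p_pos hx (Nat.pos_of_ne_zero hp)
  have h2 := h.p_le_two ht hx
  have h3 : N.p x = 1 ∨ N.p x = 2 := by omega
  rcases h3 with h3 | h3
  · exact h.not_one_root_edge ht hx h3
  · exact h.not_two_root_edges ht hx h3

lemma not_critical (N : Net V) : ¬ N.Critical := fun h => by
  have h1 := h.deg_univ_eq
  rw [h.deg_univ, Finset.sum_eq_zero fun v hv => by
    rw [h.p_eq_zero hv, show N.q v = 0 from h.rev.p_eq_zero hv, add_zero]] at h1
  omega

theorem Good.orientable {N : Net V} (h : N.Good) : N.Orientable := by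
  induction hs : N.size using WellFoundedLT.induction generalizing N with
  | ind s ih =>
    subst hs
    by_contra ho
    exact N.not_critical ⟨h, fun N' hN' hg => ih _ hN' hg rfl, ho⟩

end Net

lemma exists_orientation {E : Type} (f g : E → V) (S : Finset E) {M : Multiset (V × V)}
    (h : M.map und = S.val.map fun e => s(f e, g e)) :
    ∃ o : E → Bool, M = S.val.map fun e => if o e then (f e, g e) else (g e, f e) := by
  classical
  induction S using Finset.induction_on generalizing M with
  | empty => exact ⟨fun _ => true, by simpa using h⟩
  | insert e S he ih =>
    rw [Finset.insert_val_of_notMem he, Multiset.map_cons] at h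
    obtain ⟨a, ha, hae⟩ := Multiset.mem_map.1 (h ▸ Multiset.mem_cons_self _ _)
    obtain ⟨M, rfl⟩ := Multiset.exists_cons_of_mem ha
    rw [Multiset.map_cons, hae, Multiset.cons_inj_right] at h
    obtain ⟨o, rfl⟩ := ih h
    refine ⟨Function.update o e (decide (a = (f e, g e))), ?_⟩
    rw [Finset.insert_val_of_notMem he, Multiset.map_cons]
    congr 1
    · rcases Sym2.eq_iff.1 hae with ⟨h1, h2⟩ | ⟨h1, h2⟩ <;>
        simp only [Function.update_self, decide_eq_true_eq] <;> split_ifs with h3 <;>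
        simp_all [Prod.ext_iff]
    · refine Multiset.map_congr rfl fun e' he' => ?_
      have : e' ≠ e := by rintro rfl; exact he he'
      simp [this]

lemma crossing_cast (A : Finset V) (u v : V) :
    (crossing A s(u, v) : ZMod 2) = (if u ∈ A then 1 else 0) + (if v ∈ A then 1 else 0) := by
  by_cases hu : u ∈ A <;> by_cases hv : v ∈ A <;> simp [hu, hv]
  decide

lemma sum_cut_singleton_mod_two (L : Multiset (Sym2 V)) (A : Finset V) :
    (∑ v ∈ A, cut L {v}) % 2 = cut L A % 2 := by
  refine (ZMod.natCast_eq_natCast_iff' _ _ 2).1 ?_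
  push_cast
  induction L using Multiset.induction_on with
  | empty => simp
  | cons e L ih =>
    induction e with | _ x y
    simp only [cut_cons, Nat.cast_add, Finset.sum_add_distrib, ih, crossing_cast,
      Finset.mem_singleton, Finset.sum_ite_eq]

lemma circ_three_mul (n : ℕ) : circ ((3 * n : ℕ) : ZMod 6) = 3 * (n % 2) := by
  rw [circ, ZMod.val_natCast]
  omega

/-- The net on all vertices whose orientations have boundary divisible by `3`. -/
def parityNet [Fintype V] (L : Multiset (Sym2 V)) : Net V where
  W := Finset.univ
  L := L
  b v := ((3 * cut L {v} : ℕ) : ZMod 6)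
  p _ := 0
  q _ := 0

lemma parityNet_deg [Fintype V] (L : Multiset (Sym2 V)) (A : Finset V) :
    (parityNet L).deg A = cut L A := by
  simp [Net.deg, parityNet]

lemma parityNet_tau [Fintype V] (L : Multiset (Sym2 V)) (A : Finset V) :
    (parityNet L).tau A = ((3 * cut L A : ℕ) : ZMod 6) := by
  have h : (parityNet L).tau A = ((3 * ∑ v ∈ A, cut L {v} : ℕ) : ZMod 6) := by
    simp [Net.tau, parityNet, Finset.mul_sum]
  rw [h]
  refine (ZMod.natCast_eq_natCast_iff' _ _ 6).2 ?_
  have := sum_cut_singleton_mod_two L A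
  omega

lemma cut_univ [Fintype V] (L : Multiset (Sym2 V)) : cut L Finset.univ = 0 := by
  induction L using Multiset.induction_on with
  | empty => simp
  | cons e L ih =>
    induction e with | _ x y
    simp [cut_cons, ih]

lemma parityNet_good [Fintype V] {L : Multiset (Sym2 V)} (hL : ∀ e ∈ L, ¬ e.IsDiag)
    (h : ∀ A : Finset V, A.Nonempty → A ≠ Finset.univ → 6 ≤ cut L A) : (parityNet L).Good where
  mem _ _ v _ := Finset.mem_univ v
  noloop := hL
  sum := by
    have := parityNet_tau L Finset.univ
    rw [cut_univ] at this
    simpa [Net.tau, parityNet] using this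
  par A _ := by
    rw [parityNet_deg, parityNet_tau, circ_three_mul]
    omega
  low A _ hA hA' := by
    rw [parityNet_deg, parityNet_tau, circ_three_mul]
    have := h A hA hA'
    omega
  high := by
    rw [parityNet_deg]
    exact (cut_univ L).trans_le (Nat.zero_le _)

end BoundaryNet

namespace Multigraph

variable {V E : Type} [Fintype E] (G : Multigraph V E)

/-- The multiset of unordered pairs of end vertices of the edges. -/
def ends : Multiset (Sym2 V) := Finset.univ.val.map fun e => s(G.fst e, G.snd e)

lemma cut_ends [DecidableEq V] (A : Finset V) :
    BoundaryNet.cut G.ends A = (G.cutEdges A).ncard := by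
  classical
  have : G.cutEdges A = ↑(Finset.univ.filter fun e => ¬ (G.fst e ∈ A ↔ G.snd e ∈ A)) := by
    ext e
    simp only [cutEdges, Set.mem_ofPred_eq, Finset.mem_coe, Finset.mem_filter, Finset.mem_univ,
      true_and]
    tauto
  rw [this, Set.ncard_coe_finset, Finset.card_filter]
  simp only [BoundaryNet.cut, ends, Multiset.map_map, Function.comp_def,
    BoundaryNet.crossing_mk, ite_not]
  rfl

lemma ncard_eq_count [DecidableEq V] (f : E → V) (v : V) :
    {e | f e = v}.ncard = (Finset.univ.val.map f).count v := by
  classical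
  rw [Multiset.count_map, Set.ncard_eq_toFinset_card']
  simp [Finset.card, eq_comm]

end Multigraph

/-- every `6`-edge-connected graph admits a nowhere-zero
`3`-flow, i.e. an orientation in which `d⁺(v) ≡ d⁻(v) (mod 3)` at every
vertex `v`. -/
theorem nowhere_zero_three_flow_of_six_edge_connected
    {V E : Type} [Fintype V] [Fintype E] (G : Multigraph V E)
    (h : G.EdgeConnected 6) :
    ∃ o : E → Bool, ∀ v : V, (G.outDeg o v : ZMod 3) = (G.inDeg o v : ZMod 3) := by
  classical
  have hgood : (BoundaryNet.parityNet G.ends).Good := by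
    refine BoundaryNet.parityNet_good (fun e he => ?_) fun A hA hA' => ?_
    · obtain ⟨e, -, rfl⟩ := Multiset.mem_map.1 he
      exact G.loopless e
    · rw [G.cut_ends]
      exact h.2 A (by simpa using hA) fun hu => hA' (by simpa using hu)
  obtain ⟨M, hM, hb⟩ := hgood.orientable
  obtain ⟨o, rfl⟩ := BoundaryNet.exists_orientation G.fst G.snd Finset.univ hM
  refine ⟨o, fun v => ?_⟩
  have hout : G.outDeg o v = (Finset.univ.val.map (G.tail o)).count v := by
    rw [← Multigraph.ncard_eq_count]
    simp [Multigraph.outDeg, Multigraph.outDegOn]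
  have hin : G.inDeg o v = (Finset.univ.val.map (G.head o)).count v :=
    Multigraph.ncard_eq_count _ _
  have hv := congr_arg (ZMod.castHom (by norm_num : 3 ∣ 6) (ZMod 3)) (hb v (Finset.mem_univ v))
  simp only [BoundaryNet.bdry, BoundaryNet.parityNet, map_sub, map_natCast, Multiset.map_map,
    Function.comp_def, apply_ite Prod.fst, apply_ite Prod.snd, Nat.cast_mul] at hv
  rw [hout, hin, ← sub_eq_zero]
  refine hv.trans ?_
  rw [map_mul]
  exact zero_mul _
end
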